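/- arXiv:1911.10936 — 2 statements merged into one kernel-verified Lean document; each statement's English description precedes it below -/
import Mathlib

section
/- The function u^T solves the nonlinear PDE of the 4-expert prediction problem: for every 0 ≤ t < T and every x ∈ ℝ⁴, ∂_t u^T(t,x) + (1/2) max_{J ⊆ {1,2,3,4}} e_J^⊤ ∂²_{xx} u^T(t,x) e_J = 0; moreover, if x₁ ≤ x₂ ≤ x₃ ≤ x₄ then the maximum is attained at the comb set J = {2,4}. -/
open MeasureTheory Finset

noncomputable section

/-- The 2π-periodic square wave ψ(r) = sign(sin r). -/
def psi (r : ℝ) : ℝ := Real.sign (Real.sin r)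

/-- The vectors α_k ∈ ℝ⁴, α_{k,j} = 3/√2 if k = j and −1/√2 otherwise. -/
def alph : Fin 4 → Fin 4 → ℝ := fun k j => if k = j then 3 / Real.sqrt 2 else -(1 / Real.sqrt 2)

/-- The vector θ = (1/√2)(1,1,−1,−1) ∈ ℝ⁴. -/
def theta : Fin 4 → ℝ :=
  ![1 / Real.sqrt 2, 1 / Real.sqrt 2, -(1 / Real.sqrt 2), -(1 / Real.sqrt 2)]

/-- Euclidean dot product on ℝ⁴. -/
def dot (a b : Fin 4 → ℝ) : ℝ := ∑ j, a j * b j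

/-- The auxiliary function Λ(r,x). -/
def Lam (r : ℝ) (x : Fin 4 → ℝ) : ℝ :=
  psi (r * dot theta x + Real.pi / 2) * (∑ k, Real.cos (r * dot (alph k) x)) - 4
    - psi (r * dot theta x) * (∑ k, Real.sin (r * dot (alph k) x))

/-- x^o : the increasing rearrangement of the coordinates of x. -/
def sortv (x : Fin 4 → ℝ) : Fin 4 → ℝ := fun i => x (Tuple.sort x i)

/-- The function u^T(t,x). -/
def u (T t : ℝ) (x : Fin 4 → ℝ) : ℝ :=
  -(1 / (16 * Real.sqrt 2)) *
      (∫ r : ℝ, Real.exp (-(T - t) * r ^ 2) * Lam r (sortv x) / r ^ 2)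
    + (1 / 4) * ∑ i, x i + (1 / 2) * Real.sqrt ((T - t) * Real.pi / 2)

/-- Partial derivative in the i-th coordinate. -/
def pd (i : Fin 4) (f : (Fin 4 → ℝ) → ℝ) (x : Fin 4 → ℝ) : ℝ :=
  deriv (fun s => f (Function.update x i s)) (x i)

/-- Gaussian kernel. -/
def ff (τ z : ℝ) : ℝ := 8 * Real.sqrt (Real.pi / τ) * Real.exp (-(2 * z ^ 2 / τ))

/-- First antiderivative. -/
def gd (τ z : ℝ) : ℝ := ∫ r : ℝ, Real.exp (-τ * r ^ 2) * (2 * Real.sqrt 2 * Real.sin (2 * Real.sqrt 2 * r * z) / r)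

/-- Second antiderivative. -/
def gg (τ z : ℝ) : ℝ := ∫ r : ℝ, Real.exp (-τ * r ^ 2) * ((1 - Real.cos (2 * Real.sqrt 2 * r * z)) / r ^ 2)

lemma gauss_cos (τ : ℝ) (hτ : 0 < τ) (ω : ℝ) :
    ∫ r : ℝ, Real.exp (-τ * r ^ 2) * Real.cos (ω * r) =
      Real.sqrt (Real.pi / τ) * Real.exp (-(ω ^ 2 / (4 * τ))) := by
  have h := fourierIntegral_gaussian (b := (τ : ℂ)) (by simpa using hτ) (ω : ℂ)
  have h2 : (∫ x : ℝ, Complex.exp (Complex.I * ω * x) * Complex.exp (-(τ : ℂ) * x ^ 2)).re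
      = ∫ r : ℝ, Real.exp (-τ * r ^ 2) * Real.cos (ω * r) := by
    have hint : Integrable (fun x : ℝ => Complex.exp (Complex.I * ω * x) * Complex.exp (-(τ : ℂ) * x ^ 2)) := by
      have := integrable_cexp_quadratic (b := (τ : ℂ)) (by simpa using hτ) (Complex.I * ω) 0
      refine this.congr (Filter.Eventually.of_forall fun x => ?_)
      simp only
      rw [← Complex.exp_add]; ring_nf
    have := integral_re hint
    simp only [RCLike.re_to_complex] at this
    rw [← this]
    congr 1; ext x
    rw [← Complex.exp_add]
    have : Complex.I * ω * x + -(τ : ℂ) * x ^ 2 = ((-τ * x ^ 2 : ℝ) : ℂ) + ((ω * x : ℝ) : ℂ) * Complex.I := by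
      push_cast; ring
    rw [this, Complex.exp_add, Complex.exp_mul_I, ← Complex.ofReal_exp, ← Complex.ofReal_cos, ← Complex.ofReal_sin]
    rw [Complex.re_ofReal_mul, Complex.add_re, Complex.mul_I_re, Complex.ofReal_re, Complex.ofReal_im]
    ring
  rw [← h2, h]
  have e1 : ((Real.pi : ℂ) / τ) ^ (1 / 2 : ℂ) = ((Real.sqrt (Real.pi / τ) : ℝ) : ℂ) := by
    rw [Real.sqrt_eq_rpow, Complex.ofReal_cpow (by positivity)]
    push_cast; rfl
  have e2 : Complex.exp (-(ω : ℂ) ^ 2 / (4 * τ)) = ((Real.exp (-(ω ^ 2 / (4 * τ))) : ℝ) : ℂ) := by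
    push_cast; congr 1; ring
  rw [e1, e2, ← Complex.ofReal_mul, Complex.ofReal_re]

lemma gint (τ : ℝ) (hτ : 0 < τ) : Integrable (fun r : ℝ => Real.exp (-τ * r ^ 2)) :=
  integrable_exp_neg_mul_sq hτ

lemma gauss_total (τ : ℝ) : ∫ r : ℝ, Real.exp (-τ * r ^ 2) = Real.sqrt (Real.pi / τ) :=
  integral_gaussian τ

lemma gauss_cos_ff (τ : ℝ) (hτ : 0 < τ) (z : ℝ) :
    ∫ r : ℝ, Real.exp (-τ * r ^ 2) * Real.cos (2 * Real.sqrt 2 * r * z) = ff τ z / 8 := by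
  have := gauss_cos τ hτ (2 * Real.sqrt 2 * z)
  have e : ∀ r : ℝ, 2 * Real.sqrt 2 * r * z = 2 * Real.sqrt 2 * z * r := fun r => by ring
  simp only [e]
  rw [this, ff]
  have h2 : (2 * Real.sqrt 2 * z) ^ 2 = 8 * z ^ 2 := by
    rw [mul_pow, mul_pow, Real.sq_sqrt (by norm_num)]; ring
  rw [h2]
  have : 8 * z ^ 2 / (4 * τ) = 2 * z ^ 2 / τ := by field_simp; ring
  rw [this]; ring

lemma s2sq : (Real.sqrt 2) * (Real.sqrt 2) = 2 := Real.mul_self_sqrt (by norm_num)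

lemma one_sub_cos_bd (a : ℝ) : |1 - Real.cos a| ≤ a ^ 2 / 2 := by
  rw [abs_of_nonneg (by linarith [Real.cos_le_one a])]
  linarith [Real.one_sub_sq_div_two_le_cos (x := a)]

lemma gg_bd (r z : ℝ) : |(1 - Real.cos (2 * Real.sqrt 2 * r * z)) / r ^ 2| ≤ 4 * z ^ 2 := by
  rcases eq_or_ne r 0 with rfl | hr
  · simp; positivity
  rw [abs_div, abs_of_nonneg (sq_nonneg r), div_le_iff₀ (by positivity)]
  refine (one_sub_cos_bd _).trans (le_of_eq ?_)
  rw [mul_pow, mul_pow, mul_pow, Real.sq_sqrt (by norm_num)]; ring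

lemma gg_integrable (τ : ℝ) (hτ : 0 < τ) (z : ℝ) :
    Integrable (fun r : ℝ => Real.exp (-τ * r ^ 2) * ((1 - Real.cos (2 * Real.sqrt 2 * r * z)) / r ^ 2)) := by
  refine (gint τ hτ).mul_bdd (c := 4 * z ^ 2) ?_ ?_
  · exact (by fun_prop : Measurable _).aestronglyMeasurable
  · exact Filter.Eventually.of_forall fun r => gg_bd r z

lemma gd_bd0 (r z : ℝ) : |2 * Real.sqrt 2 * Real.sin (2 * Real.sqrt 2 * r * z) / r| ≤ 8 * |z| := by
  rcases eq_or_ne r 0 with rfl | hr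
  · simp
  rw [abs_div, div_le_iff₀ (by positivity), abs_mul, abs_of_nonneg (by positivity : (0:ℝ) ≤ 2 * Real.sqrt 2)]
  have := Real.abs_sin_le_abs (x := 2 * Real.sqrt 2 * r * z)
  calc _ ≤ 2 * Real.sqrt 2 * |2 * Real.sqrt 2 * r * z| := by gcongr
    _ = _ := by
      rw [abs_mul, abs_mul, abs_of_nonneg (by positivity : (0:ℝ) ≤ 2 * Real.sqrt 2)]
      linear_combination (4 * |r| * |z|) * s2sq

lemma gd_integrable (τ : ℝ) (hτ : 0 < τ) (z : ℝ) :
    Integrable (fun r : ℝ => Real.exp (-τ * r ^ 2) * (2 * Real.sqrt 2 * Real.sin (2 * Real.sqrt 2 * r * z) / r)) := by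
  refine (gint τ hτ).mul_bdd (c := 8 * |z|) ?_ ?_
  · exact (by fun_prop : Measurable _).aestronglyMeasurable
  · exact Filter.Eventually.of_forall fun r => gd_bd0 r z

lemma gg_deriv (τ : ℝ) (hτ : 0 < τ) (z : ℝ) : HasDerivAt (gg τ) (gd τ z) z := by
  refine (hasDerivAt_integral_of_dominated_loc_of_deriv_le (s := Metric.ball z 1)
    (F' := fun z r => Real.exp (-τ * r ^ 2) * (2 * Real.sqrt 2 * Real.sin (2 * Real.sqrt 2 * r * z) / r))
    (bound := fun r => Real.exp (-τ * r ^ 2) * (8 * (|z| + 1)))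
    (Metric.ball_mem_nhds z one_pos) ?_ (gg_integrable τ hτ z) ?_ ?_ ?_ ?_).2
  · exact Filter.Eventually.of_forall fun x => (gg_integrable τ hτ x).1
  · exact (gd_integrable τ hτ z).1
  · refine Filter.Eventually.of_forall fun r x hx => ?_
    rw [norm_mul, Real.norm_of_nonneg (Real.exp_pos _).le]
    gcongr
    refine (gd_bd0 r x).trans ?_
    have : |x| ≤ |z| + 1 := by
      have h1 : |x - z| < 1 := by simpa [Real.dist_eq] using hx
      have := abs_sub_abs_le_abs_sub x z
      linarith
    linarith
  · exact (gint τ hτ).mul_const _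
  · refine Filter.Eventually.of_forall fun r x hx => ?_
    apply HasDerivAt.const_mul
    rcases eq_or_ne r 0 with rfl | hr
    · simpa using hasDerivAt_const x (0:ℝ)
    have h1 : HasDerivAt (fun x => 2 * Real.sqrt 2 * r * x) (2 * Real.sqrt 2 * r) x := by
      simpa using (hasDerivAt_id x).const_mul (2 * Real.sqrt 2 * r)
    have h2 := ((h1.cos).const_sub 1).div_const (r ^ 2)
    convert! h2 using 1
    field_simp

lemma gd_deriv (τ : ℝ) (hτ : 0 < τ) (z : ℝ) : HasDerivAt (gd τ) (ff τ z) z := by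
  have key := (hasDerivAt_integral_of_dominated_loc_of_deriv_le (s := Set.univ) (x₀ := z) (μ := volume)
    (F := fun z r => Real.exp (-τ * r ^ 2) * (2 * Real.sqrt 2 * Real.sin (2 * Real.sqrt 2 * r * z) / r))
    (F' := fun z r => Real.exp (-τ * r ^ 2) * (8 * Real.cos (2 * Real.sqrt 2 * r * z)))
    (bound := fun r => Real.exp (-τ * r ^ 2) * 8)
    Filter.univ_mem ?_ (gd_integrable τ hτ z) ?_ ?_ ?_ ?_).2
  · have e : ∫ r : ℝ, Real.exp (-τ * r ^ 2) * (8 * Real.cos (2 * Real.sqrt 2 * r * z)) = ff τ z := by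
      have e2 : ∀ r : ℝ, Real.exp (-τ * r ^ 2) * (8 * Real.cos (2 * Real.sqrt 2 * r * z)) =
        8 * (Real.exp (-τ * r ^ 2) * Real.cos (2 * Real.sqrt 2 * r * z)) := fun r => by ring
      simp only [e2]
      rw [integral_const_mul, gauss_cos_ff τ hτ]; ring
    rw [e] at key
    exact key
  · exact Filter.Eventually.of_forall fun x => (gd_integrable τ hτ x).1
  · exact (by fun_prop : Continuous _).aestronglyMeasurable
  · refine Filter.Eventually.of_forall fun r x hx => ?_
    rw [norm_mul, Real.norm_of_nonneg (Real.exp_pos _).le]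
    gcongr
    rw [Real.norm_eq_abs, abs_mul, abs_of_nonneg (by norm_num : (0:ℝ) ≤ 8)]
    linarith [Real.abs_cos_le_one (2 * Real.sqrt 2 * r * x)]
  · exact (gint τ hτ).mul_const _
  · have : ∀ᵐ r : ℝ, r ≠ 0 := by simp [ae_iff]
    filter_upwards [this] with r hr x hx
    apply HasDerivAt.const_mul
    have h1 : HasDerivAt (fun x => 2 * Real.sqrt 2 * r * x) (2 * Real.sqrt 2 * r) x := by
      simpa using (hasDerivAt_id x).const_mul (2 * Real.sqrt 2 * r)
    have h2 := ((h1.sin).const_mul (2 * Real.sqrt 2)).div_const r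
    convert! h2 using 1
    field_simp
    linear_combination (-4 * Real.cos (2 * Real.sqrt 2 * r * x)) * s2sq

lemma ff_pos (τ : ℝ) (hτ : 0 < τ) (z : ℝ) : 0 < ff τ z := by unfold ff; positivity

lemma ff_neg (τ z : ℝ) : ff τ (-z) = ff τ z := by simp [ff]

lemma gd_neg (τ z : ℝ) : gd τ (-z) = - gd τ z := by
  unfold gd
  rw [← integral_neg]
  congr 1; ext r
  rw [mul_neg, Real.sin_neg]; ring

lemma gg_neg (τ z : ℝ) : gg τ (-z) = gg τ z := by
  unfold gg
  congr 1; ext r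
  rw [mul_neg, Real.cos_neg]

lemma gd_zero (τ : ℝ) : gd τ 0 = 0 := by simp [gd]
lemma gg_zero (τ : ℝ) : gg τ 0 = 0 := by simp [gg]

lemma gg_nonneg (τ z : ℝ) : 0 ≤ gg τ z := by
  apply integral_nonneg
  intro r
  have := Real.cos_le_one (2 * Real.sqrt 2 * r * z)
  have : 0 ≤ 1 - Real.cos (2 * Real.sqrt 2 * r * z) := by linarith
  simp only [Pi.zero_apply]
  positivity

lemma ff_cont (τ : ℝ) : Continuous (ff τ) := by unfold ff; fun_prop

lemma ff_integrable (τ : ℝ) (hτ : 0 < τ) : Integrable (ff τ) := by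
  unfold ff
  apply Integrable.const_mul
  have := integrable_exp_neg_mul_sq (b := 2 / τ) (by positivity)
  refine this.congr (Filter.Eventually.of_forall fun x => ?_)
  simp only; congr 1; ring

lemma gd_bounded (τ : ℝ) (hτ : 0 < τ) : ∃ K, 0 < K ∧ ∀ z, |gd τ z| ≤ K := by
  refine ⟨(∫ x, ff τ x) + 1, ?_, fun z => ?_⟩
  · have : 0 ≤ ∫ x, ff τ x := integral_nonneg fun x => (ff_pos τ hτ x).le
    linarith
  have h := intervalIntegral.integral_eq_sub_of_hasDerivAt (a := 0) (b := z) (fun x _ => gd_deriv τ hτ x)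
    ((ff_cont τ).intervalIntegrable _ _)
  rw [gd_zero, sub_zero] at h
  rw [← h]
  have h2 := intervalIntegral.norm_integral_le_integral_norm_uIoc (f := ff τ) (a := 0) (b := z) (μ := volume)
  have h3 : ∫ x in Set.uIoc 0 z, ‖ff τ x‖ ≤ ∫ x, ‖ff τ x‖ :=
    setIntegral_le_integral (ff_integrable τ hτ).norm (Filter.Eventually.of_forall fun x => norm_nonneg _)
  have h4 : ∫ x, ‖ff τ x‖ = ∫ x, ff τ x := by
    congr 1; ext x; exact Real.norm_of_nonneg (ff_pos τ hτ x).le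
  rw [Real.norm_eq_abs] at h2
  linarith

lemma gg_lip (τ : ℝ) (hτ : 0 < τ) (K : ℝ) (hK : ∀ z, |gd τ z| ≤ K) (x y : ℝ) :
    |gg τ x - gg τ y| ≤ K * |x - y| := by
  have := Convex.norm_image_sub_le_of_norm_hasDerivWithin_le (f := gg τ) (f' := gd τ) (s := Set.univ) (C := K)
    (fun x _ => (gg_deriv τ hτ x).hasDerivWithinAt) (fun x _ => hK x) convex_univ (Set.mem_univ y) (Set.mem_univ x)
  simpa using this

lemma gg_le (τ : ℝ) (hτ : 0 < τ) (K : ℝ) (hK : ∀ z, |gd τ z| ≤ K) (x : ℝ) :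
    gg τ x ≤ K * |x| := by
  have := gg_lip τ hτ K hK x 0
  rw [gg_zero, sub_zero, sub_zero, abs_of_nonneg (gg_nonneg τ x)] at this
  exact this

lemma ff_anti (τ : ℝ) (hτ : 0 < τ) {x y : ℝ} (h : |x| ≤ |y|) : ff τ y ≤ ff τ x := by
  unfold ff
  have : x ^ 2 ≤ y ^ 2 := sq_le_sq.mpr h
  have h2 : 2 * x ^ 2 / τ ≤ 2 * y ^ 2 / τ := by gcongr
  exact mul_le_mul_of_nonneg_left (Real.exp_le_exp.mpr (by linarith)) (by positivity)

lemma ff_decay (τ : ℝ) (hτ : 0 < τ) : ∃ C, 0 < C ∧ ∀ z, ff τ z ≤ C / (1 + z ^ 2) := by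
  refine ⟨8 * Real.sqrt (Real.pi / τ) * (1 + τ / 2), by positivity, fun z => ?_⟩
  unfold ff
  rw [mul_div_assoc (8 * Real.sqrt (Real.pi / τ))]
  refine mul_le_mul_of_nonneg_left ?_ (by positivity)
  rw [Real.exp_neg, inv_eq_one_div, div_le_div_iff₀ (by positivity) (by positivity)]
  have h1 := Real.add_one_le_exp (2 * z ^ 2 / τ)
  calc 1 * (1 + z ^ 2) ≤ (1 + τ / 2) * (2 * z ^ 2 / τ + 1) := by
        have : (1 + τ / 2) * (2 * z ^ 2 / τ + 1) = 1 + z ^ 2 + τ / 2 + 2 * z ^ 2 / τ := by field_simp; ring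
        rw [this]
        have : 0 ≤ 2 * z ^ 2 / τ := by positivity
        linarith
    _ ≤ _ := by gcongr

lemma sum_inv_sq : Summable (fun n : ℤ => 1 / (1 + (n : ℝ) ^ 2)) := by
  have h := (Real.summable_one_div_int_pow (p := 2)).mpr (by norm_num)
  have h0 : Summable (fun n : ℤ => if n = 0 then (1:ℝ) else 0) :=
    summable_of_ne_finset_zero (s := {0}) (fun b hb => by simp at hb; simp [hb])
  refine Summable.of_nonneg_of_le (fun n => by positivity) (fun n => ?_) (h.add h0)
  rcases eq_or_ne n 0 with rfl | hn
  · simp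
  · simp only [hn, if_false, add_zero]
    have : (0:ℝ) < (n:ℝ) ^ 2 := by positivity
    gcongr
    linarith

lemma int_sq_ge_one {n : ℤ} (hn : n ≠ 0) : (1:ℝ) ≤ (n:ℝ) ^ 2 := by
  have : (1:ℤ) ≤ n ^ 2 := by
    have := sq_pos_of_ne_zero hn
    lia
  exact_mod_cast this

lemma four_sq_bd (n : ℤ) : 1 + (n:ℝ) ^ 2 ≤ |1 - 4 * (n:ℝ) ^ 2| := by
  rcases eq_or_ne n 0 with rfl | hn
  · simp
  · have := int_sq_ge_one hn
    rw [abs_sub_comm]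
    refine le_trans ?_ (le_abs_self _)
    linarith

lemma sin_int (n : ℤ) : ∫ x in (0:ℝ)..Real.pi, Complex.exp (-(2 * n * Complex.I) * x) * (Real.sin x : ℂ)
    = 2 / (1 - 4 * (n:ℂ) ^ 2) := by
  have hne : (1 - 4 * (n:ℂ) ^ 2) ≠ 0 := by
    have := four_sq_bd n
    have h2 : (1 - 4 * (n:ℝ) ^ 2) ≠ 0 := by
      intro h; rw [h] at this; simp at this; nlinarith [sq_nonneg (n:ℝ)]
    exact_mod_cast h2
  set l : ℂ := -(2 * n * Complex.I) with hl
  have hl2 : l ^ 2 = -(4 * (n:ℂ) ^ 2) := by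
    rw [hl]; ring_nf; rw [Complex.I_sq]; ring
  have hd : ∀ x : ℝ, HasDerivAt (fun x : ℝ => Complex.exp (l * x) * (-(1 / (1 - 4 * (n:ℂ) ^ 2)) * (Real.cos x : ℂ)
      + l / (1 - 4 * (n:ℂ) ^ 2) * (Real.sin x : ℂ))) (Complex.exp (l * x) * (Real.sin x : ℂ)) x := by
    intro x
    have h1 : HasDerivAt (fun x : ℝ => Complex.exp (l * x)) (Complex.exp (l * x) * l) x := by
      have : HasDerivAt (fun x : ℝ => l * (x:ℂ)) l x := by
        simpa using (Complex.ofRealCLM.hasDerivAt (x := x)).const_mul l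
      exact this.cexp
    have h2 : HasDerivAt (fun x : ℝ => (Real.cos x : ℂ)) ((-Real.sin x : ℝ) : ℂ) x := (Real.hasDerivAt_cos x).ofReal_comp
    have h3 : HasDerivAt (fun x : ℝ => (Real.sin x : ℂ)) ((Real.cos x : ℝ) : ℂ) x := (Real.hasDerivAt_sin x).ofReal_comp
    have h4 := h1.mul ((h2.const_mul (-(1 / (1 - 4 * (n:ℂ) ^ 2)))).add (h3.const_mul (l / (1 - 4 * (n:ℂ) ^ 2))))
    convert! h4 using 1
    simp only [Pi.add_apply]
    push_cast
    field_simp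
    linear_combination (-(Complex.sin x)) * hl2
  rw [intervalIntegral.integral_eq_sub_of_hasDerivAt (fun x _ => hd x)
    (by apply Continuous.intervalIntegrable; fun_prop)]
  have hexp : Complex.exp (l * Real.pi) = 1 := by
    rw [Complex.exp_eq_one_iff]
    exact ⟨-n, by rw [hl]; push_cast; ring⟩
  rw [hexp]
  simp
  field_simp
  ring

lemma abs_sin_per : Function.Periodic (fun x : ℝ => ((|Real.sin x| : ℝ) : ℂ)) Real.pi := by
  intro x; simp [Real.sin_add_pi]

lemma abs_sin_fourier (x : ℝ) :
    HasSum (fun n : ℤ => 2 / Real.pi * (1 / (1 - 4 * (n:ℝ) ^ 2)) * Real.cos (2 * n * x)) |Real.sin x| := by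
  have : Fact (0 < Real.pi) := ⟨Real.pi_pos⟩
  let f : C(AddCircle Real.pi, ℂ) := ⟨abs_sin_per.lift, by
    refine continuous_coinduced_dom.mpr ?_
    have : (abs_sin_per.lift ∘ (QuotientAddGroup.mk : ℝ → AddCircle Real.pi)) = fun x : ℝ => ((|Real.sin x| : ℝ) : ℂ) := by
      ext x; exact abs_sin_per.lift_coe x
    have h2 : Continuous (fun x : ℝ => ((|Real.sin x| : ℝ) : ℂ)) := by fun_prop
    change Continuous (abs_sin_per.lift ∘ (QuotientAddGroup.mk : ℝ → AddCircle Real.pi))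
    rw [this]; exact h2⟩
  have hf : ∀ x : ℝ, f (x : AddCircle Real.pi) = ((|Real.sin x| : ℝ) : ℂ) := fun x => abs_sin_per.lift_coe x
  have hc : ∀ n : ℤ, fourierCoeff f n = ((2 / Real.pi * (1 / (1 - 4 * (n:ℝ) ^ 2)) : ℝ) : ℂ) := by
    intro n
    rw [fourierCoeff_eq_intervalIntegral f n 0, zero_add]
    have : ∫ x in (0:ℝ)..Real.pi, @fourier Real.pi (-n) (x : AddCircle Real.pi) • f x = 2 / (1 - 4 * (n:ℂ) ^ 2) := by
      rw [← sin_int n]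
      apply intervalIntegral.integral_congr
      intro x hx
      rw [Set.uIcc_of_le Real.pi_pos.le] at hx
      simp only
      rw [hf, fourier_coe_apply, abs_of_nonneg (Real.sin_nonneg_of_mem_Icc hx), smul_eq_mul]
      congr 2
      have : (Real.pi : ℂ) ≠ 0 := by exact_mod_cast Real.pi_ne_zero
      push_cast
      field_simp
    rw [this, Complex.real_smul]
    push_cast; ring
  have hs : Summable (fourierCoeff f) := by
    refine Summable.of_norm_bounded (sum_inv_sq.mul_left (2 / Real.pi)) fun n => ?_
    rw [hc, Complex.norm_real, Real.norm_eq_abs, abs_mul, abs_of_nonneg (by positivity : 0 ≤ 2 / Real.pi), abs_div, abs_one]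
    have := four_sq_bd n
    gcongr
  have h := has_pointwise_sum_fourier_series_of_summable hs (x : AddCircle Real.pi)
  rw [hf] at h
  have h2 := Complex.hasSum_re h
  rw [Complex.ofReal_re] at h2
  refine h2.congr_fun ?_
  intro n
  rw [hc, smul_eq_mul, Complex.re_ofReal_mul, fourier_coe_apply]
  congr 1
  have e : 2 * (Real.pi : ℂ) * Complex.I * n * x / Real.pi = ((2 * n * x : ℝ) : ℂ) * Complex.I := by
    have : (Real.pi : ℂ) ≠ 0 := by exact_mod_cast Real.pi_ne_zero
    push_cast
    field_simp
  rw [e, Complex.exp_ofReal_mul_I_re]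

/-- Coefficients. -/
def ca (m : ℤ) : ℝ := 1 / (1 - 16 * (m:ℝ) ^ 2)
/-- Coefficients. -/
def cb (m : ℤ) : ℝ := 1 / ((4 * (m:ℝ) + 1) * (4 * (m:ℝ) + 3))

lemma abs_cos_fourier (x : ℝ) :
    HasSum (fun n : ℤ => 2 / Real.pi * (1 / (1 - 4 * (n:ℝ) ^ 2)) * ((-1) ^ n * Real.cos (2 * n * x))) |Real.cos x| := by
  have h := abs_sin_fourier (x + Real.pi / 2)
  rw [Real.sin_add_pi_div_two] at h
  refine h.congr_fun fun n => ?_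
  congr 1
  have : 2 * (n:ℝ) * (x + Real.pi / 2) = 2 * n * x + n * Real.pi := by ring
  rw [this, Real.cos_add_int_mul_pi]

lemma PA_sum (φ : ℝ) : HasSum (fun m : ℤ => ca m * Real.cos (4 * m * φ))
    (Real.pi / 4 * (|Real.cos φ| + |Real.sin φ|)) := by
  have h := ((abs_cos_fourier φ).add (abs_sin_fourier φ)).mul_left (Real.pi / 4)
  have hinj : Function.Injective (fun m : ℤ => 2 * m) := fun a b h => by simpa using h
  rw [← hinj.hasSum_iff] at h
  · refine h.congr_fun fun m => ?_
    simp only [Function.comp]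
    have e : ((-1:ℝ)) ^ (2 * m) = 1 := by rw [zpow_mul]; simp
    rw [e, ca]
    push_cast
    have : (1 - 4 * (2 * (m:ℝ)) ^ 2) = 1 - 16 * (m:ℝ) ^ 2 := by ring
    rw [this]
    have : 2 * (2 * (m:ℝ)) * φ = 4 * m * φ := by ring
    rw [this]
    field_simp
    ring
  · intro n hn
    have : Odd n := by
      rw [← Int.not_even_iff_odd]
      rintro ⟨k, rfl⟩
      exact hn ⟨k, by simp; ring⟩
    rw [this.neg_one_zpow]; ring

lemma PB_sum (φ : ℝ) : HasSum (fun m : ℤ => cb m * Real.cos ((4 * m + 2) * φ))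
    (Real.pi / 4 * (|Real.cos φ| - |Real.sin φ|)) := by
  have h := ((abs_cos_fourier φ).sub (abs_sin_fourier φ)).mul_left (Real.pi / 4)
  have hinj : Function.Injective (fun m : ℤ => 2 * m + 1) := fun a b h => by simpa using h
  rw [← hinj.hasSum_iff] at h
  · refine h.congr_fun fun m => ?_
    simp only [Function.comp]
    have ho : Odd (2 * m + 1) := ⟨m, rfl⟩
    have e : ((-1:ℝ)) ^ (2 * m + 1) = -1 := ho.neg_one_zpow
    rw [e, cb]
    push_cast
    have : (1 - 4 * (2 * (m:ℝ) + 1) ^ 2) = -((4 * (m:ℝ) + 1) * (4 * (m:ℝ) + 3)) := by ring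
    rw [this]
    have : 2 * (2 * (m:ℝ) + 1) * φ = (4 * m + 2) * φ := by ring
    rw [this, div_neg]
    have := Real.pi_ne_zero
    generalize 1 / ((4 * (m:ℝ) + 1) * (4 * (m:ℝ) + 3)) = q
    field_simp
    ring
  · intro n hn
    have : Even n := by
      rw [← Int.not_odd_iff_even]
      rintro ⟨k, rfl⟩
      exact hn ⟨k, by simp⟩
    rw [this.neg_one_zpow]; ring

lemma ca_sum : HasSum ca (Real.pi / 4) := by simpa using PA_sum 0
lemma cb_sum : HasSum cb (Real.pi / 4) := by simpa using PB_sum 0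

/-- Slope vectors. -/
def la (m : ℤ) : Fin 4 → ℝ := ![-(m:ℝ), -(m:ℝ), (m:ℝ) - 1 / 2, (m:ℝ) + 1 / 2]
/-- Slope vectors. -/
def lb (m : ℤ) : Fin 4 → ℝ := ![-(m:ℝ), -(m:ℝ) - 1, (m:ℝ) + 1 / 2, (m:ℝ) + 1 / 2]
/-- Linear forms. -/
def La (m : ℤ) (y : Fin 4 → ℝ) : ℝ :=
  -(m:ℝ) * y 0 - (m:ℝ) * y 1 + ((m:ℝ) - 1 / 2) * y 2 + ((m:ℝ) + 1 / 2) * y 3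
/-- Linear forms. -/
def Lb (m : ℤ) (y : Fin 4 → ℝ) : ℝ :=
  -(m:ℝ) * y 0 - ((m:ℝ) + 1) * y 1 + ((m:ℝ) + 1 / 2) * y 2 + ((m:ℝ) + 1 / 2) * y 3
/-- Total gap. -/
def pp (y : Fin 4 → ℝ) : ℝ := y 2 + y 3 - y 0 - y 1

/-- The potential. -/
def Fs (τ : ℝ) (y : Fin 4 → ℝ) : ℝ :=
  ∑' m : ℤ, (ca m * gg τ (La m y) + cb m * gg τ (Lb m y))
/-- Its gradient. -/
def Gr (τ : ℝ) (k : Fin 4) (y : Fin 4 → ℝ) : ℝ :=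
  ∑' m : ℤ, (ca m * la m k * gd τ (La m y) + cb m * lb m k * gd τ (Lb m y))
/-- Its Hessian. -/
def He (τ : ℝ) (k l : Fin 4) (y : Fin 4 → ℝ) : ℝ :=
  if pp y = 0 then Real.pi / 32 * ff τ 0 * (if k = l then 3 else -1)
  else ∑' m : ℤ, (ca m * la m k * la m l * ff τ (La m y) + cb m * lb m k * lb m l * ff τ (Lb m y))

lemma int_cases (m : ℤ) : (m:ℝ) ≤ -2 ∨ (m:ℝ) = -1 ∨ (m:ℝ) = 0 ∨ (1:ℝ) ≤ m := by
  have : m ≤ -2 ∨ m = -1 ∨ m = 0 ∨ 1 ≤ m := by lia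
  rcases this with h | h | h | h
  · left; exact_mod_cast h
  · right; left; exact_mod_cast h
  · right; right; left; exact_mod_cast h
  · right; right; right; exact_mod_cast h

lemma ne41 (m : ℤ) : 4 * (m:ℝ) + 1 ≠ 0 := by
  have : 4 * m + 1 ≠ 0 := by lia
  exact_mod_cast this
lemma ne14 (m : ℤ) : 1 - 4 * (m:ℝ) ≠ 0 := by
  have : 1 - 4 * m ≠ 0 := by lia
  exact_mod_cast this
lemma ne43 (m : ℤ) : 4 * (m:ℝ) + 3 ≠ 0 := by
  have : 4 * m + 3 ≠ 0 := by lia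
  exact_mod_cast this
lemma ca_eq (m : ℤ) : ca m = 1 / ((1 - 4 * (m:ℝ)) * (4 * (m:ℝ) + 1)) := by
  unfold ca; congr 1; ring
lemma den_a (m : ℤ) : 1 + (m:ℝ) ^ 2 ≤ |1 - 16 * (m:ℝ) ^ 2| := by
  rcases int_cases m with h | h | h | h
  · rw [abs_sub_comm]; refine le_trans ?_ (le_abs_self _); nlinarith
  · rw [h]; norm_num
  · rw [h]; norm_num
  · rw [abs_sub_comm]; refine le_trans ?_ (le_abs_self _); nlinarith
lemma den_b (m : ℤ) : 1 + (m:ℝ) ^ 2 ≤ (4 * (m:ℝ) + 1) * (4 * (m:ℝ) + 3) := by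
  rcases int_cases m with h | h | h | h
  · nlinarith
  · rw [h]; norm_num
  · rw [h]; norm_num
  · nlinarith
lemma den_c (m : ℤ) : (1 + |(m:ℝ)|) / 2 ≤ |4 * (m:ℝ) + 3| := by
  rcases int_cases m with h | h | h | h
  · rw [abs_of_neg (by linarith), abs_of_neg (by linarith)]; linarith
  · rw [h]; norm_num
  · rw [h]; norm_num
  · rw [abs_of_nonneg (by linarith), abs_of_nonneg (by linarith)]; linarith
lemma ca_bd (m : ℤ) : |ca m| ≤ 1 / (1 + (m:ℝ) ^ 2) := by
  unfold ca; rw [abs_div, abs_one]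
  exact one_div_le_one_div_of_le (by positivity) (den_a m)
lemma cb_pos (m : ℤ) : 0 < cb m := by
  unfold cb; have := den_b m; have := sq_nonneg (m:ℝ); apply one_div_pos.mpr; linarith
lemma cb_bd (m : ℤ) : cb m ≤ 1 / (1 + (m:ℝ) ^ 2) := by
  unfold cb
  exact one_div_le_one_div_of_le (by positivity) (den_b m)
lemma cab_eq (m : ℤ) : ca m + cb m = 4 / ((1 - 16 * (m:ℝ) ^ 2) * (4 * (m:ℝ) + 3)) := by
  rw [ca_eq, cb]
  have e : (1 - 16 * (m:ℝ) ^ 2) = (1 - 4 * (m:ℝ)) * (4 * (m:ℝ) + 1) := by ring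
  rw [e]
  have := ne41 m; have := ne14 m; have := ne43 m
  field_simp; ring
lemma cab_bd (m : ℤ) : |ca m + cb m| ≤ 8 / ((1 + (m:ℝ) ^ 2) * (1 + |(m:ℝ)|)) := by
  rw [cab_eq, abs_div, abs_mul]
  have h1 := den_a m; have h2 := den_c m
  have : |(4:ℝ)| = 4 := by norm_num
  rw [this]
  have e : 8 / ((1 + (m:ℝ) ^ 2) * (1 + |(m:ℝ)|)) = 4 / ((1 + (m:ℝ) ^ 2) * ((1 + |(m:ℝ)|) / 2)) := by
    field_simp; norm_num
  rw [e]
  gcongr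
lemma la_bd (m : ℤ) (k : Fin 4) : |la m k| ≤ |(m:ℝ)| + 1 := by
  have h1 := le_abs_self (m:ℝ); have h2 := neg_abs_le (m:ℝ)
  fin_cases k <;> simp [la] <;> (try rw [abs_le]; constructor) <;> linarith
lemma lb_bd (m : ℤ) (k : Fin 4) : |lb m k| ≤ |(m:ℝ)| + 1 := by
  have h1 := le_abs_self (m:ℝ); have h2 := neg_abs_le (m:ℝ)
  fin_cases k <;> simp [lb] <;> (try rw [abs_le]; constructor) <;> linarith
lemma lab_bd (m : ℤ) (k : Fin 4) : |lb m k - la m k| ≤ 1 := by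
  fin_cases k <;> simp [la, lb] <;> (try rw [abs_le]; constructor) <;> linarith
lemma cabl_bd (m : ℤ) (k : Fin 4) : |ca m * la m k + cb m * lb m k| ≤ 9 * (1 / (1 + (m:ℝ) ^ 2)) := by
  have e : ca m * la m k + cb m * lb m k = (ca m + cb m) * la m k + cb m * (lb m k - la m k) := by ring
  rw [e]
  refine (abs_add_le _ _).trans ?_
  rw [abs_mul, abs_mul, abs_of_pos (cb_pos m)]
  have h1 : |ca m + cb m| * |la m k| ≤ 8 / ((1 + (m:ℝ) ^ 2) * (1 + |(m:ℝ)|)) * (|(m:ℝ)| + 1) := by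
    gcongr
    · exact cab_bd m
    · exact la_bd m k
  have h2 : cb m * |lb m k - la m k| ≤ 1 / (1 + (m:ℝ) ^ 2) * 1 := by
    gcongr
    · exact cb_bd m
    · exact lab_bd m k
  have e2 : 8 / ((1 + (m:ℝ) ^ 2) * (1 + |(m:ℝ)|)) * (|(m:ℝ)| + 1) = 8 * (1 / (1 + (m:ℝ) ^ 2)) := by
    field_simp; ring
  linarith
lemma sq_m1 (m : ℤ) : (|(m:ℝ)| + 1) * (|(m:ℝ)| + 1) ≤ 2 * (1 + (m:ℝ) ^ 2) := by
  have := sq_abs (m:ℝ)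
  nlinarith [sq_nonneg (|(m:ℝ)| - 1)]
lemma call_bd (m : ℤ) (k l : Fin 4) : |ca m * la m k * la m l| ≤ 2 := by
  rw [abs_mul, abs_mul]
  calc |ca m| * |la m k| * |la m l| ≤ 1 / (1 + (m:ℝ) ^ 2) * (|(m:ℝ)| + 1) * (|(m:ℝ)| + 1) := by
        gcongr
        · exact ca_bd m
        · exact la_bd m k
        · exact la_bd m l
    _ ≤ 2 := by
        rw [mul_assoc, one_div_mul_eq_div, div_le_iff₀ (by positivity)]; exact sq_m1 m
lemma cbll_bd (m : ℤ) (k l : Fin 4) : |cb m * lb m k * lb m l| ≤ 2 := by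
  rw [abs_mul, abs_mul, abs_of_pos (cb_pos m)]
  calc cb m * |lb m k| * |lb m l| ≤ 1 / (1 + (m:ℝ) ^ 2) * (|(m:ℝ)| + 1) * (|(m:ℝ)| + 1) := by
        gcongr
        · exact cb_bd m
        · exact lb_bd m k
        · exact lb_bd m l
    _ ≤ 2 := by
        rw [mul_assoc, one_div_mul_eq_div, div_le_iff₀ (by positivity)]; exact sq_m1 m
lemma cbl_bd (m : ℤ) (k : Fin 4) : |cb m * lb m k| ≤ 2 := by
  rw [abs_mul, abs_of_pos (cb_pos m)]
  calc cb m * |lb m k| ≤ 1 / (1 + (m:ℝ) ^ 2) * (|(m:ℝ)| + 1) := by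
        gcongr
        · exact cb_bd m
        · exact lb_bd m k
    _ ≤ 2 := by
        rw [one_div_mul_eq_div, div_le_iff₀ (by positivity)]
        have := sq_abs (m:ℝ)
        nlinarith [sq_nonneg (|(m:ℝ)| - 1)]

lemma Lb_sub_La (m : ℤ) (y : Fin 4 → ℝ) : Lb m y - La m y = y 2 - y 1 := by unfold La Lb; ring
lemma La_eq (m : ℤ) (y : Fin 4 → ℝ) : La m y = m * pp y + (y 3 - y 2) / 2 := by unfold La pp; ring
lemma Lb_eq (m : ℤ) (y : Fin 4 → ℝ) : Lb m y = m * pp y + (y 3 + y 2 - 2 * y 1) / 2 := by unfold Lb pp; ring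

lemma ff_mp (τ : ℝ) (hτ : 0 < τ) (p0 R : ℝ) (hp0 : 0 < p0) :
    ∃ C, 0 < C ∧ ∀ (m : ℤ) (p z : ℝ), p0 ≤ p → |z - m * p| ≤ R → ff τ z ≤ C * (1 / (1 + (m:ℝ) ^ 2)) := by
  obtain ⟨C, hC, h⟩ := ff_decay τ hτ
  refine ⟨C * (1 + (2 + 2 * R ^ 2) / p0 ^ 2), by positivity, fun m p z hp hz => (h z).trans ?_⟩
  have h1 : (z - m * p) ^ 2 ≤ R ^ 2 := by
    rw [← sq_abs]; gcongr
  have h2 : (m * p) ^ 2 ≤ 2 * z ^ 2 + 2 * R ^ 2 := by nlinarith [sq_nonneg (2 * z - m * p)]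
  have h3 : (m:ℝ) ^ 2 * p0 ^ 2 ≤ 2 * z ^ 2 + 2 * R ^ 2 := by
    refine le_trans ?_ h2; rw [mul_pow]; gcongr
  have h4 : (m:ℝ) ^ 2 ≤ (2 * z ^ 2 + 2 * R ^ 2) / p0 ^ 2 := by rwa [le_div_iff₀ (by positivity)]
  have h5 : 1 + (m:ℝ) ^ 2 ≤ (1 + (2 + 2 * R ^ 2) / p0 ^ 2) * (1 + z ^ 2) := by
    have : (2 * z ^ 2 + 2 * R ^ 2) / p0 ^ 2 ≤ (2 + 2 * R ^ 2) / p0 ^ 2 * (1 + z ^ 2) := by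
      rw [div_mul_eq_mul_div]; gcongr; nlinarith [sq_nonneg z, sq_nonneg R, mul_nonneg (sq_nonneg z) (sq_nonneg R)]
    nlinarith [sq_nonneg z]
  rw [mul_one_div, div_le_div_iff₀ (by positivity) (by positivity), mul_assoc]
  exact mul_le_mul_of_nonneg_left h5 hC.le

lemma Fs_summable (τ : ℝ) (hτ : 0 < τ) (y : Fin 4 → ℝ) :
    Summable (fun m : ℤ => ca m * gg τ (La m y) + cb m * gg τ (Lb m y)) := by
  obtain ⟨K, hK0, hK⟩ := gd_bounded τ hτ
  set M := |pp y| + |(y 3 - y 2) / 2|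
  refine Summable.of_norm_bounded (sum_inv_sq.mul_left (8 * (K * M) + K * |y 2 - y 1|)) fun m => ?_
  have e : ca m * gg τ (La m y) + cb m * gg τ (Lb m y) =
    (ca m + cb m) * gg τ (La m y) + cb m * (gg τ (Lb m y) - gg τ (La m y)) := by ring
  rw [e]
  refine (norm_add_le _ _).trans ?_
  rw [norm_mul, norm_mul, Real.norm_eq_abs, Real.norm_eq_abs, Real.norm_eq_abs, Real.norm_eq_abs,
    abs_of_pos (cb_pos m), abs_of_nonneg (gg_nonneg _ _)]
  have hM : |La m y| ≤ M * (1 + |(m:ℝ)|) := by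
    rw [La_eq]
    refine (abs_add_le _ _).trans ?_
    rw [abs_mul]
    have h1 := abs_nonneg (m:ℝ); have h2 := abs_nonneg (pp y); have h3 := abs_nonneg ((y 3 - y 2) / 2)
    simp only [M]
    nlinarith
  have h1 : |ca m + cb m| * gg τ (La m y) ≤ 8 / ((1 + (m:ℝ) ^ 2) * (1 + |(m:ℝ)|)) * (K * (M * (1 + |(m:ℝ)|))) := by
    gcongr
    · exact gg_nonneg _ _
    · exact cab_bd m
    · exact (gg_le τ hτ K hK _).trans (by gcongr)
  have h2 : cb m * |gg τ (Lb m y) - gg τ (La m y)| ≤ 1 / (1 + (m:ℝ) ^ 2) * (K * |y 2 - y 1|) := by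
    gcongr
    · exact cb_bd m
    · rw [← Lb_sub_La m y]; exact gg_lip τ hτ K hK _ _
  have e2 : 8 / ((1 + (m:ℝ) ^ 2) * (1 + |(m:ℝ)|)) * (K * (M * (1 + |(m:ℝ)|))) = 8 * (K * M) * (1 / (1 + (m:ℝ) ^ 2)) := by
    field_simp
  linarith

lemma Gr_bound (τ : ℝ) (hτ : 0 < τ) (p0 R : ℝ) (hp0 : 0 < p0) :
    ∃ C, 0 < C ∧ ∀ (k : Fin 4) (m : ℤ) (y : Fin 4 → ℝ), p0 ≤ pp y → |(y 3 - y 2) / 2| ≤ R →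
      |(y 3 + y 2 - 2 * y 1) / 2| ≤ R →
      |ca m * la m k * gd τ (La m y) + cb m * lb m k * gd τ (Lb m y)| ≤ C * (1 / (1 + (m:ℝ) ^ 2)) := by
  obtain ⟨K, hK0, hK⟩ := gd_bounded τ hτ
  obtain ⟨C, hC, h⟩ := ff_mp τ hτ p0 R hp0
  refine ⟨9 * K + 2 * (C * (2 * |R|)), by positivity, fun k m y hp hw hz => ?_⟩
  have e : ca m * la m k * gd τ (La m y) + cb m * lb m k * gd τ (Lb m y) =
    (ca m * la m k + cb m * lb m k) * gd τ (La m y) + cb m * lb m k * (gd τ (Lb m y) - gd τ (La m y)) := by ring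
  rw [e]
  refine (abs_add_le _ _).trans ?_
  rw [abs_mul, abs_mul (cb m * lb m k)]
  have hball : ∀ z ∈ Metric.closedBall (m * pp y) R, ‖ff τ z‖ ≤ C * (1 / (1 + (m:ℝ) ^ 2)) := by
    intro z hz
    rw [Real.norm_eq_abs, abs_of_pos (ff_pos τ hτ z)]
    exact h m (pp y) z hp (by simpa [Real.dist_eq] using hz)
  have hmv := Convex.norm_image_sub_le_of_norm_hasDerivWithin_le (f := gd τ) (f' := ff τ)
    (s := Metric.closedBall (m * pp y) R) (C := C * (1 / (1 + (m:ℝ) ^ 2))) (x := La m y) (y := Lb m y)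
    (fun x _ => (gd_deriv τ hτ x).hasDerivWithinAt) hball (convex_closedBall _ _)
    (by rw [La_eq, Metric.mem_closedBall, Real.dist_eq]; simpa using hw)
    (by rw [Lb_eq, Metric.mem_closedBall, Real.dist_eq]; simpa using hz)
  have hd : ‖Lb m y - La m y‖ ≤ 2 * |R| := by
    rw [La_eq, Lb_eq, Real.norm_eq_abs]
    have e : ↑m * pp y + (y 3 + y 2 - 2 * y 1) / 2 - (↑m * pp y + (y 3 - y 2) / 2) = (y 3 + y 2 - 2 * y 1) / 2 - (y 3 - y 2) / 2 := by ring
    rw [e]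
    have := abs_sub ((y 3 + y 2 - 2 * y 1) / 2) ((y 3 - y 2) / 2)
    have := le_abs_self R
    linarith
  rw [Real.norm_eq_abs] at hmv
  have h1 : |ca m * la m k + cb m * lb m k| * |gd τ (La m y)| ≤ 9 * (1 / (1 + (m:ℝ) ^ 2)) * K := by
    gcongr
    · exact cabl_bd m k
    · exact hK _
  have h2 : |cb m * lb m k| * |gd τ (Lb m y) - gd τ (La m y)| ≤ 2 * (C * (1 / (1 + (m:ℝ) ^ 2)) * (2 * |R|)) := by
    gcongr
    · exact cbl_bd m k
    · refine hmv.trans ?_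
      gcongr
  linarith

lemma Gr_summable_pos (τ : ℝ) (hτ : 0 < τ) (k : Fin 4) (y : Fin 4 → ℝ) (hp : 0 < pp y) :
    Summable (fun m : ℤ => ca m * la m k * gd τ (La m y) + cb m * lb m k * gd τ (Lb m y)) := by
  obtain ⟨C, hC, h⟩ := Gr_bound τ hτ (pp y) (max |(y 3 - y 2) / 2| |(y 3 + y 2 - 2 * y 1) / 2|) hp
  exact Summable.of_norm_bounded (sum_inv_sq.mul_left C) fun m => h k m y le_rfl (le_max_left _ _) (le_max_right _ _)

lemma Gr_summable_tie (τ : ℝ) (hτ : 0 < τ) (k : Fin 4) (y : Fin 4 → ℝ) (hp : y 1 = y 2) :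
    Summable (fun m : ℤ => ca m * la m k * gd τ (La m y) + cb m * lb m k * gd τ (Lb m y)) := by
  obtain ⟨K, hK0, hK⟩ := gd_bounded τ hτ
  refine Summable.of_norm_bounded (sum_inv_sq.mul_left (9 * K)) fun m => ?_
  have e : Lb m y = La m y := by have := Lb_sub_La m y; rw [hp] at this; linarith
  rw [e, ← add_mul, norm_mul, Real.norm_eq_abs, Real.norm_eq_abs]
  have h1 : |ca m * la m k + cb m * lb m k| * |gd τ (La m y)| ≤ 9 * (1 / (1 + (m:ℝ) ^ 2)) * K := by
    gcongr
    · exact cabl_bd m k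
    · exact hK _
  linarith

lemma He_bound (τ : ℝ) (hτ : 0 < τ) (p0 R : ℝ) (hp0 : 0 < p0) :
    ∃ C, 0 < C ∧ ∀ (k l : Fin 4) (m : ℤ) (y : Fin 4 → ℝ), p0 ≤ pp y → |(y 3 - y 2) / 2| ≤ R →
      |(y 3 + y 2 - 2 * y 1) / 2| ≤ R →
      |ca m * la m k * la m l * ff τ (La m y)| ≤ C * (1 / (1 + (m:ℝ) ^ 2)) ∧
      |cb m * lb m k * lb m l * ff τ (Lb m y)| ≤ C * (1 / (1 + (m:ℝ) ^ 2)) := by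
  obtain ⟨C, hC, h⟩ := ff_mp τ hτ p0 R hp0
  refine ⟨2 * C, by positivity, fun k l m y hp hw hz => ⟨?_, ?_⟩⟩
  · rw [abs_mul, abs_of_pos (ff_pos τ hτ _)]
    rw [mul_assoc 2 C]
    refine mul_le_mul (call_bd m k l) (h m (pp y) _ hp ?_) (ff_pos τ hτ _).le (by norm_num)
    rw [La_eq]; simpa using hw
  · rw [abs_mul, abs_of_pos (ff_pos τ hτ _)]
    rw [mul_assoc 2 C]
    refine mul_le_mul (cbll_bd m k l) (h m (pp y) _ hp ?_) (ff_pos τ hτ _).le (by norm_num)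
    rw [Lb_eq]; simpa using hz

lemma He_summable (τ : ℝ) (hτ : 0 < τ) (k l : Fin 4) (y : Fin 4 → ℝ) (hp : 0 < pp y) :
    Summable (fun m : ℤ => ca m * la m k * la m l * ff τ (La m y)) ∧
    Summable (fun m : ℤ => cb m * lb m k * lb m l * ff τ (Lb m y)) := by
  obtain ⟨C, hC, h⟩ := He_bound τ hτ (pp y) (max |(y 3 - y 2) / 2| |(y 3 + y 2 - 2 * y 1) / 2|) hp
  exact ⟨Summable.of_norm_bounded (sum_inv_sq.mul_left C) fun m => (h k l m y le_rfl (le_max_left _ _) (le_max_right _ _)).1,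
    Summable.of_norm_bounded (sum_inv_sq.mul_left C) fun m => (h k l m y le_rfl (le_max_left _ _) (le_max_right _ _)).2⟩

lemma La_upd (m : ℤ) (y : Fin 4 → ℝ) (k : Fin 4) (s : ℝ) :
    La m (Function.update y k s) = La m y + la m k * (s - y k) := by
  fin_cases k <;> simp [La, la, Function.update] <;> ring
lemma Lb_upd (m : ℤ) (y : Fin 4 → ℝ) (k : Fin 4) (s : ℝ) :
    Lb m (Function.update y k s) = Lb m y + lb m k * (s - y k) := by
  fin_cases k <;> simp [Lb, lb, Function.update] <;> ring

lemma upd_bds (y : Fin 4 → ℝ) (k : Fin 4) (s r : ℝ) (hs : |s - y k| ≤ r) :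
    pp y - r ≤ pp (Function.update y k s) ∧
    |(Function.update y k s 3 - Function.update y k s 2) / 2| ≤ |(y 3 - y 2) / 2| + r ∧
    |(Function.update y k s 3 + Function.update y k s 2 - 2 * Function.update y k s 1) / 2| ≤
      |(y 3 + y 2 - 2 * y 1) / 2| + r := by
  obtain ⟨h1, h2⟩ := abs_le.mp hs
  have e1 := le_abs_self ((y 3 - y 2) / 2)
  have e2 := neg_abs_le ((y 3 - y 2) / 2)
  have e3 := le_abs_self ((y 3 + y 2 - 2 * y 1) / 2)
  have e4 := neg_abs_le ((y 3 + y 2 - 2 * y 1) / 2)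
  refine ⟨?_, ?_, ?_⟩
  · fin_cases k <;> simp [pp, Function.update] at * <;> linarith
  · rw [abs_le]
    fin_cases k <;> simp [Function.update] at * <;> constructor <;> linarith
  · rw [abs_le]
    fin_cases k <;> simp [Function.update] at * <;> constructor <;> linarith

lemma C1_pos (τ : ℝ) (hτ : 0 < τ) (y : Fin 4 → ℝ) (hp : 0 < pp y) (k : Fin 4) :
    HasDerivAt (fun s => Fs τ (Function.update y k s)) (Gr τ k y) (y k) := by
  obtain ⟨C, hC, h⟩ := Gr_bound τ hτ (pp y / 2)
    (max |(y 3 - y 2) / 2| |(y 3 + y 2 - 2 * y 1) / 2| + pp y / 2) (by linarith)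
  have key := hasDerivAt_tsum_of_isPreconnected (sum_inv_sq.mul_left C) (t := Metric.ball (y k) (pp y / 2))
    (g := fun (m : ℤ) s => ca m * gg τ (La m (Function.update y k s)) + cb m * gg τ (Lb m (Function.update y k s)))
    (g' := fun (m : ℤ) s => ca m * la m k * gd τ (La m (Function.update y k s)) +
      cb m * lb m k * gd τ (Lb m (Function.update y k s)))
    Metric.isOpen_ball (convex_ball _ _).isPreconnected ?_ ?_ (y₀ := y k) (y := y k)
    (Metric.mem_ball_self (by linarith)) ?_ (Metric.mem_ball_self (by linarith))
  · simp only [Function.update_eq_self] at key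
    exact key
  · intro m s hs
    have h1 : HasDerivAt (fun s => La m (Function.update y k s)) (la m k) s := by
      simp only [La_upd]
      simpa using (((hasDerivAt_id s).sub_const (y k)).const_mul (la m k)).const_add (La m y)
    have h2 : HasDerivAt (fun s => Lb m (Function.update y k s)) (lb m k) s := by
      simp only [Lb_upd]
      simpa using (((hasDerivAt_id s).sub_const (y k)).const_mul (lb m k)).const_add (Lb m y)
    have := (((gg_deriv τ hτ _).comp s h1).const_mul (ca m)).add (((gg_deriv τ hτ _).comp s h2).const_mul (cb m))
    convert! this using 1
    ring
  · intro m s hs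
    have hs' : |s - y k| ≤ pp y / 2 := by
      rw [Metric.mem_ball, Real.dist_eq] at hs; exact hs.le
    obtain ⟨b1, b2, b3⟩ := upd_bds y k s _ hs'
    exact h k m _ (by linarith) (b2.trans (by gcongr; exact le_max_left _ _)) (b3.trans (by gcongr; exact le_max_right _ _))
  · simp only [Function.update_eq_self]
    exact Fs_summable τ hτ y

lemma C2_pos (τ : ℝ) (hτ : 0 < τ) (y : Fin 4 → ℝ) (hp : 0 < pp y) (k l : Fin 4) :
    HasDerivAt (fun s => Gr τ k (Function.update y l s)) (He τ k l y) (y l) := by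
  obtain ⟨C, hC, h⟩ := He_bound τ hτ (pp y / 2)
    (max |(y 3 - y 2) / 2| |(y 3 + y 2 - 2 * y 1) / 2| + pp y / 2) (by linarith)
  have key := hasDerivAt_tsum_of_isPreconnected (sum_inv_sq.mul_left (C + C)) (t := Metric.ball (y l) (pp y / 2))
    (g := fun (m : ℤ) s => ca m * la m k * gd τ (La m (Function.update y l s)) +
      cb m * lb m k * gd τ (Lb m (Function.update y l s)))
    (g' := fun (m : ℤ) s => ca m * la m k * la m l * ff τ (La m (Function.update y l s)) +
      cb m * lb m k * lb m l * ff τ (Lb m (Function.update y l s)))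
    Metric.isOpen_ball (convex_ball _ _).isPreconnected ?_ ?_ (y₀ := y l) (y := y l)
    (Metric.mem_ball_self (by linarith)) ?_ (Metric.mem_ball_self (by linarith))
  · simp only [Function.update_eq_self] at key
    rw [He, if_neg hp.ne']
    exact key
  · intro m s hs
    have h1 : HasDerivAt (fun s => La m (Function.update y l s)) (la m l) s := by
      simp only [La_upd]
      simpa using (((hasDerivAt_id s).sub_const (y l)).const_mul (la m l)).const_add (La m y)
    have h2 : HasDerivAt (fun s => Lb m (Function.update y l s)) (lb m l) s := by
      simp only [Lb_upd]
      simpa using (((hasDerivAt_id s).sub_const (y l)).const_mul (lb m l)).const_add (Lb m y)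
    have := (((gd_deriv τ hτ _).comp s h1).const_mul (ca m * la m k)).add
      (((gd_deriv τ hτ _).comp s h2).const_mul (cb m * lb m k))
    convert! this using 1
    ring
  · intro m s hs
    have hs' : |s - y l| ≤ pp y / 2 := by
      rw [Metric.mem_ball, Real.dist_eq] at hs; exact hs.le
    obtain ⟨b1, b2, b3⟩ := upd_bds y l s _ hs'
    obtain ⟨c1, c2⟩ := h k l m _ (by linarith) (b2.trans (by gcongr; exact le_max_left _ _)) (b3.trans (by gcongr; exact le_max_right _ _))
    refine (norm_add_le _ _).trans ?_
    rw [Real.norm_eq_abs, Real.norm_eq_abs]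
    linarith
  · simp only [Function.update_eq_self]
    exact Gr_summable_pos τ hτ k y hp

/-- Sorted vectors. -/
def Srt (y : Fin 4 → ℝ) : Prop := y 0 ≤ y 1 ∧ y 1 ≤ y 2 ∧ y 2 ≤ y 3

lemma Srt.cases {y : Fin 4 → ℝ} (h : Srt y) : 0 < pp y ∨ (pp y = 0 ∧ ∀ i, y i = y 0) := by
  obtain ⟨h0, h1, h2⟩ := h
  have : 0 ≤ pp y := by unfold pp; linarith
  rcases this.lt_or_eq with h | h
  · exact Or.inl h
  · refine Or.inr ⟨h.symm, fun i => ?_⟩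
    unfold pp at h
    fin_cases i <;> simp <;> linarith

lemma Gr_summable (τ : ℝ) (hτ : 0 < τ) (k : Fin 4) (y : Fin 4 → ℝ) (hy : Srt y) :
    Summable (fun m : ℤ => ca m * la m k * gd τ (La m y) + cb m * lb m k * gd τ (Lb m y)) := by
  rcases hy.cases with h | ⟨_, h⟩
  · exact Gr_summable_pos τ hτ k y h
  · exact Gr_summable_tie τ hτ k y (by rw [h 1, h 2])

lemma ca_neg (m : ℤ) : ca (-m) = ca m := by simp [ca]
lemma cb_refl (m : ℤ) : cb (-1 - m) = cb m := by unfold cb; push_cast; congr 1; ring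

lemma tsum_refl (c : ℤ) (f : ℤ → ℝ) : ∑' m, f (c - m) = ∑' m, f m := (Equiv.subLeft c).tsum_eq f

lemma tsum_odd (c : ℤ) (f : ℤ → ℝ) (h : ∀ m, f (c - m) = - f m) : ∑' m, f m = 0 := by
  have h1 := tsum_refl c f
  simp only [h, tsum_neg] at h1
  linarith

lemma Gr_tie01 (τ : ℝ) (hτ : 0 < τ) (y : Fin 4 → ℝ) (hy : Srt y) (h : y 0 = y 1) : Gr τ 0 y = Gr τ 1 y := by
  have s0 := Gr_summable τ hτ 0 y hy
  have s1 := Gr_summable τ hτ 1 y hy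
  rw [← sub_eq_zero, Gr, Gr, ← s0.tsum_sub s1]
  apply tsum_odd (-1)
  intro m
  have e : Lb (-1 - m) y = - Lb m y := by unfold Lb; push_cast; rw [h]; ring
  rw [e, gd_neg, cb_refl]
  simp [la, lb]
  ring

lemma Gr_tie23 (τ : ℝ) (hτ : 0 < τ) (y : Fin 4 → ℝ) (hy : Srt y) (h : y 2 = y 3) : Gr τ 2 y = Gr τ 3 y := by
  have s0 := Gr_summable τ hτ 2 y hy
  have s1 := Gr_summable τ hτ 3 y hy
  rw [← sub_eq_zero, Gr, Gr, ← s0.tsum_sub s1]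
  apply tsum_odd 0
  intro m
  have e : La (0 - m) y = - La m y := by unfold La; push_cast; rw [h]; ring
  rw [e, gd_neg, zero_sub, ca_neg]
  simp [la, lb]
  ring

lemma Gr_tie12 (τ : ℝ) (y : Fin 4 → ℝ) (h : y 1 = y 2) : Gr τ 1 y = Gr τ 2 y := by
  unfold Gr
  congr 1; ext m
  have e : Lb m y = La m y := by have := Lb_sub_La m y; rw [h] at this; linarith
  rw [e, ← add_mul, ← add_mul]
  congr 1
  simp [la, lb]
  rw [ca_eq, cb]
  have := ne41 m; have := ne14 m; have := ne43 m
  field_simp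
  ring

lemma Gr_zero (τ : ℝ) (hτ : 0 < τ) (y : Fin 4 → ℝ) (hy : Srt y) :
    Gr τ 0 y + Gr τ 1 y + Gr τ 2 y + Gr τ 3 y = 0 := by
  have s0 := Gr_summable τ hτ 0 y hy
  have s1 := Gr_summable τ hτ 1 y hy
  have s2 := Gr_summable τ hτ 2 y hy
  have s3 := Gr_summable τ hτ 3 y hy
  unfold Gr
  rw [← s0.tsum_add s1, ← (s0.add s1).tsum_add s2, ← ((s0.add s1).add s2).tsum_add s3]
  convert! tsum_zero with m
  simp [la, lb]
  ring

lemma He_zero (τ : ℝ) (hτ : 0 < τ) (y : Fin 4 → ℝ) (hy : Srt y) (l : Fin 4) :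
    He τ 0 l y + He τ 1 l y + He τ 2 l y + He τ 3 l y = 0 := by
  rcases hy.cases with h | ⟨h, _⟩
  · have s0 := (He_summable τ hτ 0 l y h).1.add (He_summable τ hτ 0 l y h).2
    have s1 := (He_summable τ hτ 1 l y h).1.add (He_summable τ hτ 1 l y h).2
    have s2 := (He_summable τ hτ 2 l y h).1.add (He_summable τ hτ 2 l y h).2
    have s3 := (He_summable τ hτ 3 l y h).1.add (He_summable τ hτ 3 l y h).2
    simp only [He, if_neg h.ne']
    rw [← s0.tsum_add s1, ← (s0.add s1).tsum_add s2, ← ((s0.add s1).add s2).tsum_add s3]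
    convert! tsum_zero with m
    simp [la, lb]
    ring
  · simp only [He, if_pos h]
    fin_cases l <;> simp <;> ring

lemma He_symm (τ : ℝ) (y : Fin 4 → ℝ) (k l : Fin 4) : He τ k l y = He τ l k y := by
  unfold He
  split_ifs with h1 h2 h3 h3
  · rfl
  · exact absurd h2.symm h3
  · exact absurd h3.symm h2
  · rfl
  · congr 1; ext m; ring

lemma He_tie01 (τ : ℝ) (hτ : 0 < τ) (y : Fin 4 → ℝ) (hy : Srt y) (h : y 0 = y 1) (k l : Fin 4) :
    He τ (Equiv.swap 0 1 k) (Equiv.swap 0 1 l) y = He τ k l y := by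
  rcases hy.cases with hp | ⟨hp, _⟩
  · simp only [He, if_neg hp.ne']
    rw [(He_summable τ hτ _ _ y hp).1.tsum_add (He_summable τ hτ _ _ y hp).2,
      (He_summable τ hτ _ _ y hp).1.tsum_add (He_summable τ hτ _ _ y hp).2]
    congr 1
    · congr 1; ext m
      have : ∀ k, la m (Equiv.swap 0 1 k) = la m k := by
        intro k; fin_cases k <;> simp [la, Equiv.swap_apply_def]
      rw [this, this]
    · rw [← tsum_refl (-1)]
      congr 1; ext m
      have e : Lb (-1 - m) y = - Lb m y := by unfold Lb; push_cast; rw [h]; ring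
      have : ∀ k, lb (-1 - m) (Equiv.swap 0 1 k) = - lb m k := by
        intro k; fin_cases k <;> simp [lb, Equiv.swap_apply_def] <;> ring
      rw [this, this, cb_refl, e, ff_neg]; ring
  · simp [He, if_pos hp]

lemma He_tie23 (τ : ℝ) (hτ : 0 < τ) (y : Fin 4 → ℝ) (hy : Srt y) (h : y 2 = y 3) (k l : Fin 4) :
    He τ (Equiv.swap 2 3 k) (Equiv.swap 2 3 l) y = He τ k l y := by
  rcases hy.cases with hp | ⟨hp, _⟩
  · simp only [He, if_neg hp.ne']
    rw [(He_summable τ hτ _ _ y hp).1.tsum_add (He_summable τ hτ _ _ y hp).2,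
      (He_summable τ hτ _ _ y hp).1.tsum_add (He_summable τ hτ _ _ y hp).2]
    congr 1
    · rw [← tsum_refl 0]
      congr 1; ext m
      have e : La (0 - m) y = - La m y := by unfold La; push_cast; rw [h]; ring
      have : ∀ k, la (0 - m) (Equiv.swap 2 3 k) = - la m k := by
        intro k; fin_cases k <;> simp [la, Equiv.swap_apply_def] <;> ring
      rw [this, this, e, ff_neg, zero_sub, ca_neg]; ring
    · congr 1; ext m
      have : ∀ k, lb m (Equiv.swap 2 3 k) = lb m k := by
        intro k; fin_cases k <;> simp [lb, Equiv.swap_apply_def]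
      rw [this, this]
  · simp [He, if_pos hp]

lemma He_tie12 (τ : ℝ) (y : Fin 4 → ℝ) (h : y 1 = y 2) (k l : Fin 4) :
    He τ (Equiv.swap 1 2 k) (Equiv.swap 1 2 l) y = He τ k l y := by
  by_cases hp : pp y = 0
  · simp [He, if_pos hp]
  · simp only [He, if_neg hp]
    congr 1; ext m
    have e : Lb m y = La m y := by have := Lb_sub_La m y; rw [h] at this; linarith
    rw [e, ← add_mul, ← add_mul]
    congr 1
    rw [ca_eq, cb]
    have := ne41 m; have := ne14 m; have := ne43 m
    fin_cases k <;> fin_cases l <;> simp [la, lb, Equiv.swap_apply_def] <;> field_simp <;> ring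

/-- Symmetry of gradient and Hessian under a permutation. -/
def Invt (τ : ℝ) (y : Fin 4 → ℝ) (π : Equiv.Perm (Fin 4)) : Prop :=
  (∀ k, Gr τ (π k) y = Gr τ k y) ∧ ∀ k l, He τ (π k) (π l) y = He τ k l y

lemma Invt.mul {τ : ℝ} {y : Fin 4 → ℝ} {π ρ : Equiv.Perm (Fin 4)} (h1 : Invt τ y π) (h2 : Invt τ y ρ) :
    Invt τ y (π * ρ) :=
  ⟨fun k => by rw [Equiv.Perm.mul_apply, h1.1, h2.1], fun k l => by
    rw [Equiv.Perm.mul_apply, Equiv.Perm.mul_apply, h1.2, h2.2]⟩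

lemma inv01 (τ : ℝ) (hτ : 0 < τ) (y : Fin 4 → ℝ) (hy : Srt y) (h : y 0 = y 1) : Invt τ y (Equiv.swap 0 1) :=
  ⟨fun k => by
    have := Gr_tie01 τ hτ y hy h
    fin_cases k <;> simp [Equiv.swap_apply_def, this], He_tie01 τ hτ y hy h⟩
lemma inv23 (τ : ℝ) (hτ : 0 < τ) (y : Fin 4 → ℝ) (hy : Srt y) (h : y 2 = y 3) : Invt τ y (Equiv.swap 2 3) :=
  ⟨fun k => by
    have := Gr_tie23 τ hτ y hy h
    fin_cases k <;> simp [Equiv.swap_apply_def, this], He_tie23 τ hτ y hy h⟩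
lemma inv12 (τ : ℝ) (y : Fin 4 → ℝ) (h : y 1 = y 2) : Invt τ y (Equiv.swap 1 2) :=
  ⟨fun k => by
    have := Gr_tie12 τ y h
    fin_cases k <;> simp [Equiv.swap_apply_def, this], He_tie12 τ y h⟩

lemma inv_swap (τ : ℝ) (hτ : 0 < τ) (y : Fin 4 → ℝ) (hy : Srt y) (a b : Fin 4) (h : y a = y b) :
    Invt τ y (Equiv.swap a b) := by
  have key : ∀ a b : Fin 4, a < b → y a = y b → Invt τ y (Equiv.swap a b) := by
    have hy' := hy
    obtain ⟨h0, h1, h2⟩ := hy'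
    have H01 := inv01 τ hτ y hy
    have H12 := inv12 τ y
    have H23 := inv23 τ hτ y hy
    have H02 : y 0 = y 2 → Invt τ y (Equiv.swap 0 2) := fun h => by
      have A := H01 (by linarith); have B := H12 (by linarith)
      have e : (Equiv.swap 0 2 : Equiv.Perm (Fin 4)) = Equiv.swap 0 1 * Equiv.swap 1 2 * Equiv.swap 0 1 := by decide
      rw [e]; exact (A.mul B).mul A
    have H13 : y 1 = y 3 → Invt τ y (Equiv.swap 1 3) := fun h => by
      have A := H12 (by linarith); have B := H23 (by linarith)
      have e : (Equiv.swap 1 3 : Equiv.Perm (Fin 4)) = Equiv.swap 1 2 * Equiv.swap 2 3 * Equiv.swap 1 2 := by decide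
      rw [e]; exact (A.mul B).mul A
    have H03 : y 0 = y 3 → Invt τ y (Equiv.swap 0 3) := fun h => by
      have A := H02 (by linarith); have B := H23 (by linarith)
      have e : (Equiv.swap 0 3 : Equiv.Perm (Fin 4)) = Equiv.swap 0 2 * Equiv.swap 2 3 * Equiv.swap 0 2 := by decide
      rw [e]; exact (A.mul B).mul A
    intro a b hab
    fin_cases a <;> fin_cases b <;> first | (exfalso; revert hab; decide) | assumption
  rcases lt_trichotomy a b with hab | rfl | hab
  · exact key a b hab h
  · rw [Equiv.swap_self]; exact ⟨fun k => rfl, fun k l => rfl⟩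
  · rw [Equiv.swap_comm]; exact key b a hab h.symm

lemma Gr_tie (τ : ℝ) (hτ : 0 < τ) (y : Fin 4 → ℝ) (hy : Srt y) (k k' : Fin 4) (h : y k = y k') :
    Gr τ k y = Gr τ k' y := by
  have := (inv_swap τ hτ y hy k k' h).1 k
  rw [Equiv.swap_apply_left] at this
  exact this.symm

lemma He_tie (τ : ℝ) (hτ : 0 < τ) (y : Fin 4 → ℝ) (hy : Srt y) (k l k' l' : Fin 4) (h : y k = y k')
    (h2 : y l = y l') (h3 : k = l ↔ k' = l') : He τ k l y = He τ k' l' y := by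
  have e1 := (inv_swap τ hτ y hy k k' h).2 k l
  rw [Equiv.swap_apply_left] at e1
  rw [← e1]
  set l1 := Equiv.swap k k' l with hl1
  have hyl : y l1 = y l' := by
    rw [hl1, Equiv.swap_apply_def]; split_ifs with a b
    · rw [← h2, a, h]
    · rw [← h2, b, h]
    · exact h2
  have e2 := (inv_swap τ hτ y hy l1 l' hyl).2 k' l1
  rw [Equiv.swap_apply_left] at e2
  rw [← e2]
  by_cases hkl : k = l
  · have a : l1 = k' := by rw [hl1, ← hkl, Equiv.swap_apply_left]
    have b := h3.mp hkl
    rw [a, ← b, Equiv.swap_self]; rfl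
  · have a : k' ≠ l1 := by
      intro h; apply hkl
      have : Equiv.swap k k' k = Equiv.swap k k' l := by rw [Equiv.swap_apply_left, ← hl1, ← h]
      exact (Equiv.swap k k').injective this
    have b : k' ≠ l' := fun h => hkl (h3.mpr h)
    rw [Equiv.swap_apply_of_ne_of_ne a b]

lemma C1_tie (τ : ℝ) (hτ : 0 < τ) (y : Fin 4 → ℝ) (h12 : y 1 = y 2) (k : Fin 4) (hk1 : k ≠ 1) (hk2 : k ≠ 2) :
    HasDerivAt (fun s => Fs τ (Function.update y k s)) (Gr τ k y) (y k) := by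
  obtain ⟨K, hK0, hK⟩ := gd_bounded τ hτ
  have key := hasDerivAt_tsum (sum_inv_sq.mul_left (9 * K))
    (g := fun (m : ℤ) s => ca m * gg τ (La m (Function.update y k s)) + cb m * gg τ (Lb m (Function.update y k s)))
    (g' := fun (m : ℤ) s => ca m * la m k * gd τ (La m (Function.update y k s)) +
      cb m * lb m k * gd τ (Lb m (Function.update y k s))) ?_ ?_ (y₀ := y k) ?_ (y k)
  · simp only [Function.update_eq_self] at key
    exact key
  · intro m s
    have h1 : HasDerivAt (fun s => La m (Function.update y k s)) (la m k) s := by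
      simp only [La_upd]
      simpa using (((hasDerivAt_id s).sub_const (y k)).const_mul (la m k)).const_add (La m y)
    have h2 : HasDerivAt (fun s => Lb m (Function.update y k s)) (lb m k) s := by
      simp only [Lb_upd]
      simpa using (((hasDerivAt_id s).sub_const (y k)).const_mul (lb m k)).const_add (Lb m y)
    have := (((gg_deriv τ hτ _).comp s h1).const_mul (ca m)).add (((gg_deriv τ hτ _).comp s h2).const_mul (cb m))
    convert! this using 1
    ring
  · intro m s
    have e : Lb m (Function.update y k s) = La m (Function.update y k s) := by
      have := Lb_sub_La m (Function.update y k s)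
      rw [Function.update_of_ne hk1.symm, Function.update_of_ne hk2.symm, h12] at this; linarith
    rw [e, ← add_mul, norm_mul, Real.norm_eq_abs, Real.norm_eq_abs]
    have h1 : |ca m * la m k + cb m * lb m k| * |gd τ (La m (Function.update y k s))| ≤ 9 * (1 / (1 + (m:ℝ) ^ 2)) * K := by
      gcongr
      · exact cabl_bd m k
      · exact hK _
    linarith
  · simp only [Function.update_eq_self]
    exact Fs_summable τ hτ y

lemma hdw_single (f : ℝ → ℝ) (f' x : ℝ) (s : Set ℝ) (hs : s ⊆ {x}) : HasDerivWithinAt f f' s x := by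
  refine HasDerivWithinAt.mono ?_ hs
  rw [hasDerivWithinAt_iff_tendsto_slope]
  simp

lemma upd_single (y : Fin 4 → ℝ) (hc : ∀ i, y i = y 0) (k : Fin 4) (hk : k = 1 ∨ k = 2) :
    {s | Srt (Function.update y k s)} ⊆ {y k} := by
  intro s hs
  have h1 := hc 1; have h2 := hc 2; have h3 := hc 3
  obtain ⟨a, b, c⟩ := hs
  rcases hk with rfl | rfl <;> simp [Function.update] at * <;> linarith

lemma C1 (τ : ℝ) (hτ : 0 < τ) (y : Fin 4 → ℝ) (hy : Srt y) (k : Fin 4) :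
    HasDerivWithinAt (fun s => Fs τ (Function.update y k s)) (Gr τ k y)
      {s | Srt (Function.update y k s)} (y k) := by
  rcases hy.cases with h | ⟨_, hc⟩
  · exact (C1_pos τ hτ y h k).hasDerivWithinAt
  · by_cases hk : k = 1 ∨ k = 2
    · exact hdw_single _ _ _ _ (upd_single y hc k hk)
    · push Not at hk
      exact (C1_tie τ hτ y (by rw [hc 1, hc 2]) k hk.1 hk.2).hasDerivWithinAt

lemma A_tendsto (c : ℝ) : Filter.Tendsto (fun n : ℕ => 1 / (4 * (n:ℝ) + c)) Filter.atTop (nhds 0) := by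
  have h : Filter.Tendsto (fun n : ℕ => 4 * (n:ℝ) + c) Filter.atTop Filter.atTop :=
    Filter.tendsto_atTop_add_const_right _ _ (Filter.Tendsto.const_mul_atTop (by norm_num) tendsto_natCast_atTop_atTop)
  exact h.inv_tendsto_atTop.congr fun n => by simp

lemma tele_nat (f : ℕ → ℝ) (L : ℝ) (hf : Filter.Tendsto f Filter.atTop (nhds L))
    (hs : Summable fun n => f n - f (n + 1)) : HasSum (fun n => f n - f (n + 1)) (f 0 - L) := by
  have h := hs.hasSum.tendsto_sum_nat
  have h2 : Filter.Tendsto (fun n => ∑ i ∈ Finset.range n, (f i - f (i + 1))) Filter.atTop (nhds (f 0 - L)) := by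
    simp only [Finset.sum_range_sub']
    exact hf.const_sub _
  rw [← tendsto_nhds_unique h h2]
  exact hs.hasSum

lemma tele : HasSum (fun m : ℤ => 1 / (4 * (m:ℝ) + 1) - 1 / (4 * ((m:ℝ) + 1) + 1)) 0 := by
  have hs : Summable (fun m : ℤ => 1 / (4 * (m:ℝ) + 1) - 1 / (4 * ((m:ℝ) + 1) + 1)) := by
    refine Summable.of_norm_bounded (sum_inv_sq.mul_left 4) fun m => ?_
    have h1 := ne41 m
    have h2 : 4 * ((m:ℝ) + 1) + 1 ≠ 0 := by have := ne41 (m + 1); push_cast at this; exact this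
    have e : 1 / (4 * (m:ℝ) + 1) - 1 / (4 * ((m:ℝ) + 1) + 1) = 4 * (1 / ((4 * (m:ℝ) + 1) * (4 * ((m:ℝ) + 1) + 1))) := by
      field_simp; ring
    rw [e, norm_mul, Real.norm_eq_abs, Real.norm_eq_abs, abs_div, abs_one]
    have : 1 + (m:ℝ) ^ 2 ≤ |(4 * (m:ℝ) + 1) * (4 * ((m:ℝ) + 1) + 1)| := by
      rcases int_cases m with h | h | h | h
      · refine le_trans ?_ (le_abs_self _); nlinarith
      · rw [h]; norm_num
      · rw [h]; norm_num
      · refine le_trans ?_ (le_abs_self _); nlinarith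
    have h4 : |(4:ℝ)| = 4 := by norm_num
    rw [h4]
    gcongr
  have i1 : Function.Injective (fun n : ℕ => (n:ℤ)) := Nat.cast_injective
  have i2 : Function.Injective (fun n : ℕ => -((n:ℤ) + 1)) := fun a b h => by simpa using h
  have s1 := hs.comp_injective i1
  have s2 := hs.comp_injective i2
  have t1 := tele_nat (fun n : ℕ => 1 / (4 * (n:ℝ) + 1)) 0 (A_tendsto 1) (s1.congr fun n => by simp)
  have t2 := tele_nat (fun n : ℕ => 1 / (4 * (n:ℝ) + (-1))) 0 (A_tendsto (-1)) (by
    refine s2.congr fun n => ?_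
    simp only [Function.comp]
    push_cast
    have h1 : 4 * (n:ℝ) + (-1) ≠ 0 := by
      have : 4 * (n:ℤ) + (-1) ≠ 0 := by lia
      exact_mod_cast this
    have h2 : 4 * ((n:ℝ) + 1) + (-1) ≠ 0 := by
      have : 4 * ((n:ℤ) + 1) + (-1) ≠ 0 := by lia
      exact_mod_cast this
    have e1 : 4 * -((n:ℝ) + 1) + 1 = -(4 * ((n:ℝ) + 1) + (-1)) := by ring
    have e2 : 4 * (-((n:ℝ) + 1) + 1) + 1 = -(4 * (n:ℝ) + (-1)) := by ring
    rw [e1, e2, div_neg, div_neg]; ring)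
  have := HasSum.of_nat_of_neg_add_one (f := fun m : ℤ => 1 / (4 * (m:ℝ) + 1) - 1 / (4 * ((m:ℝ) + 1) + 1))
    (t1.congr_fun fun n => by simp) (t2.congr_fun fun n => by
    push_cast
    have e1 : 4 * -((n:ℝ) + 1) + 1 = -(4 * ((n:ℝ) + 1) + (-1)) := by ring
    have e2 : 4 * (-((n:ℝ) + 1) + 1) + 1 = -(4 * (n:ℝ) + (-1)) := by ring
    rw [e1, e2, div_neg, div_neg]; simp; ring)
  simpa using this

lemma sym_deriv (τ : ℝ) (hτ : 0 < τ) (o : ℝ) (j : ℤ) (c : ℤ → ℝ) (S : ℝ)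
    (hj : (j:ℝ) = -(2 * o)) (hc : ∀ m : ℤ, |((m:ℝ) + o) * c m| ≤ 9 * (1 / (1 + (m:ℝ) ^ 2)))
    (hS : HasSum (fun m : ℤ => ((m:ℝ) + o) ^ 2 * ((c m + c (j - m)) / 2)) S) :
    HasDerivAt (fun d => ∑' m : ℤ, ((m:ℝ) + o) * c m * gd τ (((m:ℝ) + o) * d)) (S * ff τ 0) 0 := by
  obtain ⟨K, hK0, hK⟩ := gd_bounded τ hτ
  have hsum : ∀ d, Summable (fun m : ℤ => ((m:ℝ) + o) * c m * gd τ (((m:ℝ) + o) * d)) := fun d => by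
    refine Summable.of_norm_bounded (sum_inv_sq.mul_left (9 * K)) fun m => ?_
    rw [norm_mul, Real.norm_eq_abs, Real.norm_eq_abs]
    have := mul_le_mul (hc m) (hK (((m:ℝ) + o) * d)) (abs_nonneg _) (by positivity)
    linarith
  have hrefl : ∀ m : ℤ, ((j - m : ℤ) : ℝ) + o = -((m:ℝ) + o) := fun m => by push_cast; rw [hj]; ring
  have hsum2 : ∀ d, Summable (fun m : ℤ => ((m:ℝ) + o) * c (j - m) * gd τ (((m:ℝ) + o) * d)) := fun d => by
    have h := (Equiv.subLeft j).summable_iff.mpr (hsum d)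
    refine h.congr fun m => ?_
    simp only [Function.comp, Equiv.subLeft_apply]
    rw [hrefl, neg_mul _ d, gd_neg]; ring
  have heq : (fun d => ∑' m : ℤ, ((m:ℝ) + o) * c m * gd τ (((m:ℝ) + o) * d)) =
      fun d => ∑' m : ℤ, ((m:ℝ) + o) * ((c m + c (j - m)) / 2) * gd τ (((m:ℝ) + o) * d) := by
    ext d
    have e1 : ∑' m : ℤ, ((m:ℝ) + o) * c (j - m) * gd τ (((m:ℝ) + o) * d) =
        ∑' m : ℤ, ((m:ℝ) + o) * c m * gd τ (((m:ℝ) + o) * d) := by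
      rw [← tsum_refl j]
      congr 1; ext m
      rw [hrefl, neg_mul _ d, gd_neg, sub_sub_cancel]; ring
    have e2 := (hsum d).tsum_add (hsum2 d)
    rw [e1] at e2
    have e3 : ∀ m : ℤ, ((m:ℝ) + o) * ((c m + c (j - m)) / 2) * gd τ (((m:ℝ) + o) * d) =
      1 / 2 * (((m:ℝ) + o) * c m * gd τ (((m:ℝ) + o) * d) + ((m:ℝ) + o) * c (j - m) * gd τ (((m:ℝ) + o) * d)) := by
      intro m; ring
    simp only [e3]
    rw [tsum_mul_left, e2]; ring
  rw [heq]
  have key := hasDerivAt_tsum (hS.summable.abs.mul_right (ff τ 0))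
    (g := fun (m : ℤ) d => ((m:ℝ) + o) * ((c m + c (j - m)) / 2) * gd τ (((m:ℝ) + o) * d))
    (g' := fun (m : ℤ) d => ((m:ℝ) + o) ^ 2 * ((c m + c (j - m)) / 2) * ff τ (((m:ℝ) + o) * d)) ?_ ?_ (y₀ := 0) ?_ 0
  · simp only [mul_zero] at key
    rw [tsum_mul_right, hS.tsum_eq] at key
    exact key
  · intro m d
    have h1 : HasDerivAt (fun d => ((m:ℝ) + o) * d) ((m:ℝ) + o) d := by
      simpa using (hasDerivAt_id d).const_mul ((m:ℝ) + o)
    have := ((gd_deriv τ hτ _).comp d h1).const_mul (((m:ℝ) + o) * ((c m + c (j - m)) / 2))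
    convert! this using 1
    ring
  · intro m d
    rw [norm_mul, Real.norm_eq_abs, Real.norm_eq_abs, abs_of_pos (ff_pos τ hτ _)]
    gcongr
    exact ff_anti τ hτ (by simp; positivity)
  · simp [gd_zero, summable_zero]

lemma alg1 (x p q r s : ℝ) (h1 : p ≠ 0) (h2 : q ≠ 0) (h3 : r ≠ 0) (h4 : s ≠ 0) (hp : p = 4 * x + 1) (hq : q = 1 - 4 * x) (hr : r = 4 * x + 3) (hs : s = 4 * x + 5) :
  (x + 1 / 2) ^ 2 * ((1 / (q * p) + 1 / (p * r) + (1 / (s * -r) + 1 / (p * r))) / 2)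
   = 3 / 32 * (1 / (p * r)) + (9 / 32 * (1 / (q * p)) - 9 / 64 * (1 / p - 1 / s)) := by
  rw [mul_neg, div_neg]
  field_simp
  subst hp hq hr hs
  ring
lemma alg0 (x p q r s : ℝ) (h1 : p ≠ 0) (h2 : q ≠ 0) (h3 : r ≠ 0) (h4 : s ≠ 0) (hp : p = 4 * x + 1) (hq : q = 1 - 4 * x) (hr : r = 4 * x + 3) (hs : s = 3 - 4 * x) :
  x ^ 2 * ((1 / (q * p) + 1 / (p * r) + (1 / (q * p) + 1 / (q * s))) / 2)
   = 3 / 32 * (1 / (q * p)) + (9 / 32 * (1 / (p * r)) + 9 / 64 * (1 / (-s) - 1 / p)) := by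
  rw [div_neg]
  field_simp
  subst hp hq hr hs
  ring

lemma sumS0 : HasSum (fun m : ℤ => ((m:ℝ) + 0) ^ 2 * (((ca m + cb m) + (ca (0 - m) + cb (0 - m))) / 2))
    (3 * Real.pi / 32) := by
  have ht : HasSum (fun m : ℤ => 1 / (4 * ((m:ℝ) - 1) + 1) - 1 / (4 * (m:ℝ) + 1)) 0 := by
    have := (Equiv.subRight (1:ℤ)).hasSum_iff.mpr tele
    refine this.congr_fun fun m => ?_
    simp
  have := ((ca_sum.mul_left (3 / 32)).add ((cb_sum.mul_left (9 / 32)).add (ht.mul_left (9 / 64))))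
  have e : 3 / 32 * (Real.pi / 4) + (9 / 32 * (Real.pi / 4) + 9 / 64 * 0) = 3 * Real.pi / 32 := by ring
  rw [e] at this
  refine this.congr_fun fun m => ?_
  simp only [zero_sub, ca_neg]
  simp only [ca_eq, cb]
  push_cast
  have h1 := ne41 m; have h2 := ne14 m; have h3 := ne43 m
  have h4 : 3 - 4 * (m:ℝ) ≠ 0 := by have := ne43 (-m); push_cast at this; convert this using 1; ring
  have h6 : 4 * ((m:ℝ) - 1) + 1 = -(3 - 4 * (m:ℝ)) := by ring
  have h8 : 4 * -(m:ℝ) + 1 = 1 - 4 * (m:ℝ) := by ring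
  have h9 : 4 * -(m:ℝ) + 3 = 3 - 4 * (m:ℝ) := by ring
  rw [h6, h8, h9, add_zero]
  exact alg0 m _ _ _ _ h1 h2 h3 h4 rfl rfl rfl rfl

lemma sumS1 : HasSum (fun m : ℤ => ((m:ℝ) + 1 / 2) ^ 2 * (((ca m + cb m) + (ca (-1 - m) + cb (-1 - m))) / 2))
    (3 * Real.pi / 32) := by
  have := ((cb_sum.mul_left (3 / 32)).add ((ca_sum.mul_left (9 / 32)).sub (tele.mul_left (9 / 64))))
  have e : 3 / 32 * (Real.pi / 4) + (9 / 32 * (Real.pi / 4) - 9 / 64 * 0) = 3 * Real.pi / 32 := by ring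
  rw [e] at this
  refine this.congr_fun fun m => ?_
  simp only [cb_refl]
  simp only [ca_eq, cb]
  push_cast
  have h1 := ne41 m; have h2 := ne14 m; have h3 := ne43 m
  have h4 : 4 * (m:ℝ) + 5 ≠ 0 := by have := ne41 (m + 1); push_cast at this; convert this using 1; ring
  have h6 : 1 - 4 * (-1 - (m:ℝ)) = 4 * (m:ℝ) + 5 := by ring
  have h7 : 4 * (-1 - (m:ℝ)) + 1 = - (4 * (m:ℝ) + 3) := by ring
  have h8 : 4 * ((m:ℝ) + 1) + 1 = 4 * (m:ℝ) + 5 := by ring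
  rw [h6, h7, h8]
  exact alg1 m _ _ _ _ h1 h2 h3 h4 rfl rfl rfl rfl

lemma Gr_line (τ : ℝ) (y : Fin 4 → ℝ) (hc : ∀ i, y i = y 0) (s : ℝ) :
    Gr τ 0 (Function.update y 0 s) = - ∑' m : ℤ, ((m:ℝ) + 0) * (ca m + cb m) * gd τ (((m:ℝ) + 0) * (y 0 - s)) ∧
    Gr τ 3 (Function.update y 3 s) = ∑' m : ℤ, ((m:ℝ) + 1 / 2) * (ca m + cb m) * gd τ (((m:ℝ) + 1 / 2) * (s - y 0)) := by
  have h1 := hc 1; have h2 := hc 2; have h3 := hc 3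
  constructor
  · rw [Gr, ← tsum_neg]
    congr 1; ext m
    have e1 : La m (Function.update y 0 s) = ((m:ℝ) + 0) * (y 0 - s) := by
      simp [La, Function.update, h1, h2, h3]; ring
    have e2 : Lb m (Function.update y 0 s) = ((m:ℝ) + 0) * (y 0 - s) := by
      simp [Lb, Function.update, h1, h2, h3]; ring
    rw [e1, e2]; simp [la, lb]; ring
  · rw [Gr]
    congr 1; ext m
    have e1 : La m (Function.update y 3 s) = ((m:ℝ) + 1 / 2) * (s - y 0) := by
      simp [La, Function.update, h1, h2]; ring
    have e2 : Lb m (Function.update y 3 s) = ((m:ℝ) + 1 / 2) * (s - y 0) := by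
      simp [Lb, Function.update, h1, h2]; ring
    rw [e1, e2]; simp [la, lb]; ring

lemma Gr0_deriv (τ : ℝ) (hτ : 0 < τ) (y : Fin 4 → ℝ) (hc : ∀ i, y i = y 0) :
    HasDerivAt (fun s => Gr τ 0 (Function.update y 0 s)) (3 * Real.pi / 32 * ff τ 0) (y 0) := by
  simp only [(Gr_line τ y hc _).1]
  have h := sym_deriv τ hτ 0 0 (fun m => ca m + cb m) _ (by simp) (fun m => by
    have := cabl_bd m 0
    simp only [la, lb] at this
    convert this using 1
    rw [← abs_neg]; congr 1; simp; ring) sumS0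
  have h1 : HasDerivAt (fun s : ℝ => y 0 - s) (-1) (y 0) := by
    simpa using (hasDerivAt_id (y 0)).const_sub (y 0)
  have h2 : HasDerivAt (fun d => ∑' m : ℤ, ((m:ℝ) + 0) * (ca m + cb m) * gd τ (((m:ℝ) + 0) * d)) (3 * Real.pi / 32 * ff τ 0) (y 0 - y 0) := by
    rw [sub_self]; exact h
  have := (h2.comp (y 0) h1).neg
  convert! this using 1
  ring

lemma Gr3_deriv (τ : ℝ) (hτ : 0 < τ) (y : Fin 4 → ℝ) (hc : ∀ i, y i = y 0) :
    HasDerivAt (fun s => Gr τ 3 (Function.update y 3 s)) (3 * Real.pi / 32 * ff τ 0) (y 0) := by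
  simp only [(Gr_line τ y hc _).2]
  have h := sym_deriv τ hτ (1 / 2) (-1) (fun m => ca m + cb m) _ (by norm_num) (fun m => by
    have := cabl_bd m 3
    simp only [la, lb] at this
    convert this using 1
    congr 1; simp; ring) sumS1
  have h1 : HasDerivAt (fun s : ℝ => s - y 0) 1 (y 0) := by
    simpa using (hasDerivAt_id (y 0)).sub_const (y 0)
  have h2 : HasDerivAt (fun d => ∑' m : ℤ, ((m:ℝ) + 1 / 2) * (ca m + cb m) * gd τ (((m:ℝ) + 1 / 2) * d)) (3 * Real.pi / 32 * ff τ 0) (y 0 - y 0) := by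
    rw [sub_self]; exact h
  have := HasDerivAt.comp (h := fun s : ℝ => s - y 0) (y 0) h2 h1
  convert! this using 1
  ring

lemma C2 (τ : ℝ) (hτ : 0 < τ) (y : Fin 4 → ℝ) (hy : Srt y) (k l : Fin 4) :
    HasDerivWithinAt (fun s => Gr τ k (Function.update y l s)) (He τ k l y)
      {s | Srt (Function.update y l s)} (y l) := by
  rcases hy.cases with h | ⟨hp, hc⟩
  · exact (C2_pos τ hτ y h k l).hasDerivWithinAt
  · by_cases hl : l = 1 ∨ l = 2
    · exact hdw_single _ _ _ _ (upd_single y hc l hl)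
    · have h1 := hc 1; have h2 := hc 2; have h3 := hc 3
      have hl' : l = 0 ∨ l = 3 := by revert hl; fin_cases l <;> simp
      have main : HasDerivAt (fun s => Gr τ l (Function.update y l s)) (3 * Real.pi / 32 * ff τ 0) (y l) := by
        rw [hc l]
        rcases hl' with rfl | rfl
        · exact Gr0_deriv τ hτ y hc
        · exact Gr3_deriv τ hτ y hc
      rw [He, if_pos hp]
      by_cases hkl : k = l
      · rw [if_pos hkl, hkl]
        convert! main.hasDerivWithinAt using 1; ring
      · rw [if_neg hkl]
        have e : ∀ s ∈ {s | Srt (Function.update y l s)}, Gr τ k (Function.update y l s) =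
            -(1 / 3) * Gr τ l (Function.update y l s) := by
          intro s hs
          have z := Gr_zero τ hτ _ hs
          have t : ∀ i j, i ≠ l → j ≠ l → Gr τ i (Function.update y l s) = Gr τ j (Function.update y l s) := by
            intro i j hi hj
            apply Gr_tie τ hτ _ hs
            rw [Function.update_of_ne hi, Function.update_of_ne hj, hc i, hc j]
          rcases hl' with rfl | rfl
          · rw [t 2 1 (by decide) (by decide), t 3 1 (by decide) (by decide)] at z
            rw [t k 1 hkl (by decide)]; linarith
          · rw [t 2 1 (by decide) (by decide), t 0 1 (by decide) (by decide)] at z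
            rw [t k 1 hkl (by decide)]; linarith
        have d := (main.const_mul (-(1 / 3))).hasDerivWithinAt (s := {s | Srt (Function.update y l s)})
        have d2 := d.congr_of_mem e (show Srt _ by rw [Function.update_eq_self]; exact hy)
        convert! d2 using 1; ring

lemma rsign_mul_self (x : ℝ) : Real.sign x * x = |x| := by
  rcases lt_trichotomy x 0 with h | h | h
  · rw [Real.sign_of_neg h, abs_of_neg h]; ring
  · simp [h]
  · rw [Real.sign_of_pos h, abs_of_pos h]; ring

lemma inv_sqrt2 : 1 / Real.sqrt 2 = Real.sqrt 2 / 2 := by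
  have := s2sq
  have h : Real.sqrt 2 ≠ 0 := by positivity
  field_simp; linarith

lemma Lam_eq (r : ℝ) (y : Fin 4 → ℝ) :
    Lam r y = 2 * Real.cos (2 * Real.sqrt 2 * r * ((y 3 - y 2) / 2)) *
        (|Real.cos (2 * Real.sqrt 2 * r * pp y / 4)| + |Real.sin (2 * Real.sqrt 2 * r * pp y / 4)|)
      + 2 * Real.cos (2 * Real.sqrt 2 * r * ((y 1 - y 0) / 2)) *
        (|Real.cos (2 * Real.sqrt 2 * r * pp y / 4)| - |Real.sin (2 * Real.sqrt 2 * r * pp y / 4)|) - 4 := by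
  set φ := 2 * Real.sqrt 2 * r * pp y / 4 with hφ
  set W := 2 * Real.sqrt 2 * r * ((y 3 - y 2) / 2) with hW
  set V := 2 * Real.sqrt 2 * r * ((y 1 - y 0) / 2) with hV
  have i2 := inv_sqrt2
  have i3 : 3 / Real.sqrt 2 = 3 * (Real.sqrt 2 / 2) := by rw [← i2]; ring
  have t : r * dot theta y = -φ := by
    simp only [dot, theta, Fin.sum_univ_four, hφ, pp, i2]; simp; ring
  have a0 : r * dot (alph 0) y = -φ - V := by
    simp [dot, alph, Fin.sum_univ_four, hφ, hV, pp]; rw [← one_div, i2, i3]; ring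
  have a1 : r * dot (alph 1) y = -φ + V := by
    simp [dot, alph, Fin.sum_univ_four, hφ, hV, pp]; rw [← one_div, i2, i3]; ring
  have a2 : r * dot (alph 2) y = φ - W := by
    simp [dot, alph, Fin.sum_univ_four, hφ, hW, pp]; rw [← one_div, i2, i3]; ring
  have a3 : r * dot (alph 3) y = φ + W := by
    simp [dot, alph, Fin.sum_univ_four, hφ, hW, pp]; rw [← one_div, i2, i3]; ring
  rw [Lam, Fin.sum_univ_four, Fin.sum_univ_four, a0, a1, a2, a3, t, psi, psi, Real.sin_add_pi_div_two,
    Real.cos_neg, Real.sin_neg]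
  have hs : Real.sign (-Real.sin φ) = - Real.sign (Real.sin φ) := Real.sign_neg
  rw [hs, Real.cos_sub, Real.cos_add, Real.cos_sub, Real.cos_add, Real.sin_sub, Real.sin_add, Real.sin_sub, Real.sin_add,
    Real.cos_neg, Real.sin_neg]
  have e1 := rsign_mul_self (Real.cos φ)
  have e2 := rsign_mul_self (Real.sin φ)
  rw [← e1, ← e2]; ring

lemma summ_ca_mul (f : ℤ → ℝ) (hf : ∀ m, |f m| ≤ 1) : Summable (fun m => ca m * f m) := by
  refine Summable.of_norm_bounded sum_inv_sq fun m => ?_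
  rw [norm_mul, Real.norm_eq_abs, Real.norm_eq_abs]
  calc |ca m| * |f m| ≤ 1 / (1 + (m:ℝ) ^ 2) * 1 := by
        gcongr
        · exact ca_bd m
        · exact hf m
    _ = _ := mul_one _
lemma summ_cb_mul (f : ℤ → ℝ) (hf : ∀ m, |f m| ≤ 1) : Summable (fun m => cb m * f m) := by
  refine Summable.of_norm_bounded sum_inv_sq fun m => ?_
  rw [norm_mul, Real.norm_eq_abs, Real.norm_eq_abs, abs_of_pos (cb_pos m)]
  calc cb m * |f m| ≤ 1 / (1 + (m:ℝ) ^ 2) * 1 := by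
        gcongr
        · exact cb_bd m
        · exact hf m
    _ = _ := mul_one _

lemma Lam_series (r : ℝ) (y : Fin 4 → ℝ) :
    HasSum (fun m : ℤ => ca m * (1 - Real.cos (2 * Real.sqrt 2 * r * La m y))
      + cb m * (1 - Real.cos (2 * Real.sqrt 2 * r * Lb m y))) (-(Real.pi / 8) * Lam r y) := by
  rw [Lam_eq]
  set ζ := 2 * Real.sqrt 2 * r with hζ
  set φ := ζ * pp y / 4 with hφ
  set w := (y 3 - y 2) / 2 with hw
  set v := (y 1 - y 0) / 2 with hv
  have oa : HasSum (fun m : ℤ => ca m * Real.sin (4 * m * φ)) 0 := by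
    have h := (summ_ca_mul (fun m => Real.sin (4 * m * φ)) fun m => Real.abs_sin_le_one _).hasSum
    rwa [tsum_odd 0] at h
    intro m
    rw [zero_sub, ca_neg]; push_cast
    have : 4 * -(m:ℝ) * φ = -(4 * m * φ) := by ring
    rw [this, Real.sin_neg]; ring
  have ob : HasSum (fun m : ℤ => cb m * Real.sin ((4 * m + 2) * φ)) 0 := by
    have h := (summ_cb_mul (fun m => Real.sin ((4 * m + 2) * φ)) fun m => Real.abs_sin_le_one _).hasSum
    rwa [tsum_odd (-1)] at h
    intro m
    rw [cb_refl]; push_cast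
    have : (4 * (-1 - (m:ℝ)) + 2) * φ = -((4 * m + 2) * φ) := by ring
    rw [this, Real.sin_neg]; ring
  have H := ((ca_sum.sub (((PA_sum φ).mul_left (Real.cos (ζ * w))).sub (oa.mul_left (Real.sin (ζ * w)))))).add
    (cb_sum.sub (((PB_sum φ).mul_left (Real.cos (ζ * v))).add (ob.mul_left (Real.sin (ζ * v)))))
  convert! H using 1
  · ext m
    have e1 : ζ * La m y = ζ * w + 4 * m * φ := by rw [La_eq, hφ]; ring
    have e2 : ζ * Lb m y = (4 * m + 2) * φ - ζ * v := by rw [hφ, hv]; unfold Lb pp; ring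
    rw [e1, e2, Real.cos_add, Real.cos_sub]; ring
  · ring

lemma Lam_cont (y : Fin 4 → ℝ) : Continuous (fun r => Lam r y) := by
  simp only [Lam_eq]; fun_prop

lemma Lam_bd (y : Fin 4 → ℝ) : ∃ C, 0 ≤ C ∧ ∀ r, |Lam r y| ≤ C * r ^ 2 := by
  refine ⟨16 * ((y 3 - y 2) / 2) ^ 2 + 16 * ((y 1 - y 0) / 2) ^ 2 + 2 * (pp y) ^ 2, by positivity, fun r => ?_⟩
  rw [Lam_eq]
  set φ := 2 * Real.sqrt 2 * r * pp y / 4 with hφ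
  set W := 2 * Real.sqrt 2 * r * ((y 3 - y 2) / 2) with hW
  set V := 2 * Real.sqrt 2 * r * ((y 1 - y 0) / 2) with hV
  have sc := Real.sin_sq_add_cos_sq φ
  have c0 := abs_nonneg (Real.cos φ); have c1 := Real.abs_cos_le_one φ
  have s0 := abs_nonneg (Real.sin φ); have s1 := Real.abs_sin_le_one φ
  have hs : Real.sin φ ^ 2 ≤ φ ^ 2 := by
    rw [sq_le_sq]; exact Real.abs_sin_le_abs
  have hc : 1 - |Real.cos φ| ≤ φ ^ 2 := by
    have := sq_abs (Real.cos φ); nlinarith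
  have w0 := Real.cos_le_one W; have w1 := Real.one_sub_sq_div_two_le_cos (x := W)
  have v0 := Real.cos_le_one V; have v1 := Real.one_sub_sq_div_two_le_cos (x := V)
  have q : Real.sqrt 2 ^ 2 = 2 := by rw [sq]; exact s2sq
  have eφ : φ ^ 2 = r ^ 2 * pp y ^ 2 / 2 := by rw [hφ]; ring_nf; rw [q]; ring
  have eW : W ^ 2 = 8 * r ^ 2 * ((y 3 - y 2) / 2) ^ 2 := by rw [hW]; ring_nf; rw [q]; ring
  have eV : V ^ 2 = 8 * r ^ 2 * ((y 1 - y 0) / 2) ^ 2 := by rw [hV]; ring_nf; rw [q]; ring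
  have b : (16 * ((y 3 - y 2) / 2) ^ 2 + 16 * ((y 1 - y 0) / 2) ^ 2 + 2 * (pp y) ^ 2) * r ^ 2 = 2 * W ^ 2 + 2 * V ^ 2 + 4 * φ ^ 2 := by
    rw [eφ, eW, eV]; ring
  rw [b]
  have e : 2 * Real.cos W * (|Real.cos φ| + |Real.sin φ|) + 2 * Real.cos V * (|Real.cos φ| - |Real.sin φ|) - 4
    = -(2 * (1 - Real.cos W) * (|Real.cos φ| + |Real.sin φ|) + 2 * (1 - Real.cos V) * (|Real.cos φ| - |Real.sin φ|) + 4 * (1 - |Real.cos φ|)) := by ring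
  rw [e, abs_neg, abs_le]
  have h1 : (1 - Real.cos W) * (|Real.cos φ| + |Real.sin φ|) ≤ W ^ 2 / 2 * 2 := by
    apply mul_le_mul <;> linarith [sq_nonneg W]
  have h1' : 0 ≤ (1 - Real.cos W) * (|Real.cos φ| + |Real.sin φ|) := mul_nonneg (by linarith) (by linarith)
  have h2 : |(1 - Real.cos V) * (|Real.cos φ| - |Real.sin φ|)| ≤ V ^ 2 / 2 * 1 := by
    rw [abs_mul]
    apply mul_le_mul _ _ (abs_nonneg _) (by positivity)
    · rw [abs_of_nonneg (by linarith)]; linarith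
    · rw [abs_le]; constructor <;> linarith
  obtain ⟨h3, h4⟩ := abs_le.mp h2
  have := sq_nonneg V; have := sq_nonneg W; have := sq_nonneg φ
  constructor <;> linarith

lemma Lam_int (τ : ℝ) (hτ : 0 < τ) (y : Fin 4 → ℝ) :
    Integrable (fun r : ℝ => Real.exp (-τ * r ^ 2) * Lam r y / r ^ 2) := by
  obtain ⟨C, hC, h⟩ := Lam_bd y
  have := (gint τ hτ).mul_bdd (c := C) (g := fun r => Lam r y / r ^ 2)
    (((Lam_cont y).measurable.div (by fun_prop : Measurable fun r : ℝ => r ^ 2)).aestronglyMeasurable)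
    (Filter.Eventually.of_forall fun r => by
      rw [Real.norm_eq_abs, abs_div, abs_of_nonneg (sq_nonneg r)]
      exact div_le_of_le_mul₀ (sq_nonneg r) hC (h r))
  refine this.congr (Filter.Eventually.of_forall fun r => ?_)
  simp only; ring

lemma Lam_bd12 (r : ℝ) (y : Fin 4 → ℝ) : |Lam r y| ≤ 12 := by
  rw [Lam_eq]
  set φ := 2 * Real.sqrt 2 * r * pp y / 4 with hφ
  set W := 2 * Real.sqrt 2 * r * ((y 3 - y 2) / 2) with hW
  set V := 2 * Real.sqrt 2 * r * ((y 1 - y 0) / 2) with hV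
  have c0 := abs_nonneg (Real.cos φ); have c1 := Real.abs_cos_le_one φ
  have s0 := abs_nonneg (Real.sin φ); have s1 := Real.abs_sin_le_one φ
  have w := Real.abs_cos_le_one W
  have v := Real.abs_cos_le_one V
  have h1 : |Real.cos W * (|Real.cos φ| + |Real.sin φ|)| ≤ 1 * 2 := by
    rw [abs_mul]
    apply mul_le_mul w _ (abs_nonneg _) (by norm_num)
    rw [abs_le]; constructor <;> linarith
  have h2 : |Real.cos V * (|Real.cos φ| - |Real.sin φ|)| ≤ 1 * 1 := by
    rw [abs_mul]
    apply mul_le_mul v _ (abs_nonneg _) (by norm_num)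
    rw [abs_le]; constructor <;> linarith
  obtain ⟨h3, h4⟩ := abs_le.mp h1
  obtain ⟨h5, h6⟩ := abs_le.mp h2
  rw [abs_le]; constructor <;> linarith

lemma Lam_time (τ : ℝ) (hτ : 0 < τ) (y : Fin 4 → ℝ) :
    HasDerivAt (fun τ => ∫ r : ℝ, Real.exp (-τ * r ^ 2) * Lam r y / r ^ 2)
      (-∫ r : ℝ, Real.exp (-τ * r ^ 2) * Lam r y) τ := by
  rw [← integral_neg]
  have hms : ∀ τ : ℝ, AEStronglyMeasurable (fun r : ℝ => Real.exp (-τ * r ^ 2) * Lam r y / r ^ 2) volume := fun τ => by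
    have := (Lam_cont y).measurable
    exact (by fun_prop : Measurable _).aestronglyMeasurable
  refine (hasDerivAt_integral_of_dominated_loc_of_deriv_le (s := Metric.ball τ (τ / 2))
    (F' := fun τ r => -(Real.exp (-τ * r ^ 2) * Lam r y))
    (bound := fun r => Real.exp (-(τ / 2) * r ^ 2) * 12)
    (Metric.ball_mem_nhds τ (by linarith)) (Filter.Eventually.of_forall hms) (Lam_int τ hτ y) ?_ ?_ ?_ ?_).2
  · have := (Lam_cont y)
    exact (by fun_prop : Continuous _).aestronglyMeasurable
  · refine Filter.Eventually.of_forall fun r t ht => ?_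
    rw [norm_neg, norm_mul, Real.norm_eq_abs, Real.norm_eq_abs, Real.abs_exp]
    have : τ / 2 ≤ t := by
      rw [Metric.mem_ball, Real.dist_eq] at ht
      have := (abs_lt.mp ht).1; linarith
    gcongr
    exact Lam_bd12 r y
  · exact (gint (τ / 2) (by linarith)).mul_const 12
  · refine Filter.Eventually.of_forall fun r t ht => ?_
    have h1 : HasDerivAt (fun t : ℝ => -t * r ^ 2) (-1 * r ^ 2) t := by
      exact ((hasDerivAt_id t).neg).mul_const _
    have h2 := ((h1.exp).mul_const (Lam r y)).div_const (r ^ 2)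
    convert! h2 using 1
    rcases eq_or_ne r 0 with rfl | hr
    · obtain ⟨C, hC, h⟩ := Lam_bd y
      have := h 0
      simp at this
      simp [this]
    · field_simp

lemma Lam_int_series (τ : ℝ) (hτ : 0 < τ) (y : Fin 4 → ℝ) :
    HasSum (fun m : ℤ => ca m * ff τ (La m y) + cb m * ff τ (Lb m y))
      (Real.pi * (∫ r : ℝ, Real.exp (-τ * r ^ 2) * Lam r y) + 4 * Real.pi * Real.sqrt (Real.pi / τ)) := by
  have hint : ∀ z, Integrable (fun r : ℝ => Real.exp (-τ * r ^ 2) * (1 - Real.cos (2 * Real.sqrt 2 * r * z))) := fun z =>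
    (gint τ hτ).mul_bdd (c := 2) (by exact (by fun_prop : Continuous _).aestronglyMeasurable)
      (Filter.Eventually.of_forall fun r => by
        have := Real.cos_le_one (2 * Real.sqrt 2 * r * z); have := Real.neg_one_le_cos (2 * Real.sqrt 2 * r * z)
        rw [Real.norm_eq_abs, abs_le]; constructor <;> linarith)
  have hval : ∀ z, ∫ r : ℝ, Real.exp (-τ * r ^ 2) * (1 - Real.cos (2 * Real.sqrt 2 * r * z)) =
      Real.sqrt (Real.pi / τ) - ff τ z / 8 := fun z => by
    rw [← gauss_cos_ff τ hτ z, ← gauss_total τ, ← integral_sub (gint τ hτ)]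
    · congr 1; ext r; ring
    · exact (gint τ hτ).mul_bdd (c := 1) (by exact (by fun_prop : Continuous _).aestronglyMeasurable)
        (Filter.Eventually.of_forall fun r => Real.abs_cos_le_one _)
  have e : ∀ m, (fun r : ℝ => Real.exp (-τ * r ^ 2) * (ca m * (1 - Real.cos (2 * Real.sqrt 2 * r * La m y))
      + cb m * (1 - Real.cos (2 * Real.sqrt 2 * r * Lb m y)))) = fun r =>
      ca m * (Real.exp (-τ * r ^ 2) * (1 - Real.cos (2 * Real.sqrt 2 * r * La m y))) +
      cb m * (Real.exp (-τ * r ^ 2) * (1 - Real.cos (2 * Real.sqrt 2 * r * Lb m y))) := fun m => by ext r; ring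
  have hI : ∀ m, Integrable (fun r : ℝ => Real.exp (-τ * r ^ 2) * (ca m * (1 - Real.cos (2 * Real.sqrt 2 * r * La m y))
      + cb m * (1 - Real.cos (2 * Real.sqrt 2 * r * Lb m y)))) := fun m => by
    rw [e]; exact ((hint _).const_mul _).add ((hint _).const_mul _)
  have h := hasSum_integral_of_summable_integral_norm hI ?_
  · have e2 : ∀ r : ℝ, (∑' m : ℤ, Real.exp (-τ * r ^ 2) * (ca m * (1 - Real.cos (2 * Real.sqrt 2 * r * La m y))
      + cb m * (1 - Real.cos (2 * Real.sqrt 2 * r * Lb m y)))) = -(Real.pi / 8) * (Real.exp (-τ * r ^ 2) * Lam r y) := fun r => by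
      rw [tsum_mul_left, (Lam_series r y).tsum_eq]; ring
    simp only [e2, e] at h
    rw [integral_const_mul] at h
    have h2 := (((ca_sum.add cb_sum).mul_right (Real.sqrt (Real.pi / τ))).sub h).mul_left 8
    convert! h2 using 1
    · ext m
      rw [integral_add ((hint _).const_mul _) ((hint _).const_mul _), integral_const_mul, integral_const_mul, hval, hval]
      ring
    · ring
  · refine Summable.of_nonneg_of_le (fun m => integral_nonneg fun r => norm_nonneg _) (fun m => ?_)
      (sum_inv_sq.mul_left (4 * Real.sqrt (Real.pi / τ)))
    have : ∫ r : ℝ, Real.exp (-τ * r ^ 2) * (4 * (1 / (1 + (m:ℝ) ^ 2))) = 4 * Real.sqrt (Real.pi / τ) * (1 / (1 + (m:ℝ) ^ 2)) := by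
      rw [integral_mul_const, gauss_total]; ring
    rw [← this]
    refine integral_mono (hI m).norm ((gint τ hτ).mul_const _) fun r => ?_
    simp only
    rw [norm_mul, Real.norm_eq_abs, Real.norm_eq_abs, Real.abs_exp]
    gcongr
    have b : ∀ x : ℝ, |1 - Real.cos x| ≤ 2 := fun x => by
      have := Real.cos_le_one x; have := Real.neg_one_le_cos x
      rw [abs_le]; constructor <;> linarith
    refine (abs_add_le _ _).trans ?_
    rw [abs_mul, abs_mul, abs_of_pos (cb_pos m)]
    have h1 := mul_le_mul (ca_bd m) (b (2 * Real.sqrt 2 * r * La m y)) (abs_nonneg _) (by positivity)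
    have h2 := mul_le_mul (cb_bd m) (b (2 * Real.sqrt 2 * r * Lb m y)) (abs_nonneg _) (by positivity)
    linarith

lemma sum_sqrt_inv : Summable (fun m : ℤ => Real.sqrt (1 + |(m:ℝ)|) * (1 / (1 + (m:ℝ) ^ 2))) := by
  have h1 : Summable (fun m : ℤ => 2 * |(m:ℝ)| ^ (-(3/2) : ℝ)) := (Real.summable_abs_int_rpow (b := 3/2) (by norm_num)).mul_left 2
  have h2 : Summable (fun m : ℤ => if m = 0 then (1:ℝ) else 0) := (hasSum_ite_eq (0:ℤ) (1:ℝ)).summable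
  refine Summable.of_nonneg_of_le (fun m => by positivity) (fun m => ?_) (h1.add h2)
  by_cases hm : m = 0
  · subst hm
    have : (0:ℝ) ≤ |((0:ℤ):ℝ)| ^ (-(3/2) : ℝ) := by positivity
    simp
  · simp only [hm, if_false, add_zero]
    have h : 1 ≤ |(m:ℝ)| := by exact_mod_cast Int.one_le_abs hm
    set a := |(m:ℝ)| with ha
    have e : (m:ℝ) ^ 2 = a ^ 2 := by rw [ha, sq_abs]
    have ha0 : 0 < a := by linarith
    have e1 : a ^ (-(3/2) : ℝ) = Real.sqrt a * (1 / a ^ 2) := by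
      rw [Real.sqrt_eq_rpow, one_div (a ^ 2), ← Real.rpow_natCast, ← Real.rpow_neg ha0.le, ← Real.rpow_add ha0]
      norm_num
    rw [e, e1]
    have h3 : Real.sqrt (1 + a) ≤ 2 * Real.sqrt a := by
      rw [show (2:ℝ) = Real.sqrt 4 by rw [show (4:ℝ) = 2 ^ 2 by norm_num]; rw [Real.sqrt_sq (by norm_num)], ← Real.sqrt_mul (by norm_num)]
      apply Real.sqrt_le_sqrt; linarith
    have h4 : 1 / (1 + a ^ 2) ≤ 1 / a ^ 2 := one_div_le_one_div_of_le (by positivity) (by linarith)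
    calc _ ≤ 2 * Real.sqrt a * (1 / a ^ 2) := mul_le_mul h3 h4 (by positivity) (by positivity)
      _ = _ := by ring

lemma cos_sub_bd (A B e : ℝ) (he : 0 < e) :
    |Real.cos A - Real.cos B| ≤ (1 / e) * (1 - Real.cos (A + B)) / 2 + e * (1 - Real.cos (A - B)) / 2 := by
  have h := Real.cos_sub_cos A B
  have h1 : Real.cos (A + B) = 1 - 2 * Real.sin ((A + B) / 2) ^ 2 := by
    have := Real.cos_sq' ((A + B) / 2)
    have h2 := Real.cos_two_mul ((A + B) / 2)
    rw [show 2 * ((A + B) / 2) = A + B by ring] at h2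
    linarith
  have h2 : Real.cos (A - B) = 1 - 2 * Real.sin ((A - B) / 2) ^ 2 := by
    have := Real.cos_sq' ((A - B) / 2)
    have h2 := Real.cos_two_mul ((A - B) / 2)
    rw [show 2 * ((A - B) / 2) = A - B by ring] at h2
    linarith
  rw [h, h1, h2]
  set s := Real.sin ((A + B) / 2)
  set t := Real.sin ((A - B) / 2)
  have e1 : (1 / e) * (1 - (1 - 2 * s ^ 2)) / 2 + e * (1 - (1 - 2 * t ^ 2)) / 2 = (s ^ 2 + (e * t) ^ 2) / e := by
    field_simp; ring
  rw [e1, le_div_iff₀ he]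
  have : |-2 * s * t| * e = |-2 * s * (e * t)| := by
    rw [show -2 * s * (e * t) = (-2 * s * t) * e by ring, abs_mul _ e, abs_of_pos he]
  rw [this, abs_le]
  constructor <;> nlinarith [sq_nonneg (s - e * t), sq_nonneg (s + e * t)]

lemma Lam_int_Fs (τ : ℝ) (hτ : 0 < τ) (y : Fin 4 → ℝ) :
    ∫ r : ℝ, Real.exp (-τ * r ^ 2) * Lam r y / r ^ 2 = -(8 / Real.pi) * Fs τ y := by
  obtain ⟨K, hK0, hK⟩ := gd_bounded τ hτ
  have hint := gg_integrable τ hτ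
  have e : ∀ m, (fun r : ℝ => Real.exp (-τ * r ^ 2) * (ca m * (1 - Real.cos (2 * Real.sqrt 2 * r * La m y))
      + cb m * (1 - Real.cos (2 * Real.sqrt 2 * r * Lb m y))) / r ^ 2) = fun r =>
      ca m * (Real.exp (-τ * r ^ 2) * ((1 - Real.cos (2 * Real.sqrt 2 * r * La m y)) / r ^ 2)) +
      cb m * (Real.exp (-τ * r ^ 2) * ((1 - Real.cos (2 * Real.sqrt 2 * r * Lb m y)) / r ^ 2)) := fun m => by ext r; ring
  have hI : ∀ m, Integrable (fun r : ℝ => Real.exp (-τ * r ^ 2) * (ca m * (1 - Real.cos (2 * Real.sqrt 2 * r * La m y))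
      + cb m * (1 - Real.cos (2 * Real.sqrt 2 * r * Lb m y))) / r ^ 2) := fun m => by
    rw [e]; exact ((hint _).const_mul _).add ((hint _).const_mul _)
  have h := hasSum_integral_of_summable_integral_norm hI ?_
  · have e2 : ∀ r : ℝ, (∑' m : ℤ, Real.exp (-τ * r ^ 2) * (ca m * (1 - Real.cos (2 * Real.sqrt 2 * r * La m y))
      + cb m * (1 - Real.cos (2 * Real.sqrt 2 * r * Lb m y))) / r ^ 2) = -(Real.pi / 8) * (Real.exp (-τ * r ^ 2) * Lam r y / r ^ 2) := fun r => by
      rw [tsum_div_const, tsum_mul_left, (Lam_series r y).tsum_eq]; ring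
    simp only [e2, e] at h
    rw [integral_const_mul] at h
    have h2 : Fs τ y = -(Real.pi / 8) * ∫ r : ℝ, Real.exp (-τ * r ^ 2) * Lam r y / r ^ 2 := by
      rw [← h.tsum_eq, Fs]
      congr 1; ext m
      rw [integral_add ((hint _).const_mul _) ((hint _).const_mul _), integral_const_mul, integral_const_mul]
      rfl
    rw [h2]
    have := Real.pi_ne_zero
    field_simp
  · obtain ⟨M, hM0, hM1, hM2⟩ : ∃ M : ℝ, 0 ≤ M ∧ (∀ m : ℤ, |La m y| ≤ M * (1 + |(m:ℝ)|)) ∧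
        (∀ m : ℤ, |La m y + Lb m y| ≤ M * (1 + |(m:ℝ)|)) := by
      refine ⟨2 * |pp y| + |(y 3 - y 2) / 2| + |(y 3 + y 2 - 2 * y 1) / 2|, by positivity, fun m => ?_, fun m => ?_⟩
      · rw [La_eq]
        refine (abs_add_le _ _).trans ?_
        rw [abs_mul]
        have := abs_nonneg (m:ℝ); have := abs_nonneg (pp y); have := abs_nonneg ((y 3 - y 2) / 2)
        have := abs_nonneg ((y 3 + y 2 - 2 * y 1) / 2)
        nlinarith [mul_nonneg (abs_nonneg (m:ℝ)) (abs_nonneg (pp y)), mul_nonneg (abs_nonneg (m:ℝ)) (abs_nonneg ((y 3 - y 2) / 2)),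
          mul_nonneg (abs_nonneg (m:ℝ)) (abs_nonneg ((y 3 + y 2 - 2 * y 1) / 2))]
      · rw [La_eq, Lb_eq]
        have h1 := abs_add_le ((m:ℝ) * pp y + (y 3 - y 2) / 2) (m * pp y + (y 3 + y 2 - 2 * y 1) / 2)
        have h2 := abs_add_le ((m:ℝ) * pp y) ((y 3 - y 2) / 2)
        have h3 := abs_add_le ((m:ℝ) * pp y) ((y 3 + y 2 - 2 * y 1) / 2)
        rw [abs_mul] at h2 h3
        have := abs_nonneg (m:ℝ); have := abs_nonneg (pp y); have := abs_nonneg ((y 3 - y 2) / 2)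
        have := abs_nonneg ((y 3 + y 2 - 2 * y 1) / 2)
        nlinarith [mul_nonneg (abs_nonneg (m:ℝ)) (abs_nonneg (pp y)), mul_nonneg (abs_nonneg (m:ℝ)) (abs_nonneg ((y 3 - y 2) / 2)),
          mul_nonneg (abs_nonneg (m:ℝ)) (abs_nonneg ((y 3 + y 2 - 2 * y 1) / 2))]
    set D := |y 2 - y 1| with hD
    refine Summable.of_nonneg_of_le (fun m => integral_nonneg fun r => norm_nonneg _) (fun m => ?_)
      (sum_sqrt_inv.mul_left (K * (9 * M + D)))
    set e0 := Real.sqrt (1 + |(m:ℝ)|) with he0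
    have he1 : 1 ≤ e0 := by
      rw [he0]; exact Real.one_le_sqrt.mpr (by linarith [abs_nonneg (m:ℝ)])
    have hes : e0 * e0 = 1 + |(m:ℝ)| := Real.mul_self_sqrt (by positivity)
    set E : ℝ → ℝ → ℝ := fun z r => Real.exp (-τ * r ^ 2) * ((1 - Real.cos (2 * Real.sqrt 2 * r * z)) / r ^ 2) with hE
    have hEi : ∀ z, Integrable (E z) := hint
    have hEv : ∀ z, ∫ r, E z r = gg τ z := fun z => rfl
    set BB : ℝ → ℝ := fun r => |ca m + cb m| * E (La m y) r + (cb m * ((1 / e0) / 2) * E (La m y + Lb m y) r + cb m * (e0 / 2) * E (La m y - Lb m y) r) with hBB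
    have hBi : Integrable BB := ((hEi _).const_mul _).add (((hEi _).const_mul _).add ((hEi _).const_mul _))
    have hBv : ∫ r, BB r = |ca m + cb m| * gg τ (La m y) + (cb m * ((1 / e0) / 2) * gg τ (La m y + Lb m y) + cb m * (e0 / 2) * gg τ (La m y - Lb m y)) := by
      have i1 : Integrable (fun r => cb m * ((1 / e0) / 2) * E (La m y + Lb m y) r + cb m * (e0 / 2) * E (La m y - Lb m y) r) :=
        ((hEi _).const_mul _).add ((hEi _).const_mul _)
      simp only [hBB]
      rw [integral_add ((hEi _).const_mul _) i1, integral_add ((hEi _).const_mul _) ((hEi _).const_mul _),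
        integral_const_mul, integral_const_mul, integral_const_mul, hEv, hEv, hEv]
    have hcb := cb_pos m
    refine (integral_mono (hI m).norm hBi fun r => ?_).trans ?_
    · simp only [hBB, hE]
      rw [Real.norm_eq_abs, abs_div, abs_mul, Real.abs_exp, abs_of_nonneg (sq_nonneg r)]
      set A := 2 * Real.sqrt 2 * r * La m y with hA
      set B := 2 * Real.sqrt 2 * r * Lb m y with hB
      rw [show 2 * Real.sqrt 2 * r * (La m y + Lb m y) = A + B by rw [hA, hB]; ring,
        show 2 * Real.sqrt 2 * r * (La m y - Lb m y) = A - B by rw [hA, hB]; ring]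
      have hc := cos_sub_bd A B e0 (by linarith)
      have h1 : |ca m * (1 - Real.cos A) + cb m * (1 - Real.cos B)| ≤ |ca m + cb m| * (1 - Real.cos A) +
          cb m * ((1 / e0) * (1 - Real.cos (A + B)) / 2 + e0 * (1 - Real.cos (A - B)) / 2) := by
        rw [show ca m * (1 - Real.cos A) + cb m * (1 - Real.cos B) = (ca m + cb m) * (1 - Real.cos A) + cb m * (Real.cos A - Real.cos B) by ring]
        refine (abs_add_le _ _).trans ?_
        rw [abs_mul, abs_mul, abs_of_pos hcb, abs_of_nonneg (by linarith [Real.cos_le_one A] : 0 ≤ 1 - Real.cos A)]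
        gcongr
      have h2 : 0 ≤ Real.exp (-τ * r ^ 2) / r ^ 2 := by positivity
      have h3 := mul_le_mul_of_nonneg_left h1 h2
      refine le_of_eq_of_le ?_ (h3.trans_eq ?_) <;> ring
    · rw [hBv]
      have g1 := gg_le τ hτ K hK (La m y)
      have g2 := gg_le τ hτ K hK (La m y + Lb m y)
      have g3 := gg_le τ hτ K hK (La m y - Lb m y)
      have hd : |La m y - Lb m y| = D := by
        rw [abs_sub_comm, Lb_sub_La]
      rw [hd] at g3
      have n1 := gg_nonneg τ (La m y)
      set q := 1 / (1 + (m:ℝ) ^ 2) with hq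
      have hq0 : 0 < q := by positivity
      have hb := cb_bd m
      have hab : |ca m + cb m| ≤ 8 * q / (1 + |(m:ℝ)|) := by
        have := cab_bd m
        rw [show 8 * q / (1 + |(m:ℝ)|) = 8 / ((1 + (m:ℝ) ^ 2) * (1 + |(m:ℝ)|)) by rw [hq]; field_simp]
        exact this
      have t1 : |ca m + cb m| * gg τ (La m y) ≤ 8 * q * K * M := by
        calc _ ≤ (8 * q / (1 + |(m:ℝ)|)) * (K * (M * (1 + |(m:ℝ)|))) :=
              mul_le_mul hab (g1.trans (mul_le_mul_of_nonneg_left (hM1 m) hK0.le)) n1 (by positivity)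
          _ = _ := by field_simp
      have t2 : cb m * ((1 / e0) / 2) * gg τ (La m y + Lb m y) ≤ q * e0 * K * M := by
        calc _ ≤ q * ((1 / e0) / 2) * (K * (M * (1 + |(m:ℝ)|))) :=
              mul_le_mul (mul_le_mul_of_nonneg_right hb (by positivity)) (g2.trans (mul_le_mul_of_nonneg_left (hM2 m) hK0.le)) (gg_nonneg _ _) (by positivity)
          _ = q * e0 * K * M / 2 := by rw [← hes]; field_simp
          _ ≤ _ := by
              have : 0 ≤ q * e0 * K * M := by positivity
              linarith
      have t3 : cb m * (e0 / 2) * gg τ (La m y - Lb m y) ≤ q * e0 * K * D := by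
        calc _ ≤ q * (e0 / 2) * (K * D) :=
              mul_le_mul (mul_le_mul_of_nonneg_right hb (by positivity)) g3 (gg_nonneg _ _) (by positivity)
          _ = q * e0 * K * D / 2 := by ring
          _ ≤ _ := by
              have : 0 ≤ q * e0 * K * D := by positivity
              linarith
      have t4 : 8 * q * K * M ≤ 8 * q * K * M * e0 := le_mul_of_one_le_right (by positivity) he1
      calc _ ≤ 8 * q * K * M * e0 + (q * e0 * K * M + q * e0 * K * D) := by linarith
        _ = _ := by ring

lemma u_eq (T t : ℝ) (h : t < T) (x : Fin 4 → ℝ) :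
    u T t x = 1 / (2 * Real.sqrt 2 * Real.pi) * Fs (T - t) (sortv x) + (1 / 4) * ∑ i, x i + (1 / 2) * Real.sqrt ((T - t) * Real.pi / 2) := by
  unfold u
  rw [Lam_int_Fs (T - t) (by linarith)]
  have := Real.pi_ne_zero
  congr 2
  field_simp
  ring

/-- Gaussian -/
def GG (C x : ℝ) : ℝ := Real.exp (-(C * x ^ 2))

lemma GG_summable (C : ℝ) (hC : 0 < C) (s : ℝ) : Summable (fun m : ℤ => GG C (m + s)) := by
  set d := min 1 (C / 2) with hd
  have hd0 : 0 < d := lt_min one_pos (by linarith)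
  refine Summable.of_nonneg_of_le (fun m => (Real.exp_pos _).le) (fun m => ?_)
    (sum_inv_sq.mul_left (Real.exp (C * s ^ 2) / d))
  unfold GG
  have h1 : -(C * ((m:ℝ) + s) ^ 2) ≤ C * s ^ 2 + -(C / 2 * (m:ℝ) ^ 2) := by
    nlinarith [mul_nonneg hC.le (sq_nonneg ((m:ℝ) + 2 * s))]
  have h2 : Real.exp (-(C / 2 * (m:ℝ) ^ 2)) ≤ 1 / (d * (1 + (m:ℝ) ^ 2)) := by
    rw [Real.exp_neg, ← one_div]
    apply one_div_le_one_div_of_le (by positivity)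
    have h3 := Real.add_one_le_exp (C / 2 * (m:ℝ) ^ 2)
    have h4 : d ≤ 1 := min_le_left _ _
    have h5 : d ≤ C / 2 := min_le_right _ _
    nlinarith [mul_le_mul_of_nonneg_right h5 (sq_nonneg (m:ℝ))]
  calc _ ≤ Real.exp (C * s ^ 2) * Real.exp (-(C / 2 * (m:ℝ) ^ 2)) := by
        rw [← Real.exp_add]; exact Real.exp_le_exp.mpr h1
    _ ≤ Real.exp (C * s ^ 2) * (1 / (d * (1 + (m:ℝ) ^ 2))) := by gcongr
    _ = _ := by field_simp

lemma GG_hasDeriv (C x : ℝ) : HasDerivAt (GG C) (-(2 * C * x) * GG C x) x := by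
  unfold GG
  have h : HasDerivAt (fun x : ℝ => -(C * x ^ 2)) (-(C * (2 * x))) x := by
    have := ((hasDerivAt_pow 2 x).const_mul C).neg
    convert! this using 1
    norm_num
  convert! h.exp using 1
  ring

lemma GG_even (C x : ℝ) : GG C (-x) = GG C x := by simp [GG]

lemma GG_anti (C : ℝ) (hC : 0 < C) {x y : ℝ} (hx : 0 ≤ x) (h : x ≤ y) : GG C y ≤ GG C x := by
  unfold GG
  apply Real.exp_le_exp.mpr
  have : x ^ 2 ≤ y ^ 2 := by gcongr
  nlinarith

lemma antitone_of_hasDeriv {f f' : ℝ → ℝ} {a b : ℝ} (hf : ∀ x, HasDerivAt f (f' x) x)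
    (hn : ∀ x, a < x → x < b → f' x ≤ 0) {x y : ℝ} (hx : a ≤ x) (hxy : x ≤ y) (hy : y ≤ b) : f y ≤ f x := by
  have : AntitoneOn f (Set.Icc a b) := by
    refine antitoneOn_of_deriv_nonpos (convex_Icc a b) (fun x _ => (hf x).continuousAt.continuousWithinAt)
      (fun x _ => (hf x).differentiableAt.differentiableWithinAt) (fun x hx => ?_)
    rw [interior_Icc] at hx
    rw [(hf x).deriv]; exact hn x hx.1 hx.2
  exact this ⟨hx, hxy.trans hy⟩ ⟨hx.trans hxy, hy⟩ hxy

lemma xGG_anti (C : ℝ) (hC : 8 ≤ C) {x y : ℝ} (hx : 1 / 4 ≤ x) (h : x ≤ y) : y * GG C y ≤ x * GG C x := by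
  refine antitone_of_hasDeriv (f := fun x => x * GG C x) (a := 1/4) (b := y)
    (fun x => (hasDerivAt_id x).mul (GG_hasDeriv C x)) (fun z hz _ => ?_) hx h le_rfl
  have : 0 < GG C z := Real.exp_pos _
  have h2 : 1 - 2 * C * z ^ 2 ≤ 0 := by nlinarith
  simp only [id]
  nlinarith

lemma theta_B1 (C : ℝ) (hC : 8 ≤ C) (m : ℕ) {s s' : ℝ} (hs : 1 / 4 ≤ s) (h : s ≤ s') (hs' : s' ≤ 1 / 2) :
    GG C (m + s') + GG C (-((m:ℝ) + 1) + s') ≤ GG C (m + s) + GG C (-((m:ℝ) + 1) + s) := by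
  have hd1 : ∀ x : ℝ, HasDerivAt (fun x => GG C (m + x)) (-(2 * C * (m + x)) * GG C (m + x)) x := fun x => by
    simpa using (GG_hasDeriv C (m + x)).comp_const_add (m:ℝ) x
  have hd2 : ∀ x : ℝ, HasDerivAt (fun x => GG C (-((m:ℝ) + 1) + x)) (-(2 * C * (-((m:ℝ) + 1) + x)) * GG C (-((m:ℝ) + 1) + x)) x := fun x => by
    simpa using (GG_hasDeriv C (-((m:ℝ) + 1) + x)).comp_const_add (-((m:ℝ) + 1)) x
  refine antitone_of_hasDeriv (a := 1/4) (b := 1/2) (fun x => (hd1 x).add (hd2 x)) (fun x h1 h2 => ?_) hs h hs'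
  have hm : (0:ℝ) ≤ m := by positivity
  have e : GG C (-((m:ℝ) + 1) + x) = GG C ((m:ℝ) + 1 - x) := by
    rw [← GG_even]; congr 1; ring
  rw [e]
  have := xGG_anti C hC (x := m + x) (y := m + 1 - x) (by linarith) (by linarith)
  nlinarith

lemma theta_B2 (C : ℝ) (hC : 14 ≤ C) (m : ℕ) {s s' : ℝ} (hs : 0 ≤ s) (h : s ≤ s') (hs' : s' ≤ 1 / 4) :
    (GG C (((m:ℝ) + 1) + s') + GG C (-((m:ℝ) + 1) + s')) - (GG C (((m:ℝ) + 1) + s) + GG C (-((m:ℝ) + 1) + s))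
     ≤ 0.6 * (1 / ((m:ℝ) + 1) ^ 2) * (GG C s - GG C s') := by
  set M := (m:ℝ) + 1 with hM
  have hM1 : 1 ≤ M := by rw [hM]; have : (0:ℝ) ≤ m := by positivity
                         linarith
  have hd1 : ∀ x : ℝ, HasDerivAt (fun x => GG C (M + x)) (-(2 * C * (M + x)) * GG C (M + x)) x := fun x => by
    simpa using (GG_hasDeriv C (M + x)).comp_const_add M x
  have hd2 : ∀ x : ℝ, HasDerivAt (fun x => GG C (-M + x)) (-(2 * C * (-M + x)) * GG C (-M + x)) x := fun x => by
    simpa using (GG_hasDeriv C (-M + x)).comp_const_add (-M) x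
  set w : ℝ := 0.6 * (1 / M ^ 2) with hw
  have hw0 : 0 ≤ w := by positivity
  have key : ∀ x, 0 < x → x < 1 / 4 → -(2 * C * (M + x)) * GG C (M + x) + -(2 * C * (-M + x)) * GG C (-M + x)
      + w * (-(2 * C * x) * GG C x) ≤ 0 := by
    intro x hx0 hx1
    set X := 2 * C * M * x with hX
    have hX0 : 0 ≤ X := by positivity
    have e1 : GG C (M + x) = GG C M * GG C x * Real.exp (-X) := by
      unfold GG; rw [← Real.exp_add, ← Real.exp_add]; congr 1; rw [hX]; ring
    have e2 : GG C (-M + x) = GG C M * GG C x * Real.exp X := by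
      unfold GG; rw [← Real.exp_add, ← Real.exp_add]; congr 1; rw [hX]; ring
    have hg : 0 < GG C x := Real.exp_pos _
    have hgM : 0 < GG C M := Real.exp_pos _
    have h1 : Real.exp X - Real.exp (-X) ≤ 2 * X * Real.exp X := by
      have : Real.exp (-X) = Real.exp X * Real.exp (-2 * X) := by rw [← Real.exp_add]; congr 1; ring
      rw [this]
      have := Real.add_one_le_exp (-2 * X)
      nlinarith [Real.exp_pos X]
    have h2 : GG C M * Real.exp X ≤ Real.exp (-(C * M ^ 2 / 2)) := by
      unfold GG
      rw [← Real.exp_add]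
      apply Real.exp_le_exp.mpr
      have : X ≤ C * M ^ 2 / 2 := by
        rw [hX]
        have : 0 ≤ C * M := by positivity
        nlinarith [mul_le_mul_of_nonneg_left hM1 this, mul_le_mul_of_nonneg_left hx1.le this]
      linarith
    have h3 : 4 * C * M ^ 2 * Real.exp (-(C * M ^ 2 / 2)) ≤ w := by
      have h4 := Real.pow_div_factorial_le_exp (C * M ^ 2 / 2) (by positivity) 4
      rw [Real.exp_neg, hw]
      have h5 : 0 < (C * M ^ 2 / 2) ^ 4 / (Nat.factorial 4 : ℝ) := by positivity
      have h6 : (Real.exp (C * M ^ 2 / 2))⁻¹ ≤ ((C * M ^ 2 / 2) ^ 4 / (Nat.factorial 4 : ℝ))⁻¹ := inv_anti₀ h5 h4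
      refine (mul_le_mul_of_nonneg_left h6 (by positivity)).trans ?_
      have : 4 * C * M ^ 2 * ((C * M ^ 2 / 2) ^ 4 / (Nat.factorial 4 : ℝ))⁻¹ = 1536 / (C ^ 3 * M ^ 6) := by
        have : C ≠ 0 := by linarith
        have : M ≠ 0 := by linarith
        norm_num [Nat.factorial]
        field_simp
        norm_num
      rw [this, show (0.6:ℝ) * (1 / M ^ 2) = 1536 / (2560 * M ^ 2) by field_simp; norm_num]
      apply div_le_div_of_nonneg_left (by norm_num) (by positivity)
      have hc : (14:ℝ) ^ 3 ≤ C ^ 3 := by gcongr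
      have hm6 : M ^ 2 ≤ M ^ 6 := pow_le_pow_right₀ hM1 (by norm_num)
      calc 2560 * M ^ 2 ≤ 14 ^ 3 * M ^ 2 := by nlinarith [sq_nonneg M]
        _ ≤ C ^ 3 * M ^ 6 := mul_le_mul hc hm6 (by positivity) (by positivity)
    rw [e1, e2]
    have hC0 : 0 < C := by linarith
    have hfin : (M - x) * (GG C M * Real.exp X) - (M + x) * (GG C M * Real.exp (-X)) ≤ w * x := by
      have a1 : (M - x) * (GG C M * Real.exp X) - (M + x) * (GG C M * Real.exp (-X)) ≤ M * GG C M * (Real.exp X - Real.exp (-X)) := by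
        have := mul_pos hx0 (mul_pos hgM (Real.exp_pos X)); have := mul_pos hx0 (mul_pos hgM (Real.exp_pos (-X)))
        nlinarith
      have a2 : M * GG C M * (Real.exp X - Real.exp (-X)) ≤ M * GG C M * (2 * X * Real.exp X) := by gcongr
      have a3 : M * GG C M * (2 * X * Real.exp X) = M * 2 * X * (GG C M * Real.exp X) := by ring
      have a4 : M * 2 * X * (GG C M * Real.exp X) ≤ M * 2 * X * Real.exp (-(C * M ^ 2 / 2)) := by gcongr
      have a5 : M * 2 * X * Real.exp (-(C * M ^ 2 / 2)) = (4 * C * M ^ 2 * Real.exp (-(C * M ^ 2 / 2))) * x := by rw [hX]; ring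
      have a6 := mul_le_mul_of_nonneg_right h3 hx0.le
      linarith
    have := mul_le_mul_of_nonneg_left hfin (by positivity : 0 ≤ 2 * C * GG C x)
    nlinarith
  have := antitone_of_hasDeriv (a := 0) (b := 1/4) (fun x => ((hd1 x).add (hd2 x)).add ((GG_hasDeriv C x).const_mul w)) key hs h hs'
  simp only [Pi.add_apply] at this
  linarith

lemma inj1 : Function.Injective (fun n : ℕ => (n:ℤ) + 1) := fun a b h => by simpa using h
lemma inj2 : Function.Injective (fun n : ℕ => -((n:ℤ) + 1)) := fun a b h => by simpa using h
lemma inj0 : Function.Injective (fun n : ℕ => (n:ℤ)) := fun a b h => by simpa using h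

lemma theta_large (C : ℝ) (hC : 14 ≤ C) {s s' : ℝ} (hs : 0 ≤ s) (h : s ≤ s') (hs' : s' ≤ 1 / 2) :
    ∑' m : ℤ, GG C (m + s') ≤ ∑' m : ℤ, GG C (m + s) := by
  have hsum := GG_summable C (by linarith)
  have A : ∀ s s' : ℝ, 1 / 4 ≤ s → s ≤ s' → s' ≤ 1 / 2 → ∑' m : ℤ, GG C (m + s') ≤ ∑' m : ℤ, GG C (m + s) := by
    intro s s' hs h hs'
    have e : ∀ s : ℝ, ∑' m : ℤ, GG C (m + s) = ∑' n : ℕ, (GG C (n + s) + GG C (-((n:ℝ) + 1) + s)) ∧ Summable (fun n : ℕ => GG C (n + s) + GG C (-((n:ℝ) + 1) + s)) := by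
      intro s
      have a1 : Summable (fun n : ℕ => GG C (((n:ℤ):ℝ) + s)) := (hsum s).comp_injective inj0
      have a2 : Summable (fun n : ℕ => GG C (((-((n:ℤ) + 1) : ℤ):ℝ) + s)) := (hsum s).comp_injective inj2
      have := tsum_of_nat_of_neg_add_one (f := fun m : ℤ => GG C (m + s)) a1 a2
      rw [← a1.tsum_add a2] at this
      have a3 := a1.add a2
      push_cast at this a3
      exact ⟨this, a3⟩
    rw [(e s).1, (e s').1]
    exact (e s').2.tsum_le_tsum (fun n => theta_B1 C (by linarith) n hs h hs') (e s).2
  have B : ∀ s s' : ℝ, 0 ≤ s → s ≤ s' → s' ≤ 1 / 4 → ∑' m : ℤ, GG C (m + s') ≤ ∑' m : ℤ, GG C (m + s) := by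
    intro s s' hs h hs'
    have e : ∀ s : ℝ, ∑' m : ℤ, GG C (m + s) = GG C s + ∑' n : ℕ, (GG C (((n:ℝ) + 1) + s) + GG C (-((n:ℝ) + 1) + s)) ∧ Summable (fun n : ℕ => GG C (((n:ℝ) + 1) + s) + GG C (-((n:ℝ) + 1) + s)) := by
      intro s
      have a1 : Summable (fun n : ℕ => GG C ((((n:ℤ) + 1 : ℤ):ℝ) + s)) := (hsum s).comp_injective inj1
      have a2 : Summable (fun n : ℕ => GG C (((-((n:ℤ) + 1) : ℤ):ℝ) + s)) := (hsum s).comp_injective inj2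
      have h1 := tsum_of_add_one_of_neg_add_one (f := fun m : ℤ => GG C (m + s)) a1 a2
      have h2 := a1.tsum_add a2
      have a3 := a1.add a2
      push_cast at h1 h2 a3
      rw [zero_add] at h1
      exact ⟨by linarith, a3⟩
    rw [(e s).1, (e s').1]
    have z : HasSum (fun n : ℕ => 0.6 * (1 / ((n:ℝ) + 1) ^ 2) * (GG C s - GG C s')) (0.6 * (Real.pi ^ 2 / 6) * (GG C s - GG C s')) := by
      have := (hasSum_nat_add_iff' 1).mpr hasSum_zeta_two
      simp at this
      refine ((this.mul_left 0.6).mul_right _).congr_fun fun n => ?_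
      simp
    have := (((e s').2.sub (e s).2)).tsum_le_tsum (fun n => theta_B2 C hC n hs h hs') z.summable
    rw [z.tsum_eq, (e s').2.tsum_sub (e s).2] at this
    have hd : 0 ≤ GG C s - GG C s' := sub_nonneg.mpr (GG_anti C (by linarith) hs h)
    have hpi : 0.6 * (Real.pi ^ 2 / 6) ≤ 1 := by
      nlinarith [Real.pi_lt_d2, Real.pi_pos]
    nlinarith
  rcases le_total s' (1/4) with h1 | h1
  · exact B s s' hs h h1
  · rcases le_total s (1/4) with h2 | h2
    · exact (A (1/4) s' le_rfl h1 hs').trans (B s (1/4) hs h2 le_rfl)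
    · exact A s s' h2 h hs'

lemma abs_sin_nat_mul (n : ℕ) (x : ℝ) : |Real.sin (n * x)| ≤ n * |Real.sin x| := by
  induction n with
  | zero => simp
  | succ k ih =>
    push_cast
    rw [add_mul, one_mul, Real.sin_add]
    have h1 := abs_add_le (Real.sin (k * x) * Real.cos x) (Real.cos (k * x) * Real.sin x)
    rw [abs_mul, abs_mul] at h1
    have h2 := Real.abs_cos_le_one x
    have h3 := Real.abs_cos_le_one (k * x)
    have h4 := mul_le_mul_of_nonneg_left h2 (abs_nonneg (Real.sin (k * x)))
    have h5 := mul_le_mul_of_nonneg_right h3 (abs_nonneg (Real.sin x))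
    linarith

lemma cos_nat_diff (n : ℕ) {a b : ℝ} (ha : 0 ≤ a) (hab : a ≤ b) (hb : b ≤ Real.pi) :
    |Real.cos (n * a) - Real.cos (n * b)| ≤ n ^ 2 * (Real.cos a - Real.cos b) := by
  have h1 := Real.cos_sub_cos (n * a) (n * b)
  have h2 := Real.cos_sub_cos a b
  have h3 := abs_sin_nat_mul n ((a + b) / 2)
  have h4 := abs_sin_nat_mul n ((a - b) / 2)
  have h5 : 0 ≤ Real.cos a - Real.cos b := sub_nonneg.mpr (Real.cos_le_cos_of_nonneg_of_le_pi ha hb hab)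
  rw [← abs_of_nonneg h5, h1, h2, show (n * a + n * b) / 2 = n * ((a + b) / 2) by ring,
    show (n * a - n * b) / 2 = n * ((a - b) / 2) by ring]
  simp only [abs_mul]
  have := mul_le_mul h3 h4 (abs_nonneg _) (by positivity)
  norm_num
  nlinarith

lemma theta_poisson (C : ℝ) (hC : 0 < C) (s : ℝ) : ∃ K, 0 < K ∧ ∀ s : ℝ,
    ∑' m : ℤ, GG C (m + s) = K * ∑' n : ℤ, Real.exp (-(Real.pi ^ 2 / C) * (n:ℝ) ^ 2) * Real.cos (2 * Real.pi * s * n) := by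
  have hpi := Real.pi_pos
  set a : ℝ := Real.pi / C with ha
  have ha0 : 0 < a := by positivity
  refine ⟨a ^ (1/2 : ℝ), by positivity, fun s => ?_⟩
  have h := Complex.tsum_exp_neg_quadratic (a := (a:ℂ)) (by simpa using ha0) (-(Complex.I * s))
  have e1 : ∀ n : ℤ, Complex.exp (-(Real.pi:ℂ) / a * (n + Complex.I * (-(Complex.I * s))) ^ 2) = ((GG C (n + s) : ℝ) : ℂ) := by
    intro n
    unfold GG
    rw [Complex.ofReal_exp]
    congr 1
    have : Complex.I * (-(Complex.I * (s:ℂ))) = s := by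
      rw [mul_neg, ← mul_assoc, Complex.I_mul_I]; ring
    rw [this, ha]
    push_cast
    have : (C:ℂ) ≠ 0 := by exact_mod_cast hC.ne'
    have : (Real.pi:ℂ) ≠ 0 := by exact_mod_cast hpi.ne'
    field_simp
  simp only [e1] at h
  rw [← Complex.ofReal_tsum] at h
  have h2 : ((a:ℂ)) ^ (1/2 : ℂ) = ((a ^ (1/2:ℝ) : ℝ) : ℂ) := by
    rw [Complex.ofReal_cpow ha0.le]; norm_num
  rw [h2] at h
  have h3 : ((∑' m : ℤ, GG C (m + s) : ℝ) : ℂ) = ((a ^ (1/2:ℝ) : ℝ) : ℂ) * ∑' n : ℤ, Complex.exp (-Real.pi * a * n ^ 2 + 2 * Real.pi * (-(Complex.I * s)) * n) := by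
    rw [h, ← mul_assoc]
    have : ((a ^ (1/2:ℝ) : ℝ) : ℂ) ≠ 0 := by
      have : a ^ (1/2:ℝ) ≠ 0 := by positivity
      exact_mod_cast this
    field_simp
  have e3 : ∀ n : ℤ, Complex.exp (-Real.pi * a * n ^ 2 + 2 * Real.pi * (-(Complex.I * s)) * n) =
      ((Real.exp (-(Real.pi ^ 2 / C) * (n:ℝ) ^ 2) : ℝ) : ℂ) * Complex.exp (((-(2 * Real.pi * s * n) : ℝ) : ℂ) * Complex.I) := by
    intro n
    rw [Complex.ofReal_exp, ← Complex.exp_add]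
    congr 1
    rw [ha]; push_cast
    have : (C:ℂ) ≠ 0 := by exact_mod_cast hC.ne'
    field_simp
  have hs : Summable (fun n : ℤ => ((Real.exp (-(Real.pi ^ 2 / C) * (n:ℝ) ^ 2) : ℝ) : ℂ) * Complex.exp (((-(2 * Real.pi * s * n) : ℝ) : ℂ) * Complex.I)) := by
    apply Summable.of_norm
    have := GG_summable (Real.pi ^ 2 / C) (by positivity) 0
    refine this.congr fun n => ?_
    rw [norm_mul, Complex.norm_exp_ofReal_mul_I, Complex.norm_real, Real.norm_eq_abs, Real.abs_exp, GG]
    simp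
  simp only [e3] at h3
  have h4 := congrArg Complex.re h3
  rw [Complex.ofReal_re, Complex.re_ofReal_mul, Complex.re_tsum hs] at h4
  rw [h4]
  congr 2; ext n
  rw [Complex.re_ofReal_mul, Complex.exp_ofReal_mul_I_re, Real.cos_neg]

lemma sq_geom (j : ℕ) : ((j:ℝ) + 2) ^ 2 ≤ 4 * (9/4) ^ j := by
  induction j with
  | zero => norm_num
  | succ k ih =>
    push_cast
    rw [pow_succ (9/4 : ℝ)]
    have : (0:ℝ) ≤ k := by positivity
    nlinarith

lemma q_bd (C : ℝ) (hC : 0 < C) (h : C ≤ 14) : Real.exp (-(Real.pi ^ 2 / C)) ^ 3 ≤ 1 / 7 := by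
  rw [← Real.exp_nat_mul]
  have h1 : 2.1 ≤ 3 * (Real.pi ^ 2 / C) := by
    have : 0.7 ≤ Real.pi ^ 2 / C := by
      rw [le_div_iff₀ hC]; nlinarith [Real.pi_gt_d2]
    linarith
  have h2 : Real.exp (((3:ℕ):ℝ) * -(Real.pi ^ 2 / C)) ≤ Real.exp (-2.1) := by
    apply Real.exp_le_exp.mpr; push_cast; linarith
  refine h2.trans ?_
  rw [Real.exp_neg, ← one_div]
  apply one_div_le_one_div_of_le (by norm_num)
  have h3 : Real.exp 2.1 = Real.exp 1 * Real.exp 1 * Real.exp 0.1 := by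
    rw [← Real.exp_add, ← Real.exp_add]; norm_num
  have h4 := Real.exp_one_gt_d9
  have h5 := Real.add_one_le_exp (0.1:ℝ)
  rw [h3]
  have : 7.38 ≤ Real.exp 1 * Real.exp 1 := by nlinarith
  nlinarith

lemma theta_small (C : ℝ) (hC : 0 < C) (hC14 : C ≤ 14) {s s' : ℝ} (hs : 0 ≤ s) (h : s ≤ s') (hs' : s' ≤ 1 / 2) :
    ∑' m : ℤ, GG C (m + s') ≤ ∑' m : ℤ, GG C (m + s) := by
  obtain ⟨K, hK, hP⟩ := theta_poisson C hC 0
  rw [hP, hP]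
  apply mul_le_mul_of_nonneg_left _ hK.le
  have hpi := Real.pi_pos
  set q := Real.exp (-(Real.pi ^ 2 / C)) with hq
  have hq0 : 0 < q := Real.exp_pos _
  have hq1 : q ≤ 1 := Real.exp_le_one_iff.mpr (by have : 0 ≤ Real.pi ^ 2 / C := by positivity
                                                  linarith)
  have hq3 := q_bd C hC hC14
  rw [← hq] at hq3
  set φ : ℤ → ℝ := fun n => Real.exp (-(Real.pi ^ 2 / C) * (n:ℝ) ^ 2) * (Real.cos (2 * Real.pi * s * n) - Real.cos (2 * Real.pi * s' * n)) with hφ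
  have hsc : ∀ s : ℝ, Summable (fun n : ℤ => Real.exp (-(Real.pi ^ 2 / C) * (n:ℝ) ^ 2) * Real.cos (2 * Real.pi * s * n)) := by
    intro s
    have := GG_summable (Real.pi ^ 2 / C) (by positivity) 0
    refine Summable.of_norm_bounded this fun n => ?_
    rw [norm_mul, Real.norm_eq_abs, Real.norm_eq_abs, Real.abs_exp, GG]
    have := Real.abs_cos_le_one (2 * Real.pi * s * n)
    simp only [add_zero, neg_mul]
    exact mul_le_of_le_one_right (Real.exp_pos _).le this
  have hφs : Summable φ := by
    refine ((hsc s).sub (hsc s')).congr fun n => ?_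
    rw [hφ]; ring
  suffices 0 ≤ ∑' n, φ n by
    have e : ∑' n, φ n = ∑' n : ℤ, Real.exp (-(Real.pi ^ 2 / C) * (n:ℝ) ^ 2) * Real.cos (2 * Real.pi * s * n) - ∑' n : ℤ, Real.exp (-(Real.pi ^ 2 / C) * (n:ℝ) ^ 2) * Real.cos (2 * Real.pi * s' * n) := by
      rw [← (hsc s).tsum_sub (hsc s')]
      congr 1; ext n; rw [hφ]; ring
    linarith
  have hev : ∀ n, φ (-n) = φ n := fun n => by
    simp only [hφ]; push_cast; rw [neg_sq, mul_neg, mul_neg, Real.cos_neg, Real.cos_neg]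
  have a1 : Summable (fun n : ℕ => φ ((n:ℤ) + 1)) := hφs.comp_injective inj1
  have a2 : Summable (fun n : ℕ => φ (-((n:ℤ) + 1))) := hφs.comp_injective inj2
  have hz : φ 0 = 0 := by simp [hφ]
  rw [tsum_of_add_one_of_neg_add_one a1 a2, hz]
  simp only [hev]
  suffices 0 ≤ ∑' n : ℕ, φ ((n:ℤ) + 1) by linarith
  rw [a1.tsum_eq_zero_add]
  set d := Real.cos (2 * Real.pi * s) - Real.cos (2 * Real.pi * s') with hd
  have hd0 : 0 ≤ d := by
    apply sub_nonneg.mpr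
    apply Real.cos_le_cos_of_nonneg_of_le_pi (by positivity) (by nlinarith) (by nlinarith)
  have e0 : φ (((0:ℕ):ℤ) + 1) = q * d := by
    simp [hφ, hq, hd]
  rw [e0]
  have a3 : Summable (fun n : ℕ => φ (((n + 1 : ℕ):ℤ) + 1)) := (summable_nat_add_iff 1).mpr a1
  have hg : HasSum (fun j : ℕ => q * d * (4 / 7) * (9 / 28) ^ j) (q * d * (4 / 7) * (1 - 9 / 28)⁻¹) :=
    (hasSum_geometric_of_lt_one (by norm_num) (by norm_num)).mul_left _
  have hb : ∀ j : ℕ, -(q * d * (4 / 7) * (9 / 28) ^ j) ≤ φ (((j + 1 : ℕ):ℤ) + 1) := by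
    intro j
    have h1 := cos_nat_diff (j + 2) (a := 2 * Real.pi * s) (b := 2 * Real.pi * s') (by positivity) (by nlinarith) (by nlinarith)
    rw [← hd] at h1
    have e1 : φ (((j + 1 : ℕ):ℤ) + 1) = q ^ ((j + 2) ^ 2) * (Real.cos (((j + 2 : ℕ):ℝ) * (2 * Real.pi * s)) - Real.cos (((j + 2 : ℕ):ℝ) * (2 * Real.pi * s'))) := by
      simp only [hφ, hq]
      rw [← Real.exp_nat_mul]
      push_cast
      rw [show (j:ℝ) + 1 + 1 = j + 2 by ring]
      congr 2
      · ring
      · congr 1; ring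
      · congr 1; ring
    rw [e1]
    have h2 : q ^ ((j + 2) ^ 2) ≤ q * (1 / 7) * (1 / 7) ^ j := by
      calc q ^ ((j + 2) ^ 2) = q * (q ^ 3) ^ (j + 1) * q ^ (j * (j + 1)) := by
            rw [← pow_mul, ← pow_succ', ← pow_add]; congr 1; ring
        _ ≤ q * (1 / 7) ^ (j + 1) * 1 := by
            gcongr
            exact pow_le_one₀ hq0.le hq1
        _ = _ := by rw [pow_succ]; ring
    have h3 := sq_geom j
    push_cast at h1 ⊢
    have h4 : q ^ ((j + 2) ^ 2) * |Real.cos (((j:ℝ) + 2) * (2 * Real.pi * s)) - Real.cos (((j:ℝ) + 2) * (2 * Real.pi * s'))| ≤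
        (q * (1 / 7) * (1 / 7) ^ j) * ((4 * (9/4) ^ j) * d) :=
      mul_le_mul h2 (h1.trans (by gcongr)) (abs_nonneg _) (by positivity)
    have h5 : (q * (1 / 7) * (1 / 7) ^ j) * ((4 * (9/4) ^ j) * d) = q * d * (4 / 7) * (9 / 28) ^ j := by
      rw [show (9/28 : ℝ) = 1 / 7 * (9 / 4) by norm_num, mul_pow]; ring
    rw [h5] at h4
    have h6 := neg_abs_le (Real.cos (((j:ℝ) + 2) * (2 * Real.pi * s)) - Real.cos (((j:ℝ) + 2) * (2 * Real.pi * s')))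
    have h7 := mul_le_mul_of_nonneg_left h6 (by positivity : 0 ≤ q ^ ((j + 2) ^ 2))
    linarith
  have := hg.neg.summable.tsum_le_tsum hb a3
  rw [hg.neg.tsum_eq] at this
  have : 0 ≤ q * d := by positivity
  norm_num at *
  linarith

lemma theta_mono (C : ℝ) (hC : 0 < C) {s s' : ℝ} (hs : 0 ≤ s) (h : s ≤ s') (hs' : s' ≤ 1 / 2) :
    ∑' m : ℤ, GG C (m + s') ≤ ∑' m : ℤ, GG C (m + s) := by
  rcases le_total C 14 with h1 | h1
  · exact theta_small C hC h1 hs h hs'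
  · exact theta_large C h1 hs h hs'

lemma ff_GG (τ : ℝ) (hτ : 0 < τ) (p : ℝ) (hp : 0 < p) (m : ℤ) (w : ℝ) :
    ff τ (m * p + w) = 8 * Real.sqrt (Real.pi / τ) * GG (2 * p ^ 2 / τ) (m + w / p) := by
  unfold ff GG
  congr 2
  field_simp

lemma ff_summable (τ : ℝ) (hτ : 0 < τ) (p : ℝ) (hp : 0 < p) (w : ℝ) : Summable (fun m : ℤ => ff τ (m * p + w)) := by
  simp only [ff_GG τ hτ p hp]
  exact (GG_summable _ (by positivity) _).mul_left _

lemma ff_theta (τ : ℝ) (hτ : 0 < τ) (p : ℝ) (hp : 0 < p) {w z : ℝ} (hw : 0 ≤ w) (h : w ≤ z) (hz : z ≤ p / 2) :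
    ∑' m : ℤ, ff τ (m * p + z) ≤ ∑' m : ℤ, ff τ (m * p + w) := by
  simp only [ff_GG τ hτ p hp]
  rw [tsum_mul_left, tsum_mul_left]
  apply mul_le_mul_of_nonneg_left _ (by positivity)
  apply theta_mono _ (by positivity) (by positivity) (by gcongr)
  rw [div_le_iff₀ hp]; linarith

lemma comb_sum (U V : ℤ → ℝ) (hU : Summable U) (hV : Summable V) (F : ℝ) (hF : 0 ≤ F)
    (hh : F / 12 ≤ U 0 + V 0 + V (-1))
    (hb : ∀ n : ℕ, -(1 / 20 * (1 / ((n:ℝ) + 1) ^ 2) * F) ≤ U ((n:ℤ) + 1) + U (-((n:ℤ) + 1)) + V ((n:ℤ) + 1) + V (-((n:ℤ) + 1) - 1)) :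
    0 ≤ ∑' m, (U m + V m) := by
  rw [hU.tsum_add hV]
  have u1 : Summable (fun n : ℕ => U ((n:ℤ) + 1)) := hU.comp_injective inj1
  have u2 : Summable (fun n : ℕ => U (-((n:ℤ) + 1))) := hU.comp_injective inj2
  have v1 : Summable (fun n : ℕ => V ((n:ℤ) + 1)) := hV.comp_injective inj1
  have v2 : Summable (fun n : ℕ => V (-((n:ℤ) + 1))) := hV.comp_injective inj2
  have v3 : Summable (fun n : ℕ => V (-(((n + 1 : ℕ):ℤ) + 1))) := (summable_nat_add_iff 1).mpr v2
  rw [tsum_of_add_one_of_neg_add_one u1 u2, tsum_of_add_one_of_neg_add_one v1 v2, v2.tsum_eq_zero_add]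
  have z : HasSum (fun n : ℕ => -(1 / 20 * (1 / ((n:ℝ) + 1) ^ 2) * F)) (-(1 / 20 * (Real.pi ^ 2 / 6) * F)) := by
    have := (hasSum_nat_add_iff' 1).mpr hasSum_zeta_two
    simp at this
    refine ((this.mul_left (1/20)).mul_right _).neg.congr_fun fun n => ?_
    simp
  have s1 := u1.add u2
  have s2 := s1.add v1
  have s3 := s2.add v3
  have := z.summable.tsum_le_tsum (fun n => by
    refine (hb n).trans_eq ?_
    show _ = U ((n:ℤ) + 1) + U (-((n:ℤ) + 1)) + V ((n:ℤ) + 1) + V (-(((n + 1 : ℕ):ℤ) + 1))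
    rw [show (-((n:ℤ) + 1) - 1) = -(((n + 1 : ℕ):ℤ) + 1) by push_cast; ring]) s3
  rw [z.tsum_eq, s2.tsum_add v3, s1.tsum_add v1, u1.tsum_add u2] at this
  have hpi : Real.pi ^ 2 ≤ 10 := by nlinarith [Real.pi_lt_d2, Real.pi_pos]
  have e : V (-(((0:ℕ):ℤ) + 1)) = V (-1) := by norm_num
  rw [e]
  nlinarith

lemma ford (τ : ℝ) (hτ : 0 < τ) (p w z : ℝ) (hp : 0 < p) (hw : 0 ≤ w) (hwz : w ≤ z) (hz : z ≤ p / 2) (n : ℕ) :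
    let f1 := fun m : ℤ => ff τ (m * p + w)
    let f2 := fun m : ℤ => ff τ (m * p + z)
    f2 0 ≤ f1 0 ∧ f2 (-1) ≤ f2 0 ∧ f1 (-((n:ℤ) + 1)) ≤ f2 (-1) ∧ f1 ((n:ℤ) + 1) ≤ f1 (-((n:ℤ) + 1)) ∧
    f2 ((n:ℤ) + 1) ≤ f1 ((n:ℤ) + 1) ∧ f2 (-((n:ℤ) + 1) - 1) ≤ f2 ((n:ℤ) + 1) := by
  have hn : (0:ℝ) ≤ n := by positivity
  have hnp : 0 ≤ (n:ℝ) * p := by positivity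
  refine ⟨?_, ?_, ?_, ?_, ?_, ?_⟩ <;> apply ff_anti τ hτ <;> push_cast
  · rw [abs_of_nonneg (by nlinarith), abs_of_nonneg (by nlinarith)]; nlinarith
  · rw [abs_of_nonneg (by nlinarith), abs_of_nonpos (by nlinarith)]; nlinarith
  · rw [abs_of_nonpos (by nlinarith), abs_of_nonpos (by nlinarith)]; nlinarith
  · rw [abs_of_nonpos (by nlinarith), abs_of_nonneg (by nlinarith)]; nlinarith
  · rw [abs_of_nonneg (by nlinarith), abs_of_nonneg (by nlinarith)]; nlinarith
  · rw [abs_of_nonneg (by nlinarith), abs_of_nonpos (by nlinarith)]; nlinarith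

lemma ca_n (n : ℕ) : ca ((n:ℤ) + 1) = -(1 / (16 * ((n:ℝ) + 1) ^ 2 - 1)) := by
  unfold ca; push_cast
  rw [← one_div_neg_eq_neg_one_div]; congr 1; ring
lemma ca_nn (n : ℕ) : ca (-((n:ℤ) + 1)) = -(1 / (16 * ((n:ℝ) + 1) ^ 2 - 1)) := by
  rw [← ca_n]; unfold ca; push_cast; rw [neg_sq]
lemma cb_n (n : ℕ) : cb ((n:ℤ) + 1) = 1 / ((4 * ((n:ℝ) + 1) + 1) * (4 * ((n:ℝ) + 1) + 3)) := by
  unfold cb; push_cast; rfl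
lemma cb_nn (n : ℕ) : cb (-((n:ℤ) + 1) - 1) = 1 / ((4 * ((n:ℝ) + 1) + 1) * (4 * ((n:ℝ) + 1) + 3)) := by
  unfold cb; push_cast; congr 1; ring
lemma ca_0 : ca 0 = 1 := by simp [ca]
lemma cb_0 : cb 0 = 1 / 3 := by simp [cb]
lemma cb_n1 : cb (-1) = 1 / 3 := by norm_num [cb]

/-- abstract bracket inequality -/
lemma br_ineq (x1 x2 y1 y2 a b c d F dl : ℝ) (hx1 : 0 ≤ x1) (hx2 : 0 ≤ x2) (hy2 : y2 ≤ 0)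
    (ha : c ≤ a) (hb : c ≤ b) (hd : d ≤ c) (hcF : c ≤ F) (hc : 0 ≤ c) (hdl : 0 ≤ dl) (hs : -dl ≤ x1 + x2 + y1 + y2) :
    -(dl * F) ≤ x1 * a + x2 * b + y1 * c + y2 * d := by
  have h1 := mul_le_mul_of_nonneg_left ha hx1
  have h2 := mul_le_mul_of_nonneg_left hb hx2
  have h3 := mul_le_mul_of_nonpos_left hd hy2
  have h4 := mul_le_mul_of_nonneg_right hs hc
  have h5 := mul_le_mul_of_nonneg_left hcF hdl
  nlinarith

lemma coef23 (M : ℝ) (hM : 1 ≤ M) : 0 ≤ 2 * M ^ 2 * (1 / (16 * M ^ 2 - 1)) - 2 * M * (M + 1) * (1 / ((4 * M + 1) * (4 * M + 3))) := by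
  have h1 : 0 < 16 * M ^ 2 - 1 := by nlinarith
  have : 2 * M ^ 2 * (1 / (16 * M ^ 2 - 1)) - 2 * M * (M + 1) * (1 / ((4 * M + 1) * (4 * M + 3))) =
      2 * M * (4 * M + 1) / ((16 * M ^ 2 - 1) * ((4 * M + 1) * (4 * M + 3))) := by
    have h1' := h1.ne'
    obtain ⟨P, hP⟩ : ∃ P, P = 16 * M ^ 2 - 1 := ⟨_, rfl⟩
    rw [← hP] at h1' ⊢
    field_simp
    rw [hP]
    ring
  rw [this]; positivity

lemma coef01 (M : ℝ) (hM : 1 ≤ M) : -(1 / 20 * (1 / M ^ 2)) ≤ 2 * (M ^ 2 - 1 / 4) * (1 / (16 * M ^ 2 - 1)) - (2 * M ^ 2 + 2 * M + 1 / 2) * (1 / ((4 * M + 1) * (4 * M + 3))) := by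
  have h1 : 0 < 16 * M ^ 2 - 1 := by nlinarith
  have : 2 * (M ^ 2 - 1 / 4) * (1 / (16 * M ^ 2 - 1)) - (2 * M ^ 2 + 2 * M + 1 / 2) * (1 / ((4 * M + 1) * (4 * M + 3))) =
      -((2 * M + 1) / ((16 * M ^ 2 - 1) * (4 * M + 3))) := by
    have h1' := h1.ne'
    obtain ⟨P, hP⟩ : ∃ P, P = 16 * M ^ 2 - 1 := ⟨_, rfl⟩
    rw [← hP] at h1' ⊢
    field_simp
    rw [hP]
    ring
  rw [this]
  apply neg_le_neg
  rw [div_le_iff₀ (by positivity)]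
  have : 1 / 20 * (1 / M ^ 2) * ((16 * M ^ 2 - 1) * (4 * M + 3)) = (16 * M ^ 2 - 1) * (4 * M + 3) / (20 * M ^ 2) := by field_simp
  rw [this, le_div_iff₀ (by positivity)]
  nlinarith [mul_nonneg (sub_nonneg.mpr hM) (sq_nonneg M), mul_nonneg (sub_nonneg.mpr hM) (sub_nonneg.mpr hM)]

/-- The four sums: abstract version -/
lemma comb_core (τ : ℝ) (hτ : 0 < τ) (p w z : ℝ) (hp : 0 < p) (hw : 0 ≤ w) (hwz : w ≤ z) (hz : z ≤ p / 2)
    (A B : ℤ → ℝ)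
    (hAs : Summable (fun m : ℤ => ca m * (1 / 4 - A m ^ 2) * ff τ (m * p + w)))
    (hBs : Summable (fun m : ℤ => cb m * (1 / 4 - B m ^ 2) * ff τ (m * p + z)))
    (hcase : (∀ m : ℤ, A m = 0 ∧ B m = 0) ∨ (∀ m : ℤ, A m ^ 2 = m ^ 2 ∧ B m ^ 2 = m ^ 2) ∨
      (∀ m : ℤ, A m ^ 2 = m ^ 2 ∧ B m ^ 2 = (m + 1) ^ 2) ∨ (∀ m : ℤ, A m ^ 2 = (m - 1 / 2) ^ 2 ∧ B m ^ 2 = (m + 1 / 2) ^ 2) ∨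
      (∀ m : ℤ, A m ^ 2 = (m + 1 / 2) ^ 2 ∧ B m ^ 2 = (m + 1 / 2) ^ 2)) :
    0 ≤ ∑' m : ℤ, (ca m * (1 / 4 - A m ^ 2) * ff τ (m * p + w) + cb m * (1 / 4 - B m ^ 2) * ff τ (m * p + z)) := by
  have ho := ford τ hτ p w z hp hw hwz hz
  simp only at ho
  set f1 := fun m : ℤ => ff τ (m * p + w) with hf1
  set f2 := fun m : ℤ => ff τ (m * p + z) with hf2
  have p1 : ∀ m, 0 < f1 m := fun m => ff_pos τ hτ _
  have p2 : ∀ m, 0 < f2 m := fun m => ff_pos τ hτ _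
  have o1 : f2 0 ≤ f1 0 := (ho 0).1
  have o2 : f2 (-1) ≤ f2 0 := (ho 0).2.1
  have o3 : ∀ n : ℕ, f1 (-((n:ℤ) + 1)) ≤ f2 (-1) := fun n => (ho n).2.2.1
  have o4 : ∀ n : ℕ, f1 ((n:ℤ) + 1) ≤ f1 (-((n:ℤ) + 1)) := fun n => (ho n).2.2.2.1
  have o5 : ∀ n : ℕ, f2 ((n:ℤ) + 1) ≤ f1 ((n:ℤ) + 1) := fun n => (ho n).2.2.2.2.1
  have o6 : ∀ n : ℕ, f2 (-((n:ℤ) + 1) - 1) ≤ f2 ((n:ℤ) + 1) := fun n => (ho n).2.2.2.2.2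
  clear ho
  change Summable (fun m : ℤ => ca m * (1 / 4 - A m ^ 2) * f1 m) at hAs
  change Summable (fun m : ℤ => cb m * (1 / 4 - B m ^ 2) * f2 m) at hBs
  change 0 ≤ ∑' m : ℤ, (ca m * (1 / 4 - A m ^ 2) * f1 m + cb m * (1 / 4 - B m ^ 2) * f2 m)
  clear_value f1 f2
  have hMn : ∀ n : ℕ, 1 ≤ (n:ℝ) + 1 := fun n => le_add_of_nonneg_left (by positivity)
  have hca : ∀ n : ℕ, 0 < 1 / (16 * ((n:ℝ) + 1) ^ 2 - 1) := fun n => by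
    have := hMn n
    have : 0 < 16 * ((n:ℝ) + 1) ^ 2 - 1 := by nlinarith
    positivity
  have hcb : ∀ n : ℕ, 0 < 1 / ((4 * ((n:ℝ) + 1) + 1) * (4 * ((n:ℝ) + 1) + 3)) := fun n => by positivity
  rcases hcase with h | h | h | h | h
  · refine comb_sum _ _ hAs hBs (f1 0) (p1 0).le ?_ fun n => ?_
    · rw [(h 0).1, (h 0).2, (h (-1)).2, ca_0, cb_0, cb_n1]
      have := p1 0; have := p2 0; have := p2 (-1)
      linarith
    · rw [(h _).1, (h _).2, (h _).1, (h _).2, ca_n, ca_nn, cb_n, cb_nn]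
      have h1 : 1 / (16 * ((n:ℝ) + 1) ^ 2 - 1) ≤ 1 / 10 * (1 / ((n:ℝ) + 1) ^ 2) := by
        have := hMn n
        rw [show (1 / 10 * (1 / ((n:ℝ) + 1) ^ 2) : ℝ) = 1 / (10 * ((n:ℝ) + 1) ^ 2) by field_simp]
        apply one_div_le_one_div_of_le (by positivity); nlinarith
      have h2 := hca n
      have h3 := mul_pos (hcb n) (p2 ((n:ℤ) + 1)); have h4 := mul_pos (hcb n) (p2 (-((n:ℤ) + 1) - 1))
      have h5 : f1 (-((n:ℤ) + 1)) ≤ f1 0 := by linarith [o3 n]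
      have h6 : f1 ((n:ℤ) + 1) ≤ f1 0 := by linarith [o3 n, o4 n]
      have h7 := mul_le_mul h1 h5 (p1 _).le (by positivity)
      have h8 := mul_le_mul h1 h6 (p1 _).le (by positivity)
      nlinarith
  · refine comb_sum _ _ hAs hBs (f2 (-1)) (p2 _).le ?_ fun n => ?_
    · rw [(h 0).1, (h 0).2, (h (-1)).2, ca_0, cb_0, cb_n1]
      push_cast
      linarith
    · rw [(h _).1, (h _).2, (h _).1, (h _).2, ca_n, ca_nn, cb_n, cb_nn]
      have hM := hMn n
      have c := coef01 _ hM
      have ha := hca n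
      have hb := hcb n
      push_cast
      set M := (n:ℝ) + 1
      set a := 1 / (16 * M ^ 2 - 1)
      set b := 1 / ((4 * M + 1) * (4 * M + 3))
      have q1 : 1 / 4 - M ^ 2 ≤ 0 := by nlinarith
      have q2 : 1 / 4 - (-M - 1) ^ 2 ≤ 0 := by nlinarith
      apply le_of_le_of_eq (br_ineq (-a * (1 / 4 - M ^ 2)) (-a * (1 / 4 - M ^ 2)) (b * (1 / 4 - M ^ 2)) (b * (1 / 4 - (-M - 1) ^ 2)) (f1 ((n:ℤ) + 1)) (f1 (-((n:ℤ) + 1))) (f2 ((n:ℤ) + 1)) (f2 (-((n:ℤ) + 1) - 1)) (f2 (-1)) _ (by nlinarith) (by nlinarith) (by nlinarith) (o5 n) ((o5 n).trans (o4 n)) (o6 n) (by linarith [o3 n, o4 n, o5 n]) (p2 _).le (by positivity) (by linarith))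
      ring
  · refine comb_sum _ _ hAs hBs (f2 (-1)) (p2 _).le ?_ fun n => ?_
    · rw [(h 0).1, (h 0).2, (h (-1)).2, ca_0, cb_0, cb_n1]
      push_cast
      linarith
    · rw [(h _).1, (h _).2, (h _).1, (h _).2, ca_n, ca_nn, cb_n, cb_nn]
      have hM := hMn n
      have c := coef01 _ hM
      have ha := hca n
      have hb := hcb n
      push_cast
      set M := (n:ℝ) + 1
      set a := 1 / (16 * M ^ 2 - 1)
      set b := 1 / ((4 * M + 1) * (4 * M + 3))
      have q1 : 1 / 4 - M ^ 2 ≤ 0 := by nlinarith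
      have q2 : 1 / 4 - (M + 1) ^ 2 ≤ 0 := by nlinarith
      apply le_of_le_of_eq (br_ineq (-a * (1 / 4 - M ^ 2)) (-a * (1 / 4 - M ^ 2)) (b * (1 / 4 - (M + 1) ^ 2)) (b * (1 / 4 - M ^ 2)) (f1 ((n:ℤ) + 1)) (f1 (-((n:ℤ) + 1))) (f2 ((n:ℤ) + 1)) (f2 (-((n:ℤ) + 1) - 1)) (f2 (-1)) _ (by nlinarith) (by nlinarith) (by nlinarith) (o5 n) ((o5 n).trans (o4 n)) (o6 n) (by linarith [o3 n, o4 n, o5 n]) (p2 _).le (by positivity) (by linarith))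
      ring
  · refine comb_sum _ _ hAs hBs 0 le_rfl ?_ fun n => ?_
    · rw [(h 0).1, (h 0).2, (h (-1)).2, ca_0, cb_0, cb_n1]
      push_cast
      norm_num
    · rw [(h _).1, (h _).2, (h _).1, (h _).2, ca_n, ca_nn, cb_n, cb_nn]
      have hM := hMn n
      have c := coef23 _ hM
      have ha := hca n
      have hb := hcb n
      push_cast
      set M := (n:ℝ) + 1
      set a := 1 / (16 * M ^ 2 - 1)
      set b := 1 / ((4 * M + 1) * (4 * M + 3))
      have q1 : 0 ≤ a * (M * (M - 1)) := mul_nonneg ha.le (by nlinarith)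
      have q2 : 0 ≤ a * (M * (M + 1)) := by positivity
      have q3 : 0 ≤ b * (M * (M + 1)) := by positivity
      have hbr := (br_ineq (a * (M * (M - 1))) (a * (M * (M + 1))) (-(b * (M * (M + 1)))) (-(b * (M * (M + 1)))) (f1 ((n:ℤ) + 1)) (f1 (-((n:ℤ) + 1))) (f2 ((n:ℤ) + 1)) (f2 (-((n:ℤ) + 1) - 1)) (f2 ((n:ℤ) + 1)) 0 q1 q2 (by linarith) (o5 n) ((o5 n).trans (o4 n)) (o6 n) le_rfl (p2 _).le le_rfl (by linarith))
      rw [zero_mul, neg_zero] at hbr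
      rw [mul_zero, neg_zero]
      refine hbr.trans_eq ?_
      ring
  · refine comb_sum _ _ hAs hBs 0 le_rfl ?_ fun n => ?_
    · rw [(h 0).1, (h 0).2, (h (-1)).2, ca_0, cb_0, cb_n1]
      push_cast
      norm_num
    · rw [(h _).1, (h _).2, (h _).1, (h _).2, ca_n, ca_nn, cb_n, cb_nn]
      have hM := hMn n
      have c := coef23 _ hM
      have ha := hca n
      have hb := hcb n
      push_cast
      set M := (n:ℝ) + 1
      set a := 1 / (16 * M ^ 2 - 1)
      set b := 1 / ((4 * M + 1) * (4 * M + 3))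
      have q1 : 0 ≤ a * (M * (M - 1)) := mul_nonneg ha.le (by nlinarith)
      have q2 : 0 ≤ a * (M * (M + 1)) := by positivity
      have q3 : 0 ≤ b * (M * (M + 1)) := by positivity
      have hbr := (br_ineq (a * (M * (M + 1))) (a * (M * (M - 1))) (-(b * (M * (M + 1)))) (-(b * (M * (M + 1)))) (f1 ((n:ℤ) + 1)) (f1 (-((n:ℤ) + 1))) (f2 ((n:ℤ) + 1)) (f2 (-((n:ℤ) + 1) - 1)) (f2 ((n:ℤ) + 1)) 0 q2 q1 (by linarith) (o5 n) ((o5 n).trans (o4 n)) (o6 n) le_rfl (p2 _).le le_rfl (by linarith))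
      rw [zero_mul, neg_zero] at hbr
      rw [mul_zero, neg_zero]
      refine hbr.trans_eq ?_
      ring

/-- Quadratic form of the Hessian. -/
def DJ (τ : ℝ) (y : Fin 4 → ℝ) (J : Finset (Fin 4)) : ℝ := ∑ i ∈ J, ∑ j ∈ J, He τ i j y

lemma sq_expand (J : Finset (Fin 4)) (c d : ℝ) (v : Fin 4 → ℝ) :
    ∑ i ∈ J, ∑ j ∈ J, c * v i * v j * d = c * (∑ i ∈ J, v i) ^ 2 * d := by
  rw [sq, Finset.sum_mul_sum, Finset.mul_sum, Finset.sum_mul]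
  refine Finset.sum_congr rfl fun i _ => ?_
  rw [Finset.mul_sum, Finset.sum_mul]
  refine Finset.sum_congr rfl fun j _ => ?_
  ring

lemma DJ_summable (τ : ℝ) (hτ : 0 < τ) (J : Finset (Fin 4)) (y : Fin 4 → ℝ) (hp : 0 < pp y) :
    Summable (fun m : ℤ => ca m * (∑ i ∈ J, la m i) ^ 2 * ff τ (La m y)) ∧
    Summable (fun m : ℤ => cb m * (∑ i ∈ J, lb m i) ^ 2 * ff τ (Lb m y)) := by
  constructor
  · have : Summable (fun m : ℤ => ∑ i ∈ J, ∑ j ∈ J, ca m * la m i * la m j * ff τ (La m y)) :=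
      summable_sum fun i _ => summable_sum fun j _ => (He_summable τ hτ i j y hp).1
    exact this.congr fun m => (sq_expand J _ _ _)
  · have : Summable (fun m : ℤ => ∑ i ∈ J, ∑ j ∈ J, cb m * lb m i * lb m j * ff τ (Lb m y)) :=
      summable_sum fun i _ => summable_sum fun j _ => (He_summable τ hτ i j y hp).2
    exact this.congr fun m => (sq_expand J _ _ _)

lemma DJ_eq (τ : ℝ) (hτ : 0 < τ) (J : Finset (Fin 4)) (y : Fin 4 → ℝ) (hp : 0 < pp y) :
    DJ τ y J = ∑' m : ℤ, (ca m * (∑ i ∈ J, la m i) ^ 2 * ff τ (La m y) + cb m * (∑ i ∈ J, lb m i) ^ 2 * ff τ (Lb m y)) := by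
  have h : HasSum (fun m : ℤ => ∑ i ∈ J, ∑ j ∈ J, (ca m * la m i * la m j * ff τ (La m y) + cb m * lb m i * lb m j * ff τ (Lb m y))) (DJ τ y J) := by
    unfold DJ
    refine hasSum_sum fun i _ => hasSum_sum fun j _ => ?_
    unfold He
    rw [if_neg hp.ne']
    exact ((He_summable τ hτ i j y hp).1.add (He_summable τ hτ i j y hp).2).hasSum
  rw [← h.tsum_eq]
  refine tsum_congr fun m => ?_
  simp only [Finset.sum_add_distrib]
  rw [sq_expand, sq_expand]

lemma sum_mem4 (J : Finset (Fin 4)) (v : Fin 4 → ℝ) :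
    ∑ i ∈ J, v i = (if 0 ∈ J then v 0 else 0) + (if 1 ∈ J then v 1 else 0) + (if 2 ∈ J then v 2 else 0) + (if 3 ∈ J then v 3 else 0) := by
  rw [← Fin.sum_univ_four (fun i => if i ∈ J then v i else 0)]
  simp

lemma la0 (m : ℤ) : la m 0 = -m := rfl
lemma la1 (m : ℤ) : la m 1 = -m := rfl
lemma la2 (m : ℤ) : la m 2 = m - 1 / 2 := rfl
lemma la3 (m : ℤ) : la m 3 = m + 1 / 2 := rfl
lemma lb0 (m : ℤ) : lb m 0 = -m := rfl
lemma lb1 (m : ℤ) : lb m 1 = -m - 1 := rfl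
lemma lb2 (m : ℤ) : lb m 2 = m + 1 / 2 := rfl
lemma lb3 (m : ℤ) : lb m 3 = m + 1 / 2 := rfl

/-- Value at the comb set. -/
def SS (τ : ℝ) (y : Fin 4 → ℝ) : ℝ := ∑' m : ℤ, (ca m * ff τ (La m y) + cb m * ff τ (Lb m y))

lemma wz (y : Fin 4 → ℝ) (hy : Srt y) : 0 ≤ (y 3 - y 2) / 2 ∧ (y 3 - y 2) / 2 ≤ (y 3 + y 2 - 2 * y 1) / 2 ∧ (y 3 + y 2 - 2 * y 1) / 2 ≤ pp y / 2 := by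
  obtain ⟨h0, h1, h2⟩ := hy
  unfold pp
  refine ⟨by linarith, by linarith, by linarith⟩

lemma DJ_comb (τ : ℝ) (hτ : 0 < τ) (y : Fin 4 → ℝ) (hy : Srt y) : DJ τ y {1, 3} = 1 / 4 * SS τ y := by
  rcases hy.cases with hp | ⟨hp, he⟩
  · rw [DJ_eq τ hτ _ y hp, SS, ← tsum_mul_left]
    refine tsum_congr fun m => ?_
    rw [Finset.sum_pair (by decide), Finset.sum_pair (by decide), la1, la3, lb1, lb3]
    ring
  · have hLa : ∀ m, La m y = 0 := fun m => by rw [La_eq, hp, he 3, he 2]; ring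
    have hLb : ∀ m, Lb m y = 0 := fun m => by rw [Lb_eq, hp, he 3, he 2, he 1]; ring
    have : SS τ y = (Real.pi / 4 + Real.pi / 4) * ff τ 0 := by
      unfold SS
      simp only [hLa, hLb, ← add_mul]
      exact ((ca_sum.add cb_sum).mul_right _).tsum_eq
    rw [this, DJ, Finset.sum_pair (by decide), Finset.sum_pair (by decide), Finset.sum_pair (by decide)]
    unfold He
    simp only [hp, if_true, show ((1:Fin 4) = 3) = False by simp, show ((3:Fin 4) = 1) = False by simp, if_false]
    ring

lemma DJ_le (τ : ℝ) (hτ : 0 < τ) (y : Fin 4 → ℝ) (hy : Srt y) (J : Finset (Fin 4)) : DJ τ y J ≤ DJ τ y {1, 3} := by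
  rcases hy.cases with hp | ⟨hp, he⟩
  · obtain ⟨hw, hwz, hz⟩ := wz y hy
    have s := DJ_summable τ hτ J y hp
    have s' := DJ_summable τ hτ {1, 3} y hp
    have hc1 : ∀ m, (∑ i ∈ ({1, 3} : Finset (Fin 4)), la m i) ^ 2 = 1 / 4 := fun m => by
      rw [Finset.sum_pair (by decide), la1, la3]; ring
    have hc2 : ∀ m, (∑ i ∈ ({1, 3} : Finset (Fin 4)), lb m i) ^ 2 = 1 / 4 := fun m => by
      rw [Finset.sum_pair (by decide), lb1, lb3]; ring
    have hAs : Summable (fun m : ℤ => ca m * (1 / 4 - (∑ i ∈ J, la m i) ^ 2) * ff τ (m * pp y + (y 3 - y 2) / 2)) := by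
      refine (s'.1.sub s.1).congr fun m => ?_
      rw [hc1, La_eq]; ring
    have hBs : Summable (fun m : ℤ => cb m * (1 / 4 - (∑ i ∈ J, lb m i) ^ 2) * ff τ (m * pp y + (y 3 + y 2 - 2 * y 1) / 2)) := by
      refine (s'.2.sub s.2).congr fun m => ?_
      rw [hc2, Lb_eq]; ring
    have key : DJ τ y {1, 3} - DJ τ y J = ∑' m : ℤ, (ca m * (1 / 4 - (∑ i ∈ J, la m i) ^ 2) * ff τ (m * pp y + (y 3 - y 2) / 2) + cb m * (1 / 4 - (∑ i ∈ J, lb m i) ^ 2) * ff τ (m * pp y + (y 3 + y 2 - 2 * y 1) / 2)) := by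
      rw [DJ_eq τ hτ _ y hp, DJ_eq τ hτ _ y hp, ← (s'.1.add s'.2).tsum_sub (s.1.add s.2)]
      refine tsum_congr fun m => ?_
      rw [hc1, hc2, La_eq, Lb_eq]; ring
    rw [← sub_nonneg, key]
    have core := comb_core τ hτ (pp y) _ _ hp hw hwz hz _ _ hAs hBs
    have eqc : (∀ m, (∑ i ∈ J, la m i) ^ 2 = 1 / 4 ∧ (∑ i ∈ J, lb m i) ^ 2 = 1 / 4) → 0 ≤ ∑' m : ℤ, (ca m * (1 / 4 - (∑ i ∈ J, la m i) ^ 2) * ff τ (m * pp y + (y 3 - y 2) / 2) + cb m * (1 / 4 - (∑ i ∈ J, lb m i) ^ 2) * ff τ (m * pp y + (y 3 + y 2 - 2 * y 1) / 2)) := by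
      intro h
      simp [h]
    have thc : (∀ m : ℤ, (∑ i ∈ J, la m i) ^ 2 = 4 * (m:ℝ) ^ 2 ∧ (∑ i ∈ J, lb m i) ^ 2 = (2 * (m:ℝ) + 1) ^ 2) → 0 ≤ ∑' m : ℤ, (ca m * (1 / 4 - (∑ i ∈ J, la m i) ^ 2) * ff τ (m * pp y + (y 3 - y 2) / 2) + cb m * (1 / 4 - (∑ i ∈ J, lb m i) ^ 2) * ff τ (m * pp y + (y 3 + y 2 - 2 * y 1) / 2)) := by
      intro h
      have e : ∀ m : ℤ, (ca m * (1 / 4 - (∑ i ∈ J, la m i) ^ 2) * ff τ (m * pp y + (y 3 - y 2) / 2) + cb m * (1 / 4 - (∑ i ∈ J, lb m i) ^ 2) * ff τ (m * pp y + (y 3 + y 2 - 2 * y 1) / 2)) = 1 / 4 * (ff τ (m * pp y + (y 3 - y 2) / 2) - ff τ (m * pp y + (y 3 + y 2 - 2 * y 1) / 2)) := by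
        intro m
        rw [(h m).1, (h m).2]
        have h1 : (1 - 16 * (m:ℝ) ^ 2) ≠ 0 := by
          have h1 := ne41 m
          have h2 := ne14 m
          intro h; exact (mul_ne_zero h1 h2) (by linear_combination h)
        have e1 : ca m * (1 / 4 - 4 * (m:ℝ) ^ 2) = 1 / 4 := by
          unfold ca
          rw [div_mul_eq_mul_div, div_eq_iff h1]; ring
        have e2 : cb m * (1 / 4 - (2 * (m:ℝ) + 1) ^ 2) = -(1 / 4) := by
          unfold cb
          rw [div_mul_eq_mul_div, div_eq_iff (mul_ne_zero (ne41 m) (ne43 m))]; ring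
        rw [e1, e2]; ring
      simp only [e]
      rw [tsum_mul_left, (ff_summable τ hτ _ hp _).tsum_sub (ff_summable τ hτ _ hp _)]
      have := ff_theta τ hτ _ hp hw hwz hz
      linarith
    clear key s s' hAs hBs
    by_cases h0 : 0 ∈ J <;> by_cases h1 : 1 ∈ J <;> by_cases h2 : 2 ∈ J <;> by_cases h3 : 3 ∈ J <;>
    simp only [sum_mem4 J, h0, h1, h2, h3, if_true, if_false, la0, la1, la2, la3, lb0, lb1, lb2, lb3] at core eqc thc ⊢ <;>
    first
    | (refine eqc fun m => ⟨?_, ?_⟩ <;> ring1)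
    | (refine thc fun m => ⟨?_, ?_⟩ <;> ring1)
    | (refine core (Or.inl fun m => ⟨?_, ?_⟩) <;> ring1)
    | (refine core (Or.inr (Or.inl fun m => ⟨?_, ?_⟩)) <;> ring1)
    | (refine core (Or.inr (Or.inr (Or.inl fun m => ⟨?_, ?_⟩))) <;> ring1)
    | (refine core (Or.inr (Or.inr (Or.inr (Or.inl fun m => ⟨?_, ?_⟩)))) <;> ring1)
    | (refine core (Or.inr (Or.inr (Or.inr (Or.inr fun m => ⟨?_, ?_⟩)))) <;> ring1)
  · have hf := ff_pos τ hτ 0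
    have e : ∀ J, DJ τ y J = Real.pi / 32 * ff τ 0 * (4 * (#J : ℝ) - (#J : ℝ) ^ 2) := by
      intro J
      unfold DJ He
      simp only [hp, if_true]
      rw [show (4 * (#J : ℝ) - (#J : ℝ) ^ 2) = ∑ i ∈ J, ∑ j ∈ J, (if i = j then (3:ℝ) else -1) from ?_]
      · simp only [Finset.mul_sum]
      · have : ∀ i j : Fin 4, (if i = j then (3:ℝ) else -1) = (if i = j then 4 else 0) - 1 := by
          intro i j; split_ifs <;> norm_num
        simp only [this, Finset.sum_sub_distrib, Finset.sum_ite_eq, Finset.sum_const, nsmul_eq_mul]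
        rw [Finset.sum_congr rfl (fun i hi => if_pos hi)]
        simp only [Finset.sum_const, nsmul_eq_mul]
        ring
    rw [e, e]
    have : #({1, 3} : Finset (Fin 4)) = 2 := by decide
    rw [this]
    apply mul_le_mul_of_nonneg_left _ (by positivity)
    push_cast
    nlinarith [sq_nonneg ((#J : ℝ) - 2)]

lemma u_time (T t : ℝ) (h : t < T) (x : Fin 4 → ℝ) :
    HasDerivAt (fun s => u T s x) (-(1 / (16 * Real.sqrt 2 * Real.pi)) * SS (T - t) (sortv x)) t := by
  have hτ : 0 < T - t := by linarith
  have hs := (Lam_int_series (T - t) hτ (sortv x)).tsum_eq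
  change SS (T - t) (sortv x) = _ at hs
  have hd : HasDerivAt (fun s : ℝ => T - s) (-1) t := by simpa using (hasDerivAt_id t).const_sub T
  have h1 := (Lam_time (T - t) hτ (sortv x)).comp t hd
  have hq : HasDerivAt (fun s : ℝ => (T - s) * Real.pi / 2) (-1 * Real.pi / 2) t := (hd.mul_const Real.pi).div_const 2
  have hpos : 0 < (T - t) * Real.pi / 2 := by positivity
  have h2 := hq.sqrt hpos.ne'
  have h3 := ((h1.const_mul (-(1 / (16 * Real.sqrt 2)))).add_const ((1 / 4) * ∑ i, x i)).add (h2.const_mul (1 / 2))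
  have e : -(1 / (16 * Real.sqrt 2 * Real.pi)) * SS (T - t) (sortv x) = -(1 / (16 * Real.sqrt 2)) * (-(∫ r : ℝ, Real.exp (-(T - t) * r ^ 2) * Lam r (sortv x)) * -1) + 1 / 2 * (-1 * Real.pi / 2 / (2 * Real.sqrt ((T - t) * Real.pi / 2))) := by
    rw [hs, Real.sqrt_div Real.pi_pos.le, Real.sqrt_div (by positivity), Real.sqrt_mul hτ.le]
    have a1 : 0 < Real.sqrt (T - t) := Real.sqrt_pos.2 hτ
    have a2 : 0 < Real.sqrt Real.pi := Real.sqrt_pos.2 Real.pi_pos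
    have a3 : 0 < Real.sqrt 2 := by positivity
    have b2 : Real.sqrt Real.pi ^ 2 = Real.pi := Real.sq_sqrt Real.pi_pos.le
    have b3 : Real.sqrt 2 ^ 2 = 2 := Real.sq_sqrt (by norm_num)
    generalize (∫ r : ℝ, Real.exp (-(T - t) * r ^ 2) * Lam r (sortv x)) = I
    have hpi := Real.pi_pos
    generalize Real.sqrt (T - t) = a at *
    generalize Real.sqrt Real.pi = b at *
    generalize Real.sqrt 2 = c at *
    rw [← b2]
    field_simp
    rw [b3]
    ring
  rw [e]
  exact h3

/-- Gradient of the symmetrised function. -/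
def DD (τ : ℝ) (x : Fin 4 → ℝ) (i : Fin 4) : ℝ := Gr τ ((Tuple.sort x).symm i) (sortv x)
/-- Hessian of the symmetrised function. -/
def HH (τ : ℝ) (x : Fin 4 → ℝ) (i j : Fin 4) : ℝ := He τ ((Tuple.sort x).symm i) ((Tuple.sort x).symm j) (sortv x)

lemma Srt_iff (y : Fin 4 → ℝ) : Srt y ↔ Monotone y := by
  rw [Fin.monotone_iff_le_succ]
  unfold Srt
  constructor
  · rintro ⟨h0, h1, h2⟩ i
    fin_cases i
    · exact h0
    · exact h1
    · exact h2
  · intro h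
    exact ⟨h 0, h 1, h 2⟩

lemma sortv_srt (x : Fin 4 → ℝ) : Srt (sortv x) := (Srt_iff _).2 (Tuple.monotone_sort x)

lemma sortv_of (x : Fin 4 → ℝ) (σ : Equiv.Perm (Fin 4)) (h : Srt (x ∘ σ)) : sortv x = x ∘ σ :=
  (Tuple.comp_sort_eq_comp_iff_monotone.2 ((Srt_iff _).1 h)).symm

lemma sortv_symm (x : Fin 4 → ℝ) (i : Fin 4) : sortv x ((Tuple.sort x).symm i) = x i := by simp [sortv]

lemma DD_of (τ : ℝ) (hτ : 0 < τ) (x : Fin 4 → ℝ) (σ : Equiv.Perm (Fin 4)) (h : Srt (x ∘ σ)) (i : Fin 4) :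
    DD τ x i = Gr τ (σ.symm i) (x ∘ σ) := by
  have e := sortv_of x σ h
  unfold DD
  rw [← e]
  apply Gr_tie τ hτ _ (sortv_srt x)
  rw [sortv_symm, e]; simp

lemma HH_of (τ : ℝ) (hτ : 0 < τ) (x : Fin 4 → ℝ) (σ : Equiv.Perm (Fin 4)) (h : Srt (x ∘ σ)) (i j : Fin 4) :
    HH τ x i j = He τ (σ.symm i) (σ.symm j) (x ∘ σ) := by
  have e := sortv_of x σ h
  unfold HH
  rw [← e]
  apply He_tie τ hτ _ (sortv_srt x)
  · rw [sortv_symm, e]; simp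
  · rw [sortv_symm, e]; simp
  · simp

lemma upd_comp (x : Fin 4 → ℝ) (σ : Equiv.Perm (Fin 4)) (i : Fin 4) (s : ℝ) :
    Function.update x i s ∘ σ = Function.update (x ∘ σ) (σ.symm i) s := by
  funext k
  by_cases h : σ k = i
  · subst h; simp
  · have : k ≠ σ.symm i := by rintro rfl; simp at h
    simp [Function.update_of_ne h, Function.update_of_ne this]

lemma Srt_closed : IsClosed {y : Fin 4 → ℝ | Srt y} := by
  unfold Srt
  exact (isClosed_le (continuous_apply 0) (continuous_apply 1)).inter ((isClosed_le (continuous_apply 1) (continuous_apply 2)).inter (isClosed_le (continuous_apply 2) (continuous_apply 3)))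

lemma glue (f : ℝ → ℝ) (f' : ℝ) (x : Fin 4 → ℝ) (i : Fin 4)
    (h : ∀ σ : Equiv.Perm (Fin 4), Srt (x ∘ σ) → HasDerivWithinAt f f' {s | Srt (Function.update x i s ∘ σ)} (x i)) :
    HasDerivAt f f' (x i) := by
  have h' : ∀ σ : Equiv.Perm (Fin 4), HasDerivWithinAt f f' {s | Srt (Function.update x i s ∘ σ)} (x i) := by
    intro σ
    by_cases hs : Srt (x ∘ σ)
    · exact h σ hs
    · have hc : IsClosed {s : ℝ | Srt (Function.update x i s ∘ σ)} := by
        refine Srt_closed.preimage (f := fun s : ℝ => Function.update x i s ∘ σ) ?_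
        refine continuous_pi fun k => ?_
        exact (continuous_apply (σ k)).comp ((continuous_const (y := x)).update i continuous_id)
      apply HasFDerivWithinAt.of_notMem_closure
      rw [hc.closure_eq]
      simpa using hs
  have hF : ∀ F : Finset (Equiv.Perm (Fin 4)), HasDerivWithinAt f f' (⋃ σ ∈ F, {s | Srt (Function.update x i s ∘ σ)}) (x i) := by
    intro F
    induction F using Finset.induction_on with
    | empty =>
      apply HasFDerivWithinAt.of_notMem_closure
      simp
    | insert σ F _ ih =>
      rw [Finset.set_biUnion_insert]
      exact (h' σ).union ih
  have := hF Finset.univ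
  rw [show (⋃ σ ∈ (Finset.univ : Finset (Equiv.Perm (Fin 4))), {s | Srt (Function.update x i s ∘ σ)}) = Set.univ from ?_] at this
  · exact hasDerivWithinAt_univ.1 this
  · rw [Set.eq_univ_iff_forall]
    intro s
    simp only [Set.mem_iUnion]
    exact ⟨Tuple.sort (Function.update x i s), Finset.mem_univ _, sortv_srt _⟩

lemma F_deriv (τ : ℝ) (hτ : 0 < τ) (x : Fin 4 → ℝ) (i : Fin 4) :
    HasDerivAt (fun s => Fs τ (sortv (Function.update x i s))) (DD τ x i) (x i) := by
  refine glue _ _ x i fun σ hσ => ?_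
  have h := C1 τ hτ (x ∘ σ) hσ (σ.symm i)
  rw [← DD_of τ hτ x σ hσ] at h
  simp only [← upd_comp, Function.comp_apply, Equiv.apply_symm_apply] at h
  refine h.congr_of_mem (fun s hs => ?_) (by simpa using hσ)
  rw [sortv_of _ σ hs]

lemma DD_deriv (τ : ℝ) (hτ : 0 < τ) (x : Fin 4 → ℝ) (i j : Fin 4) :
    HasDerivAt (fun s => DD τ (Function.update x j s) i) (HH τ x i j) (x j) := by
  refine glue _ _ x j fun σ hσ => ?_
  have h := C2 τ hτ (x ∘ σ) hσ (σ.symm i) (σ.symm j)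
  rw [← HH_of τ hτ x σ hσ] at h
  simp only [← upd_comp, Function.comp_apply, Equiv.apply_symm_apply] at h
  refine h.congr_of_mem (fun s hs => ?_) (by simpa using hσ)
  exact DD_of τ hτ _ σ hs i

/-- Constant. -/
def kap : ℝ := 1 / (2 * Real.sqrt 2 * Real.pi)

lemma u_deriv (T t : ℝ) (h : t < T) (x : Fin 4 → ℝ) (i : Fin 4) :
    HasDerivAt (fun s => u T t (Function.update x i s)) (kap * DD (T - t) x i + 1 / 4) (x i) := by
  simp only [u_eq T t h]
  have h1 := (F_deriv (T - t) (by linarith) x i).const_mul kap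
  have h2 : HasDerivAt (fun s => ∑ k, Function.update x i s k) 1 (x i) := by
    have : ∀ s, ∑ k, Function.update x i s k = s + ∑ k ∈ Finset.univ \ {i}, x k := fun s =>
      Finset.sum_update_of_mem (Finset.mem_univ i) x s
    simp only [this]
    exact (hasDerivAt_id _).add_const _
  have h3 := (h1.add (h2.const_mul (1 / 4))).add_const ((1 / 2) * Real.sqrt ((T - t) * Real.pi / 2))
  rw [mul_one] at h3
  exact h3

lemma pd_u (T t : ℝ) (h : t < T) (i : Fin 4) : pd i (u T t) = fun x => kap * DD (T - t) x i + 1 / 4 := by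
  funext x
  exact (u_deriv T t h x i).deriv

lemma pd_deriv (T t : ℝ) (h : t < T) (x : Fin 4 → ℝ) (i j : Fin 4) :
    HasDerivAt (fun s => pd i (u T t) (Function.update x j s)) (kap * HH (T - t) x i j) (x j) := by
  rw [pd_u T t h]
  exact ((DD_deriv (T - t) (by linarith) x i j).const_mul kap).add_const _

lemma HH_sum (τ : ℝ) (x : Fin 4 → ℝ) (J : Finset (Fin 4)) :
    ∑ i ∈ J, ∑ j ∈ J, HH τ x i j = DJ τ (sortv x) (J.map (Tuple.sort x).symm.toEmbedding) := by
  unfold DJ HH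
  simp [Finset.sum_map]

lemma pd_pd (T t : ℝ) (h : t < T) (x : Fin 4 → ℝ) (J : Finset (Fin 4)) :
    ∑ i ∈ J, ∑ j ∈ J, pd j (pd i (u T t)) x = kap * DJ (T - t) (sortv x) (J.map (Tuple.sort x).symm.toEmbedding) := by
  rw [← HH_sum, Finset.mul_sum]
  refine Finset.sum_congr rfl fun i _ => ?_
  rw [Finset.mul_sum]
  refine Finset.sum_congr rfl fun j _ => ?_
  exact (pd_deriv T t h x i j).deriv

lemma kap_pos : 0 < kap := by unfold kap; positivity

lemma sup_eq (T t : ℝ) (h : t < T) (x : Fin 4 → ℝ) :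
    Finset.univ.sup' Finset.univ_nonempty
      (fun J : Finset (Fin 4) => ∑ i ∈ J, ∑ j ∈ J, pd j (pd i (u T t)) x) = kap * DJ (T - t) (sortv x) {1, 3} := by
  apply le_antisymm
  · refine Finset.sup'_le _ _ fun J _ => ?_
    rw [pd_pd T t h]
    exact mul_le_mul_of_nonneg_left (DJ_le _ (by linarith) _ (sortv_srt x) _) kap_pos.le
  · have := Finset.le_sup' (fun J : Finset (Fin 4) => ∑ i ∈ J, ∑ j ∈ J, pd j (pd i (u T t)) x)
      (Finset.mem_univ (({1, 3} : Finset (Fin 4)).map (Tuple.sort x).toEmbedding))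
    refine le_trans (le_of_eq ?_) this
    simp only [pd_pd T t h]
    rw [Finset.map_map]
    congr 2
    ext k
    simp

/-- u^T solves the nonlinear PDE of the 4-expert problem, the maximum
over subsets being attained at the comb set {2,4} when x is sorted. -/
theorem u_nonlinear_pde (T t : ℝ) (ht : 0 ≤ t) (htT : t < T) (x : Fin 4 → ℝ) :
    (∀ i, DifferentiableAt ℝ (fun s => u T t (Function.update x i s)) (x i)) ∧
    (∀ i j, DifferentiableAt ℝ (fun s => pd i (u T t) (Function.update x j s)) (x j)) ∧
    DifferentiableAt ℝ (fun s => u T s x) t ∧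
    deriv (fun s => u T s x) t + (1 / 2) *
        (Finset.univ.sup' Finset.univ_nonempty
          (fun J : Finset (Fin 4) => ∑ i ∈ J, ∑ j ∈ J, pd j (pd i (u T t)) x)) = 0 ∧
    ((x 0 ≤ x 1 ∧ x 1 ≤ x 2 ∧ x 2 ≤ x 3) →
      (∑ i ∈ ({1, 3} : Finset (Fin 4)), ∑ j ∈ ({1, 3} : Finset (Fin 4)),
          pd j (pd i (u T t)) x)
        = Finset.univ.sup' Finset.univ_nonempty
            (fun J : Finset (Fin 4) => ∑ i ∈ J, ∑ j ∈ J, pd j (pd i (u T t)) x)) := by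
  refine ⟨fun i => (u_deriv T t htT x i).differentiableAt, fun i j => (pd_deriv T t htT x i j).differentiableAt,
    (u_time T t htT x).differentiableAt, ?_, fun hx => ?_⟩
  · rw [(u_time T t htT x).deriv, sup_eq T t htT, DJ_comb _ (by linarith) _ (sortv_srt x), kap]
    have := Real.pi_pos
    field_simp
    ring
  · rw [sup_eq T t htT, pd_pd T t htT]
    have e : Tuple.sort x = Equiv.refl _ := Tuple.sort_eq_refl_iff_monotone.2 ((Srt_iff x).1 hx)
    rw [e]
    congr 2

end
end

section
/- For every c > 0 and every η ∈ [1,3], (8/π) ĝ(c(η−1)) ≥ 2 Σ_{l=1}^∞ ( 2/((4l−1)π) − 2/((4l+1)π) ) ( ĝ(c(4l−1+η)) + ĝ(c(4l+1−η)) ). -/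
noncomputable section

/-- ĝ(v) = √π e^{−π² v²}, the Fourier transform of the Gaussian e^{−x²}. -/
def gFT (v : ℝ) : ℝ := Real.sqrt Real.pi * Real.exp (-Real.pi ^ 2 * v ^ 2)

/-- Monotonicity of the Gaussian. -/
theorem gFT_anti (c a b : ℝ) (hc : 0 < c) (ha : 0 ≤ a) (h : a ≤ b) :
    gFT (c * b) ≤ gFT (c * a) := by
  unfold gFT
  have h1 : (c * a) ^ 2 ≤ (c * b) ^ 2 := by
    have := mul_le_mul_of_nonneg_left h hc.le
    have := mul_nonneg hc.le ha
    gcongr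
  have h2 : -Real.pi ^ 2 * (c * b) ^ 2 ≤ -Real.pi ^ 2 * (c * a) ^ 2 := by
    nlinarith [mul_le_mul_of_nonneg_left h1 (sq_nonneg Real.pi)]
  exact mul_le_mul_of_nonneg_left (Real.exp_le_exp.mpr h2) (Real.sqrt_nonneg _)

theorem gFT_nonneg (v : ℝ) : 0 ≤ gFT v := by
  unfold gFT
  positivity

/-- for every c > 0 and η ∈ [1,3],
(8/π) ĝ(c(η−1)) ≥ 2 Σ_{l=1}^∞ (2/((4l−1)π) − 2/((4l+1)π)) (ĝ(c(4l−1+η)) + ĝ(c(4l+1−η))). -/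
theorem gaussian_tail_inequality (c : ℝ) (hc : 0 < c) (η : ℝ) (hη : η ∈ Set.Icc (1 : ℝ) 3) :
    (8 / Real.pi) * gFT (c * (η - 1)) ≥
      2 * ∑' l : ℕ, (2 / ((4 * (l : ℝ) + 3) * Real.pi) - 2 / ((4 * (l : ℝ) + 5) * Real.pi)) *
        (gFT (c * (4 * (l : ℝ) + 3 + η)) + gFT (c * (4 * (l : ℝ) + 5 - η))) := by
  obtain ⟨h1, h3⟩ := hη
  have hp := Real.pi_pos
  have hG := gFT_nonneg (c * (η - 1))
  set G := gFT (c * (η - 1)) with hGdef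
  have hcoef : ∀ l : ℕ, 0 ≤ 2 / ((4 * (l : ℝ) + 3) * Real.pi) - 2 / ((4 * (l : ℝ) + 5) * Real.pi) := by
    intro l
    have : 2 / ((4 * (l : ℝ) + 5) * Real.pi) ≤ 2 / ((4 * (l : ℝ) + 3) * Real.pi) := by
      gcongr
      norm_num
    linarith
  have hcoef2 : ∀ l : ℕ, 2 / ((4 * (l : ℝ) + 3) * Real.pi) - 2 / ((4 * (l : ℝ) + 5) * Real.pi)
      ≤ 2 / Real.pi * (1 / (4 * (l : ℝ) + 1) - 1 / (4 * (l : ℝ) + 5)) := by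
    intro l
    have h : 2 / ((4 * (l : ℝ) + 3) * Real.pi) ≤ 2 / ((4 * (l : ℝ) + 1) * Real.pi) := by
      gcongr
      norm_num
    have e : 2 / Real.pi * (1 / (4 * (l : ℝ) + 1) - 1 / (4 * (l : ℝ) + 5))
        = 2 / ((4 * (l : ℝ) + 1) * Real.pi) - 2 / ((4 * (l : ℝ) + 5) * Real.pi) := by
      field_simp
    linarith
  have key : ∑' l : ℕ, (2 / ((4 * (l : ℝ) + 3) * Real.pi) - 2 / ((4 * (l : ℝ) + 5) * Real.pi)) *
        (gFT (c * (4 * (l : ℝ) + 3 + η)) + gFT (c * (4 * (l : ℝ) + 5 - η))) ≤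
        4 / Real.pi * G := by
    apply Real.tsum_le_of_sum_range_le
    · intro l
      exact mul_nonneg (hcoef l) (add_nonneg (gFT_nonneg _) (gFT_nonneg _))
    · intro n
      have hs : ∀ n : ℕ, ∑ l ∈ Finset.range n,
          (2 / ((4 * (l : ℝ) + 3) * Real.pi) - 2 / ((4 * (l : ℝ) + 5) * Real.pi)) *
          (gFT (c * (4 * (l : ℝ) + 3 + η)) + gFT (c * (4 * (l : ℝ) + 5 - η))) ≤
          4 / Real.pi * G * (1 - 1 / (4 * (n : ℝ) + 1)) := by
        intro n
        induction n with
        | zero => simp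
        | succ n ih =>
          rw [Finset.sum_range_succ]
          have hn : (0 : ℝ) ≤ n := Nat.cast_nonneg n
          have a1 : gFT (c * (4 * (n : ℝ) + 3 + η)) ≤ G :=
            gFT_anti c _ _ hc (by linarith) (by linarith)
          have a2 : gFT (c * (4 * (n : ℝ) + 5 - η)) ≤ G :=
            gFT_anti c _ _ hc (by linarith) (by linarith)
          have a3 := mul_le_mul_of_nonneg_left (add_le_add a1 a2) (hcoef n)
          have a4 := mul_le_mul_of_nonneg_right (hcoef2 n) (add_nonneg hG hG)
          have e : 4 * ((n + 1 : ℕ) : ℝ) + 1 = 4 * (n : ℝ) + 5 := by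
            push_cast
            ring
          rw [e]
          have e2 : 2 / Real.pi * (1 / (4 * (n : ℝ) + 1) - 1 / (4 * (n : ℝ) + 5)) * (G + G)
            = 4 / Real.pi * G * (1 - 1 / (4 * (n : ℝ) + 5))
              - 4 / Real.pi * G * (1 - 1 / (4 * (n : ℝ) + 1)) := by ring
          linarith
      refine (hs n).trans ?_
      have : 0 ≤ 1 / (4 * (n : ℝ) + 1) := by positivity
      have h0 : 0 ≤ 4 / Real.pi * G := by positivity
      nlinarith [mul_nonneg h0 this]
  have e3 : 8 / Real.pi * G = 2 * (4 / Real.pi * G) := by ring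
  rw [e3]
  linarith

end
end
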